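/- Involution relation for the Griffiths polynomials of q-Racah type: for all nonnegative integers i, j, k, ℓ with i+j ≤ N and k+ℓ ≤ N, one has Σ_{x,y ≥ 0, x+y ≤ N} (c₁/c₀)^{x/2}·(c₄/c₁)^{y/2}·ξ_x(c₂,c₄)·ξ_y(c₀,c₃)·G_{i,j}(x,y;c₁,c₂,c₃,c₄;N)·G_{y,x}(k,ℓ;c₁,c₃,c₀,c₂;N) = δ_{i,k}·δ_{j,ℓ}·ω_N(qc₁c₂c₃)·[ω_j(c₃c₀c₄/c₂)/ω_i(c₂c₃)]·ξ_i(c₂,c₃)·ξ_j(c₀,c₄). (For the parameter list (c₁,c₃,c₀,c₂) the induced fifth parameter (q^{2N+3}c₁c₃c₀c₂)^{−1} equals c₄.) -/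

import Mathlib

noncomputable section
namespace qR

/-- q-Pochhammer symbol `(a;q)_k = ∏_{l<k} (1 - a qˡ)`. -/
def poch (q a : ℂ) (k : ℕ) : ℂ := ∏ l ∈ Finset.range k, (1 - a * q ^ l)

/-- q-binomial coefficient, zero outside `0 ≤ n ≤ N`. -/
def binom (q : ℂ) (N n : ℤ) : ℂ :=
  if 0 ≤ n ∧ n ≤ N then poch q q N.toNat / (poch q q n.toNat * poch q q (N - n).toNat) else 0

/-- Normalisation `Ω(n;c1,c2,c3;N)`; `s` and `t2` are the chosen square roots of `q` and `c2`,
so that `(q c2)^(n - N/2) = (s t2)^(2n - N)`. -/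
def Om (q s c1 c2 c3 t2 : ℂ) (N n : ℤ) : ℂ :=
  binom q N n * (1 - c2 * c3 * q ^ (2 * n + 1)) * poch q (q * c2) n.toNat
      * poch q (c1 * c2 * c3 * q ^ (N + 2)) n.toNat * poch q (q * c1) (N - n).toNat
    / ((s * t2) ^ (2 * n - N) * poch q (c2 * c3 * q ^ (n + 1)) (N + 1).toNat
        * poch q (q * c3) n.toNat)

/-- Normalised q-Racah polynomial `p_n(x;c1,c2,c3;N)`, with the convention that it
vanishes unless `0 ≤ n ≤ N` and `0 ≤ x ≤ N`. -/
def p (q s c1 c2 c3 t2 : ℂ) (N n x : ℤ) : ℂ :=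
  if 0 ≤ n ∧ n ≤ N ∧ 0 ≤ x ∧ x ≤ N then
    Om q s c1 c2 c3 t2 N n *
      ∑ k ∈ Finset.range (n.toNat + 1),
        poch q (q ^ (-n)) k * poch q (c2 * c3 * q ^ (n + 1)) k * poch q (q ^ (-x)) k
            * poch q (c1 * c2 * q ^ (x + 1)) k * q ^ k
          / (poch q (q * c2) k * poch q (c1 * c2 * c3 * q ^ (N + 2)) k
              * poch q (q ^ (-N)) k * poch q q k)
  else 0

/-- `ω_n(c) = (-1)^n c^{n/2} q^{n(n+1)/2}`, where `r` is the chosen square root of `c`. -/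
def om (q r : ℂ) (n : ℤ) : ℂ := (-1 : ℂ) ^ n * r ^ n * q ^ (n * (n + 1) / 2)

/-- `ξ_n(c1,c2) = ((qc1;q)_n/(qc2;q)_n) (c2/c1)^{n/2}`, where `t1, t2` are the chosen
square roots of `c1, c2`. -/
def xi (q c1 c2 t1 t2 : ℂ) (n : ℤ) : ℂ :=
  poch q (q * c1) n.toNat / poch q (q * c2) n.toNat * (t2 / t1) ^ n

/-- `λ(x;c) = -(1-q^{-x})(1-c q^{x+1})`. -/
def lam (q c : ℂ) (x : ℤ) : ℂ := -(1 - q ^ (-x)) * (1 - c * q ^ (x + 1))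

def PhiP (q c1 c2 c3 : ℂ) (N n : ℤ) : ℂ :=
  -c2 * q ^ (n - N) * (1 - q ^ n) * (1 - c1 * q ^ (N - n + 1)) * (1 - c2 * c3 * q ^ (n + N + 1))
      * (1 - c3 * q ^ n)
    / ((1 - c2 * c3 * q ^ (2 * n)) * (1 - c2 * c3 * q ^ (2 * n + 1)))

def PhiM (q c1 c2 c3 : ℂ) (N n : ℤ) : ℂ :=
  (1 - q ^ (n - N)) * (1 - c1 * c2 * c3 * q ^ (n + N + 2)) * (1 - c2 * q ^ (n + 1))
      * (1 - c2 * c3 * q ^ (n + 1))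
    / ((1 - c2 * c3 * q ^ (2 * n + 1)) * (1 - c2 * c3 * q ^ (2 * n + 2)))

/-- `Φ^ε(n;c1,c2,c3;N)`, where `ε = 1, -1, 0` selects `Φ⁺, Φ⁻, Φ⁰`. -/
def Phi (q c1 c2 c3 : ℂ) (N ε n : ℤ) : ℂ :=
  if ε = 1 then PhiP q c1 c2 c3 N n
  else if ε = -1 then PhiM q c1 c2 c3 N n
  else -PhiP q c1 c2 c3 N n - PhiM q c1 c2 c3 N n

/-- `λ₊(x;c1,c2,c3;N)`. -/
def lamP (q c1 c2 c3 : ℂ) (N x : ℤ) : ℂ :=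
  -(q ^ (-N - 1) / c3 - q ^ (-x)) * (1 - c1 * c2 * c3 * q ^ (N + x + 2))

/-- `λ₋(x;c1,c2,c3;N)`. -/
def lamM (q c1 c2 c3 : ℂ) (N x : ℤ) : ℂ :=
  -(q ^ (-N) - q ^ (-x)) * (1 - c1 * c2 * q ^ (N + x + 1))

def PhiPp (q sq c1 c2 c3 : ℂ) (N n : ℤ) : ℂ :=
  -sq * c2 * q ^ (2 * n - N - 1) * (1 - q ^ n) * (1 - c1 * q ^ (N - n + 1))
      * (1 - c1 * q ^ (N + 2 - n)) * (1 - c3 * q ^ n)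
    / ((1 - c2 * c3 * q ^ (2 * n)) * (1 - c2 * c3 * q ^ (2 * n + 1)))

def PhiPm (q sq c1 c2 c3 : ℂ) (N n : ℤ) : ℂ :=
  -((1 - c1 * c2 * c3 * q ^ (n + N + 2)) * (1 - c1 * c2 * c3 * q ^ (n + N + 3))
      * (1 - c2 * q ^ (n + 1)) * (1 - c2 * c3 * q ^ (n + 1)))
    / (c3 * q ^ (N + 1) * sq * (1 - c2 * c3 * q ^ (2 * n + 1)) * (1 - c2 * c3 * q ^ (2 * n + 2)))

def PhiP0 (q sq c1 c2 c3 : ℂ) (N n : ℤ) : ℂ :=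
  -PhiPp q sq c1 c2 c3 N n - PhiPm q sq c1 c2 c3 N n
    - (1 - c1 * c2 * q ^ (N + 2)) * (1 - c1 * c2 * c3 * q ^ (N + 2)) / (c3 * q ^ (N + 1) * sq)

def PhiMp (q sq c1 c2 c3 : ℂ) (N n : ℤ) : ℂ :=
  -sq * (1 - q ^ n) * (1 - c3 * q ^ n) * (1 - c2 * c3 * q ^ (n + N))
      * (1 - c2 * c3 * q ^ (n + N + 1))
    / (q ^ N * (1 - c2 * c3 * q ^ (2 * n)) * (1 - c2 * c3 * q ^ (2 * n + 1)))

def PhiMm (q sq c1 c2 c3 : ℂ) (N n : ℤ) : ℂ :=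
  -c3 * sq * q ^ N * (1 - q ^ (n - N)) * (1 - q ^ (n - N + 1)) * (1 - c2 * q ^ (n + 1))
      * (1 - c2 * c3 * q ^ (n + 1))
    / ((1 - c2 * c3 * q ^ (2 * n + 1)) * (1 - c2 * c3 * q ^ (2 * n + 2)))

def PhiM0 (q sq c1 c2 c3 : ℂ) (N n : ℤ) : ℂ :=
  -PhiMp q sq c1 c2 c3 N n - PhiMm q sq c1 c2 c3 N n - sq * (1 - c3 * q ^ N) * (q ^ (-N) - 1)

/-- Contiguity coefficient `Φ_σ^ε(n;c1,c2,c3;N)`, where `σ = 1` is the `+` and `σ = -1`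
the `-` family, `ε ∈ {1,0,-1}` selects the superscript, and `sq` is the chosen square
root of `q c2`. -/
def PhiC (q sq c1 c2 c3 : ℂ) (σ ε N n : ℤ) : ℂ :=
  if σ = 1 then
    if ε = 1 then PhiPp q sq c1 c2 c3 N n
    else if ε = -1 then PhiPm q sq c1 c2 c3 N n
    else PhiP0 q sq c1 c2 c3 N n
  else
    if ε = 1 then PhiMp q sq c1 c2 c3 N n
    else if ε = -1 then PhiMm q sq c1 c2 c3 N n
    else PhiM0 q sq c1 c2 c3 N n

def Fp (q c1 c2 : ℂ) (x : ℤ) : ℂ :=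
  c1 * c2 ^ 2 * q ^ (x + 1) * (1 - c1 * q ^ x) * (1 - q ^ x)
    / ((1 - c1 * c2 * q ^ (2 * x)) * (1 - c1 * c2 * q ^ (2 * x + 1)))

def Fm (q c1 c2 : ℂ) (x : ℤ) : ℂ :=
  c1 * c2 * q ^ (x + 1) * (1 - c2 * q ^ (x + 1)) * (1 - c1 * c2 * q ^ (x + 1))
    / ((1 - c1 * c2 * q ^ (2 * x + 1)) * (1 - c1 * c2 * q ^ (2 * x + 2)))

/-- The coefficients `A^{ε,ε'}_{i,j}(c1,c2,c3,c4;N)` for `(ε,ε') ≠ (0,0)`;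
`t2` is the chosen square root of `c2` and the fifth parameter
`c0 = (q^{2N+3} c1 c2 c3 c4)⁻¹` is computed internally. -/
def Aaux (q s c1 c2 c3 c4 t2 : ℂ) (N ε ε' i j : ℤ) : ℂ :=
  if ε' = 1 ∨ ε' = -1 then
    -c3 * q ^ (N + 1) *
        (if ε' = 1 then Fp q c4 ((q ^ (2 * N + 3) * c1 * c2 * c3 * c4)⁻¹) j
         else Fm q c4 ((q ^ (2 * N + 3) * c1 * c2 * c3 * c4)⁻¹) j) *
        PhiC q (s * t2) c1 c2 c3 ε' ε (N - j) i
  else if ε = 1 ∨ ε = -1 then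
    c3 * q ^ (N + 1) *
        (Fp q c4 ((q ^ (2 * N + 3) * c1 * c2 * c3 * c4)⁻¹) j
          + Fm q c4 ((q ^ (2 * N + 3) * c1 * c2 * c3 * c4)⁻¹) j) *
        Phi q c1 c2 c3 (N - j) ε i
  else 0

/-- The coefficients `A^{ε,ε'}_{i,j}(c1,c2,c3,c4;N)`. -/
def A (q s c1 c2 c3 c4 t2 : ℂ) (N ε ε' i j : ℤ) : ℂ :=
  if ε = 0 ∧ ε' = 0 then
    -((1 - c3 * q ^ (N + 1 - j)) * (s * t2) / (1 - c1 * c2 * q ^ (N + 2 - j)))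
          * ∑ e ∈ ({-1, 0, 1} : Finset ℤ), Aaux q s c1 c2 c3 c4 t2 N e 1 i j
      - (1 - c1 * c2 * q ^ (N + 1 - j)) / ((1 - c3 * q ^ (N - j)) * (s * t2))
          * ∑ e ∈ ({-1, 0, 1} : Finset ℤ), Aaux q s c1 c2 c3 c4 t2 N e (-1) i j
      - ∑ e ∈ ({-1, 1} : Finset ℤ), Aaux q s c1 c2 c3 c4 t2 N e 0 i j
  else Aaux q s c1 c2 c3 c4 t2 N ε ε' i j

/-- `Λ(x;c1,c2,c3,c4;N)`; `s, t1, t2, t3, t4` are the chosen square roots of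
`q, c1, c2, c3, c4`. -/
def Lam (q s c1 c2 c3 c4 t1 t2 t3 t4 : ℂ) (N x : ℤ) : ℂ :=
  (-1 : ℂ) ^ x * binom q N x * (1 - c1 * c2 * q ^ (2 * x + 1)) * poch q (q * c2) x.toNat
      * (s * t2) ^ N * (t1 * t3 / (t2 * t4)) ^ x * q ^ (x * (x - 1) / 2)
    / (poch q (q * c1) x.toNat * poch q (q ^ (x + 1) * c1 * c2) (N + 1).toNat)

/-- Tratnik polynomial of q-Racah type `T_{i,j}(x,y;c1,c2,c3,c4;N)`; the fifth parameter
`c0 = (q^{2N+3} c1 c2 c3 c4)⁻¹` and its square root `t0 = (s^{2N+3} t1 t2 t3 t4)⁻¹`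
are computed internally. -/
def T (q s c1 c2 c3 c4 t1 t2 t3 t4 : ℂ) (N i j x y : ℤ) : ℂ :=
  if 0 ≤ i ∧ 0 ≤ j ∧ i + j ≤ N then
    p q s c1 c2 c3 t2 (N - j) i x *
      p q s c3 ((q ^ (2 * N + 3) * c1 * c2 * c3 * c4)⁻¹) c4
        ((s ^ (2 * N + 3) * t1 * t2 * t3 * t4)⁻¹) (N - x) j y
  else 0

/-- Griffiths polynomial of q-Racah type `G_{i,j}(x,y;c1,c2,c3,c4;N)`; the fifth parameter
`c0 = (q^{2N+3} c1 c2 c3 c4)⁻¹` and its square root `t0 = (s^{2N+3} t1 t2 t3 t4)⁻¹`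
are computed internally. -/
def G (q s c1 c2 c3 c4 t1 t2 t3 t4 : ℂ) (N i j x y : ℤ) : ℂ :=
  if 0 ≤ i ∧ 0 ≤ j ∧ i + j ≤ N then
    ∑ a ∈ Finset.range ((min (N - j) (N - y)).toNat + 1),
      om q (t1 * t2 * t3 / t4) (a : ℤ) * p q s c1 c2 c3 t2 (N - j) i (a : ℤ) *
        p q s c3 ((q ^ (2 * N + 3) * c1 * c2 * c3 * c4)⁻¹) c4
          ((s ^ (2 * N + 3) * t1 * t2 * t3 * t4)⁻¹) (N - (a : ℤ)) j y *
        p q s c4 c2 c1 t2 (N - y) (a : ℤ) x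
  else 0

end qR

set_option linter.all false
namespace qR
lemma poch_zero (q a : ℂ) : poch q a 0 = 1 := by simp [poch]
lemma poch_succ (q a : ℂ) (k : ℕ) : poch q a (k+1) = poch q a k*(1-a*q^k) := by
  simp [poch, Finset.prod_range_succ]
lemma poch_succ' (q a : ℂ) (k : ℕ) : poch q a (k+1) = (1-a)*poch q (a*q) k := by
  simp only [poch, Finset.prod_range_succ', pow_zero, mul_one]
  rw [mul_comm]; congr 1; apply Finset.prod_congr rfl; intros; ring
/-- shift -/
lemma poch_shift (q a : ℂ) (k : ℕ) : (1-a)*poch q (a*q) k = poch q a k*(1-a*q^k) := by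
  rw [← poch_succ', poch_succ]
lemma poch_add (q a : ℂ) (m k : ℕ) : poch q a (m+k) = poch q a m*poch q (a*q^m) k := by
  induction k with
  | zero => simp [poch_zero]
  | succ k ih => rw [← add_assoc, poch_succ, ih, poch_succ]; ring
lemma poch_ne_of_le {q a : ℂ} {m k : ℕ} (h : poch q a k ≠ 0) (hm : m ≤ k) : poch q a m ≠ 0 := by
  obtain ⟨d, rfl⟩ := Nat.exists_eq_add_of_le hm
  rw [poch_add] at h; exact left_ne_zero_of_mul h
lemma poch_ne {q a : ℂ} {k : ℕ} (h : ∀ l < k, a*q^l ≠ 1) : poch q a k ≠ 0 := by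
  rw [poch, Finset.prod_ne_zero_iff]; intro l hl
  exact sub_ne_zero.2 (Ne.symm (h l (Finset.mem_range.1 hl)))
lemma poch_eq_zero {q a : ℂ} {k l : ℕ} (h : a*q^l = 1) (hl : l < k) : poch q a k = 0 := by
  rw [poch, Finset.prod_eq_zero_iff]; exact ⟨l, Finset.mem_range.2 hl, by rw [h, sub_self]⟩
def tm (q A B C D E F G : ℂ) (k : ℕ) : ℂ :=
  poch q A k*poch q B k*poch q C k*poch q D k*q^k /
    (poch q E k*poch q F k*poch q G k*poch q q k)
def S4 (q A B C D E F G : ℂ) (K : ℕ) : ℂ := ∑ k ∈ Finset.range K, tm q A B C D E F G k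
lemma S4_trunc {q A B C D E F G : ℂ} {K l : ℕ} (h : A*q^l = 1 ∨ C*q^l = 1) (hl : l < K) :
    S4 q A B C D E F G K = S4 q A B C D E F G (l+1) := by
  unfold S4
  rw [← Finset.sum_subset (Finset.range_subset_range.2 hl)]
  intro k hk hk'
  rw [Finset.mem_range] at hk hk'
  have hlk : l < k := by omega
  unfold tm
  rcases h with h | h <;> rw [poch_eq_zero h hlk] <;> simp
lemma S4_one (q A B C D E F G : ℂ) : S4 q A B C D E F G 1 = 1 := by
  simp [S4, tm, poch_zero]
/-- affine sums -/
def aff (q A B C D E F G u : ℂ) (K : ℕ) : ℂ :=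
  ∑ k ∈ Finset.range K, tm q A B C D E F G k*(1-u*q^k)
lemma aff_rel (q A B C D E F G u v w : ℂ) (K : ℕ) :
    (v-w)*aff q A B C D E F G u K+(w-u)*aff q A B C D E F G v K
      + (u-v)*aff q A B C D E F G w K = 0 := by
  simp only [aff, Finset.mul_sum, ← Finset.sum_add_distrib]
  apply Finset.sum_eq_zero; intros; ring
lemma aff_C (q A B C D E F G : ℂ) (K : ℕ) :
    aff q A B C D E F G C K = (1-C)*S4 q A B (C*q) D E F G K := by
  simp only [aff, S4, Finset.mul_sum]
  apply Finset.sum_congr rfl; intro k _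
  have := poch_shift q C k
  simp only [tm]
  linear_combination (-(poch q A k*poch q B k*poch q D k*q^k /
    (poch q E k*poch q F k*poch q G k*poch q q k)))*this
lemma aff_D (q A B C D E F G : ℂ) (K : ℕ) :
    aff q A B C D E F G D K = (1-D)*S4 q A B C (D*q) E F G K := by
  simp only [aff, S4, Finset.mul_sum]
  apply Finset.sum_congr rfl; intro k _
  have := poch_shift q D k
  simp only [tm]
  linear_combination (-(poch q A k*poch q B k*poch q C k*q^k /
    (poch q E k*poch q F k*poch q G k*poch q q k)))*this
/-- lower parameter: base has `F*q`, target has `F`. -/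
lemma aff_F (q A B C D E F G : ℂ) (K : ℕ) (hF : ∀ k < K, poch q (F*q) k ≠ 0)
    (hF' : ∀ k < K, poch q F k ≠ 0) :
    aff q A B C D E (F*q) G F K = (1-F)*S4 q A B C D E F G K := by
  simp only [aff, S4, Finset.mul_sum]
  apply Finset.sum_congr rfl; intro k hk
  have := poch_shift q F k
  have h1 := hF k (Finset.mem_range.1 hk)
  have h2 := hF' k (Finset.mem_range.1 hk)
  have e : (1-F*q^k) / poch q (F*q) k = (1-F) / poch q F k := by
    rw [div_eq_div_iff h1 h2]; linear_combination -this
  simp only [tm]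
  calc _ = poch q A k*poch q B k*poch q C k*poch q D k*q^k / (poch q E k*poch q G k*poch q q k)
        * ((1-F*q^k) / poch q (F*q) k) := by ring
    _ = _ := by rw [e]; ring
lemma S4_swapFG (q A B C D E F G : ℂ) (K : ℕ) : S4 q A B C D E F G K = S4 q A B C D E G F K := by
  simp only [S4, tm]; apply Finset.sum_congr rfl; intros; ring
lemma S4_swap (q A B C D E F G : ℂ) (K : ℕ) : S4 q A B C D E F G K = S4 q C D A B E F G K := by
  simp only [S4, tm]; apply Finset.sum_congr rfl; intros; ring
/-- backward shift, partial sums -/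
lemma BS_partial (q A B C D E F G : ℂ) (hq : q ≠ 0) (hb : A*B*C*D*q = E*F*G) (K : ℕ)
    (hE : poch q E (K+1) ≠ 0) (hF : poch q F (K+1) ≠ 0) (hG : poch q G (K+1) ≠ 0)
    (hQ : poch q q K ≠ 0) :
    D*(C-E)*(C-F)*(C-G)*(1-D)*S4 q (A*q) (B*q) C (D*q) (E*q) (F*q) (G*q) (K+1)
      - C*(D-E)*(D-F)*(D-G)*(1-C)*S4 q (A*q) (B*q) (C*q) D (E*q) (F*q) (G*q) (K+1)
    = C*D*(C-D)*((1-E)*(1-F)*(1-G)*S4 q A B C D E F G (K+1)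
        + tm q (A*q) (B*q) C D (E*q) (F*q) (G*q) K*(1-C*q^K)*(1-D*q^K)*(q*A*B-(q^K)⁻¹)) := by
  have key : ∀ Z : ℂ, (D*(C-E)*(C-F)*(C-G)*(1-D*Z)-C*(D-E)*(D-F)*(D-G)*(1-C*Z))*Z
      = C*D*(C-D)*((1-E*Z)*(1-F*Z)*(1-G*Z)+(1-C*Z)*(1-D*Z)*(q*A*B*Z-1)) := by
    intro Z; linear_combination (-(C*D*(C-D)*Z^3)-(C-D)*Z*(1-(C+D)*Z))*hb
  rw [mul_assoc _ (1-D), ← aff_D, mul_assoc _ (1-C), ← aff_C]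
  induction K with
  | zero =>
    have := key 1
    simp [aff, S4, tm, poch_zero]
    linear_combination this
  | succ k ih =>
    have ih := ih (poch_ne_of_le hE (by omega)) (poch_ne_of_le hF (by omega))
      (poch_ne_of_le hG (by omega)) (poch_ne_of_le hQ (by omega))
    have hqk : q^k ≠ 0 := pow_ne_zero _ hq
    set m := tm q (A*q) (B*q) C D (E*q) (F*q) (G*q) k with hm
    set m' := tm q (A*q) (B*q) C D (E*q) (F*q) (G*q) (k+1) with hm'
    set L := tm q A B C D E F G (k+1) with hL
    rw [poch_succ'] at hE hF hG
    rw [poch_succ] at hQ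
    have hE2 := right_ne_zero_of_mul hE
    have hF2 := right_ne_zero_of_mul hF
    have hG2 := right_ne_zero_of_mul hG
    have hE1 := left_ne_zero_of_mul hE
    have hF1 := left_ne_zero_of_mul hF
    have hG1 := left_ne_zero_of_mul hG
    have hQ1 := left_ne_zero_of_mul hQ
    have hQ2 := right_ne_zero_of_mul hQ
    rw [poch_succ] at hE2 hF2 hG2
    have hE3 := left_ne_zero_of_mul hE2
    have hF3 := left_ne_zero_of_mul hF2
    have hG3 := left_ne_zero_of_mul hG2
    have hE4 := right_ne_zero_of_mul hE2
    have hF4 := right_ne_zero_of_mul hF2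
    have hG4 := right_ne_zero_of_mul hG2
    have h1 : m'*((1-E*(q*q^k))*(1-F*(q*q^k))*(1-G*(q*q^k))*(1-q*q^k))
        = m*((1-A*(q*q^k))*(1-B*(q*q^k))*(1-C*q^k)*(1-D*q^k)*q) := by
      rw [hm, hm']
      simp only [tm, poch_succ, pow_succ]
      have e1 : 1-E*(q*q^k) = 1-E*q*q^k := by ring
      have e2 : 1-F*(q*q^k) = 1-F*q*q^k := by ring
      have e3 : 1-G*(q*q^k) = 1-G*q*q^k := by ring
      rw [e1, e2, e3]
      rw [div_mul_eq_mul_div, div_mul_eq_mul_div, div_eq_div_iff (by simp [*]) (by simp [*])]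
      ring
    have h2 : (1-E)*(1-F)*(1-G)*L*(1-q*q^k) = (1-A)*(1-B)*(1-C*q^k)*(1-D*q^k)*q*m := by
      rw [hm, hL]
      simp only [tm]
      rw [poch_succ' q A, poch_succ' q B, poch_succ' q E, poch_succ' q F, poch_succ' q G,
        poch_succ q C, poch_succ q D, poch_succ q q, pow_succ]
      rw [mul_div_assoc', mul_div_assoc', div_mul_eq_mul_div, div_eq_div_iff (by simp [*]) (by simp [*])]
      ring
    have k1 := key (q*q^k)
    have e4 : aff q (A*q) (B*q) C D (E*q) (F*q) (G*q) D (k+1+1) = aff q (A*q) (B*q) C D (E*q) (F*q) (G*q) D (k+1)+m'*(1-D*(q*q^k)) := by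
      rw [aff, Finset.sum_range_succ, ← aff, pow_succ, mul_comm q]
    have e5 : aff q (A*q) (B*q) C D (E*q) (F*q) (G*q) C (k+1+1) = aff q (A*q) (B*q) C D (E*q) (F*q) (G*q) C (k+1)+m'*(1-C*(q*q^k)) := by
      rw [aff, Finset.sum_range_succ, ← aff, pow_succ, mul_comm q]
    have e6 : S4 q A B C D E F G (k+1+1) = S4 q A B C D E F G (k+1)+L := by
      rw [S4, Finset.sum_range_succ, ← S4]
    rw [e4, e5, e6, pow_succ, mul_comm (q^k) q]
    have h3 : ((1-E)*(1-F)*(1-G)*L-m*(1-C*q^k)*(1-D*q^k)*(q*A*B-(q^k)⁻¹))*(q*q^k)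
        = m'*((1-E*(q*q^k))*(1-F*(q*q^k))*(1-G*(q*q^k))) := by
      apply mul_right_cancel₀ hQ2
      have : (q^k)⁻¹*q^k = 1 := inv_mul_cancel₀ hqk
      linear_combination (q*q^k)*h2-h1+m*(1-C*q^k)*(1-D*q^k)*q*(1-q*q^k)*this
    have hqq : q*q^k ≠ 0 := mul_ne_zero hq hqk
    have h4 : (q*q^k)⁻¹*(q*q^k) = 1 := inv_mul_cancel₀ hqq
    apply mul_right_cancel₀ hqq
    linear_combination (q*q^k)*ih+m'*k1-C*D*(C-D)*h3+C*D*(C-D)*m'*(1-C*(q*q^k))*(1-D*(q*q^k))*h4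
lemma BS (q A B C D E F G : ℂ) (hq : q ≠ 0) (hb : A*B*C*D*q = E*F*G) (K : ℕ)
    (hE : poch q E (K+1) ≠ 0) (hF : poch q F (K+1) ≠ 0) (hG : poch q G (K+1) ≠ 0)
    (hQ : poch q q (K+1) ≠ 0) (hA : A*q^(K+1) = 1) :
    D*(C-E)*(C-F)*(C-G)*(1-D)*S4 q (A*q) (B*q) C (D*q) (E*q) (F*q) (G*q) (K+1)
      - C*(D-E)*(D-F)*(D-G)*(1-C)*S4 q (A*q) (B*q) (C*q) D (E*q) (F*q) (G*q) (K+1)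
    = C*D*(C-D)*((1-E)*(1-F)*(1-G)*S4 q A B C D E F G (K+2)) := by
  rw [BS_partial q A B C D E F G hq hb K hE hF hG (poch_ne_of_le hQ (by omega))]
  have hqk : q^K ≠ 0 := pow_ne_zero _ hq
  rw [poch_succ'] at hE hF hG
  rw [poch_succ] at hQ
  have hE1 := left_ne_zero_of_mul hE
  have hF1 := left_ne_zero_of_mul hF
  have hG1 := left_ne_zero_of_mul hG
  have hE2 := right_ne_zero_of_mul hE
  have hF2 := right_ne_zero_of_mul hF
  have hG2 := right_ne_zero_of_mul hG
  have hQ1 := left_ne_zero_of_mul hQ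
  have hQ2 := right_ne_zero_of_mul hQ
  set m := tm q (A*q) (B*q) C D (E*q) (F*q) (G*q) K with hm
  have h2 : (1-E)*(1-F)*(1-G)*(tm q A B C D E F G (K+1))*(1-q*q^K) = (1-A)*(1-B)*(1-C*q^K)*(1-D*q^K)*q*m := by
    rw [hm]
    simp only [tm]
    rw [poch_succ' q A, poch_succ' q B, poch_succ' q E, poch_succ' q F, poch_succ' q G,
      poch_succ q C, poch_succ q D, poch_succ q q, pow_succ]
    rw [mul_div_assoc', mul_div_assoc', div_mul_eq_mul_div, div_eq_div_iff (by simp [*]) (by simp [*])]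
    ring
  have e6 : S4 q A B C D E F G (K+2) = S4 q A B C D E F G (K+1)+tm q A B C D E F G (K+1) := by
    rw [S4, Finset.sum_range_succ, ← S4]
  rw [e6]
  have hqq : q*q^K ≠ 0 := mul_ne_zero hq hqk
  have hA' : A = (q*q^K)⁻¹ := by
    apply eq_inv_of_mul_eq_one_left; rw [mul_comm q, ← pow_succ, hA]
  have : m*(1-C*q^K)*(1-D*q^K)*(q*A*B-(q^K)⁻¹) = (1-E)*(1-F)*(1-G)*(tm q A B C D E F G (K+1)) := by
    apply mul_right_cancel₀ hQ2
    rw [h2, hA']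
    field_simp
    ring
  linear_combination C*D*(C-D)*this
end qR
namespace qR
/-- forward shift -/
lemma FS (q A B C D E F G : ℂ) (K : ℕ)
    (hE : poch q E K ≠ 0) (hF : poch q F K ≠ 0) (hG : poch q G K ≠ 0)
    (hQ : poch q q K ≠ 0) :
    (1-E)*(1-F)*(1-G)*(S4 q A B (C*q) D E F G (K+1)-S4 q A B C (D*q) E F G (K+1))
    = (C-D)*(1-A)*(1-B)*q*S4 q (A*q) (B*q) (C*q) (D*q) (E*q) (F*q) (G*q) K := by
  rw [S4, S4, Finset.sum_range_succ', Finset.sum_range_succ']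
  have h0 : tm q A B (C*q) D E F G 0 = tm q A B C (D*q) E F G 0 := by simp [tm, poch_zero]
  rw [h0, add_sub_add_right_eq_sub, ← Finset.sum_sub_distrib, S4, Finset.mul_sum, Finset.mul_sum]
  apply Finset.sum_congr rfl
  intro k hk
  rw [Finset.mem_range] at hk
  have hE := poch_ne_of_le (m := k+1) hE (by omega)
  have hF := poch_ne_of_le (m := k+1) hF (by omega)
  have hG := poch_ne_of_le (m := k+1) hG (by omega)
  have hQ := poch_ne_of_le (m := k+1) hQ (by omega)
  simp only [tm]
  rw [poch_succ'] at hE hF hG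
  rw [poch_succ] at hQ
  have hE1 := left_ne_zero_of_mul hE
  have hF1 := left_ne_zero_of_mul hF
  have hG1 := left_ne_zero_of_mul hG
  have hE2 := right_ne_zero_of_mul hE
  have hF2 := right_ne_zero_of_mul hF
  have hG2 := right_ne_zero_of_mul hG
  have hQ1 := left_ne_zero_of_mul hQ
  have hQ2 := right_ne_zero_of_mul hQ
  rw [poch_succ' q A, poch_succ' q B, poch_succ' q E, poch_succ' q F, poch_succ' q G,
    poch_succ q (C*q), poch_succ' q C, poch_succ q (D*q), poch_succ' q D, poch_succ q q, pow_succ,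
    ← sub_div, mul_div_assoc', mul_div_assoc', div_eq_div_iff (by simp [*]) (by simp [*])]
  ring
lemma TII_partial (q A B C D E F G : ℂ) (hq : q ≠ 0) (hb : A*B*C*D*q^2 = E*F*G) (K : ℕ)
    (hE : poch q E K ≠ 0) (hF : poch q F (K+1) ≠ 0) (hG : poch q G K ≠ 0)
    (hQ : poch q q K ≠ 0) :
    q^2*(F-A)*(F-D)*B*C*(C-B)*S4 q A D (B*q) (C*q) E (F*q) G (K+1)
    = F*(1-F)* (C*(B*q-E)*(B*q-G)*S4 q A D B (C*q) E F G (K+1)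
       - B*(C*q-E)*(C*q-G)*S4 q A D (B*q) C E F G (K+1))
      + q^2*F*B*C*(C-B)*tm q A D (B*q) (C*q) E (F*q) G K *(1-A*q^K)*(1-D*q^K)*(q^K)⁻¹ := by
  have key : ∀ Z, q^2*F*B*C*(C-B)*(1-A*Z)*(1-D*Z)*(1-B*Z)*(1-C*Z)
      - F*B*C*(C-B)*(q-E*Z)*(1-F*Z)*(q-G*Z)*(1-Z)
      = Z*(q^2*(F-A)*(F-D)*B*C*(C-B)*(1-B*Z)*(1-C*Z)
        - F*(C*(B*q-E)*(B*q-G)*(1-B)*(1-C*Z)*(1-F*Z)-B*(C*q-E)*(C*q-G)*(1-C)*(1-B*Z)*(1-F*Z))) := by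
    intro Z
    linear_combination (-(C-B)*Z*(1-F*Z)*(1-B*Z)*(1-C*Z))*hb
  induction K with
  | zero =>
    have := key 1
    simp [S4, tm, poch_zero]
    linear_combination -this+(1-F)*(C^2-B*C^2-B^2+B^2*C)*hb
  | succ k ih =>
    have ih := ih (poch_ne_of_le hE (by omega)) (poch_ne_of_le hF (by omega))
      (poch_ne_of_le hG (by omega)) (poch_ne_of_le hQ (by omega))
    have e1 : ∀ A B C D E F G, S4 q A B C D E F G (k+1+1) = S4 q A B C D E F G (k+1)+tm q A B C D E F G (k+1) := by
      intros; rw [S4, Finset.sum_range_succ, ← S4]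
    rw [e1, e1, e1]
    have hqk : q^k ≠ 0 := pow_ne_zero _ hq
    have hE := poch_ne_of_le (m := k+1) hE (by omega)
    have hF := poch_ne_of_le (m := k+1+1) hF (by omega)
    have hG := poch_ne_of_le (m := k+1) hG (by omega)
    have hQ := poch_ne_of_le (m := k+1) hQ (by omega)
    rw [poch_succ] at hE hG hQ
    rw [poch_succ'] at hF
    have hE1 := left_ne_zero_of_mul hE
    have hF1 := left_ne_zero_of_mul hF
    have hG1 := left_ne_zero_of_mul hG
    have hE2 := right_ne_zero_of_mul hE
    have hF2 := right_ne_zero_of_mul hF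
    have hG2 := right_ne_zero_of_mul hG
    have hQ1 := left_ne_zero_of_mul hQ
    have hQ2 := right_ne_zero_of_mul hQ
    rw [poch_succ] at hF2
    have hF3 := left_ne_zero_of_mul hF2
    have hF4 := right_ne_zero_of_mul hF2
    set m := tm q A D (B*q) (C*q) E (F*q) G k with hm
    -- base term
    set w := poch q A (k+1)*poch q D (k+1)*poch q (B*q) k*poch q (C*q) k*q^k*q /
      (poch q E (k+1)*poch q (F*q) (k+1)*poch q G (k+1)*poch q q (k+1)) with hw
    have t1 : tm q A D (B*q) (C*q) E (F*q) G (k+1) = w*(1-B*(q*q^k))*(1-C*(q*q^k)) := by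
      rw [hw]; simp only [tm, poch_succ q (B*q), poch_succ q (C*q), pow_succ]; ring
    have t2 : (1-F)*tm q A D B (C*q) E F G (k+1) = w*(1-B)*(1-C*(q*q^k))*(1-F*(q*q^k)) := by
      rw [hw]; simp only [tm, poch_succ' q B, poch_succ q (C*q), pow_succ, poch_succ' q F k, poch_succ q (F*q), poch_succ q E, poch_succ q G, poch_succ q q]
      have : 1-F*(q*q^k) = 1-F*q*q^k := by ring
      rw [this, mul_div_assoc', div_mul_eq_mul_div, div_mul_eq_mul_div, div_mul_eq_mul_div, div_eq_div_iff (by simp [*]) (by simp [*])]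
      ring
    have t3 : (1-F)*tm q A D (B*q) C E F G (k+1) = w*(1-B*(q*q^k))*(1-C)*(1-F*(q*q^k)) := by
      rw [hw]; simp only [tm, poch_succ' q C, poch_succ q (B*q), pow_succ, poch_succ' q F k, poch_succ q (F*q), poch_succ q E, poch_succ q G, poch_succ q q]
      have : 1-F*(q*q^k) = 1-F*q*q^k := by ring
      rw [this, mul_div_assoc', div_mul_eq_mul_div, div_mul_eq_mul_div, div_mul_eq_mul_div, div_eq_div_iff (by simp [*]) (by simp [*])]
      ring
    have t4 : m*(1-A*q^k)*(1-D*q^k)*q = w*((1-E*q^k)*(1-F*(q*q^k))*(1-G*q^k)*(1-q*q^k)) := by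
      rw [hw, hm]; simp only [tm, poch_succ, pow_succ]
      have : 1-F*(q*q^k) = 1-F*q*q^k := by ring
      rw [this, div_mul_eq_mul_div, div_mul_eq_mul_div, div_mul_eq_mul_div, div_mul_eq_mul_div, div_eq_div_iff (by simp [*]) (by simp [*])]
      ring
    rw [t1, pow_succ q k, mul_comm (q^k) q]
    have k1 := key (q*q^k)
    have hqq : q*q^k ≠ 0 := mul_ne_zero hq hqk
    have h4 : (q*q^k)⁻¹*(q*q^k) = 1 := inv_mul_cancel₀ hqq
    have h5 : (q^k)⁻¹*(q^k) = 1 := inv_mul_cancel₀ hqk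
    apply mul_right_cancel₀ hqq
    linear_combination (q*q^k)*ih-F*C*(B*q-E)*(B*q-G)*(q*q^k)*t2+F*B*(C*q-E)*(C*q-G)*(q*q^k)*t3-w*k1
      + q^2*F*B*C*(C-B)*t4-q^2*F*B*C*(C-B)*w*(1-B*(q*q^k))*(1-C*(q*q^k))*(1-A*(q*q^k))*(1-D*(q*q^k))*h4
      + q^2*F*B*C*(C-B)*m*(1-A*q^k)*(1-D*q^k)*q*h5
lemma TII (q A B C D E F G : ℂ) (hq : q ≠ 0) (hb : A*B*C*D*q^2 = E*F*G) (K : ℕ)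
    (hE : poch q E K ≠ 0) (hF : poch q F (K+1) ≠ 0) (hG : poch q G K ≠ 0)
    (hQ : poch q q K ≠ 0) (hA : A*q^K = 1 ∨ D*q^K = 1) :
    q^2*(F-A)*(F-D)*B*C*(C-B)*S4 q A D (B*q) (C*q) E (F*q) G (K+1)
    = F*(1-F)* (C*(B*q-E)*(B*q-G)*S4 q A D B (C*q) E F G (K+1)
       - B*(C*q-E)*(C*q-G)*S4 q A D (B*q) C E F G (K+1)) := by
  rw [TII_partial q A B C D E F G hq hb K hE hF hG hQ]
  rcases hA with h | h <;> rw [h] <;> simp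
end qR
namespace qR
def hh (q g v : ℂ) (k : ℕ) : ℂ := ∏ l ∈ Finset.range k, (g-v*q^l)
lemma hh_zero (q g v : ℂ) : hh q g v 0 = 1 := by simp [hh]
lemma hh_succ (q g v : ℂ) (k : ℕ) : hh q g v (k+1) = hh q g v k*(g-v*q^k) := by
  simp [hh, Finset.prod_range_succ]
lemma hh_succ' (q g v : ℂ) (k : ℕ) : hh q g v (k+1) = (g-v)*hh q g (v*q) k := by
  simp only [hh, Finset.prod_range_succ', pow_zero, mul_one]
  rw [mul_comm]; congr 1; apply Finset.prod_congr rfl; intros; ring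
/-- sigma -/
def sg (q d : ℂ) (y : ℕ) : ℂ := ∏ l ∈ Finset.range y, (-d*q^(l+2))⁻¹
lemma sg_zero (q d : ℂ) : sg q d 0 = 1 := by simp [sg]
lemma sg_succ (q d : ℂ) (k : ℕ) : sg q d (k+1) = sg q d k*(-d*q^(k+2))⁻¹ := by
  simp [sg, Finset.prod_range_succ]
def e65 (q d g u v : ℂ) (N y : ℕ) : ℂ :=
  sg q d y*poch q u (N-y)*poch q (d*q^(N+1)*u) y*hh q g v (N-y)*hh q g (d*q^(N+1)*v) y
   / (poch q q y*poch q q (N-y)*poch q (d*q^(y+1)) (N+1))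
lemma sum65_partial (q d g u v : ℂ) (hq : q ≠ 0) (hd : d ≠ 0) (N : ℕ)
    (hq1 : ∀ k, 1 ≤ k → k ≤ N+1 → q^k ≠ 1) (hd1 : ∀ k, 1 ≤ k → k ≤ 2*N+3 → d*q^k ≠ 1) (Y : ℕ) (hY : Y ≤ N) :
    ∑ y ∈ Finset.range (Y+1), ((1-q^(N+1))*(-d*q^(N+2))*((1-d*q^(2*y+1))*e65 q d g u v (N+1) y)
        - (g-d*u*v*q^(N+2))*((1-d*q^(2*y+1))*e65 q d g (u*q) (v*q) N y))
     = -e65 q d g (u*q) (v*q) N Y*(1-d*q^(Y+1))*(1-d*q^(N+Y+2)*u)*(g-d*q^(N+Y+2)*v)/(1-d*q^(N+Y+2)) := by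
  induction Y with
  | zero =>
    have h1 : (1:ℂ)-d*q^(N+2) ≠ 0 := sub_ne_zero.2 (hd1 _ (by omega) (by omega)).symm
    have h2 : (1:ℂ)-q^(N+1) ≠ 0 := sub_ne_zero.2 (hq1 _ (by omega) (by omega)).symm
    have h3 : poch q (d*q) (N+1) ≠ 0 := by
      apply poch_ne; intro l hl
      rw [mul_assoc, ← pow_succ']; exact hd1 _ (by omega) (by omega)
    have h4 : poch q q N ≠ 0 := by
      apply poch_ne; intro l hl; rw [← pow_succ']; exact hq1 _ (by omega) (by omega)
    rw [Finset.sum_range_one]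
    simp only [e65, sg_zero, hh_zero, poch_zero, Nat.sub_zero, zero_add, mul_zero, add_zero, pow_one]
    rw [poch_succ' q u, hh_succ', poch_succ q q, poch_succ q (d*q) (N+1), ← pow_succ', mul_assoc d q, ← pow_succ', show N+1+1 = N+2 from rfl]
    have r1 : 1-d*q^(N+2) = 1-d*q*q^(N+1) := by ring
    generalize poch q (d*q) (N+1) = P at *
    generalize poch q q N = Q at *
    generalize poch q (u*q) N = U at *
    generalize hh q g (v*q) N = H at *
    generalize a1 : 1-d*q^(N+2) = D1 at *
    generalize a2 : 1-q^(N+1) = D2 at *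
    field_simp
    subst a1 a2
    ring
  | succ y ih =>
    rw [Finset.sum_range_succ, ih (by omega)]
    obtain ⟨z, rfl⟩ := Nat.exists_eq_add_of_le hY
    have n1 : y+1+z+1-(y+1) = z+1 := by omega
    have n2 : y+1+z-(y+1) = z := by omega
    have n3 : y+1+z-y = z+1 := by omega
    simp only [e65, n1, n2, n3]
    have h3 : poch q (d*q^(y+2)) (y+1+z) ≠ 0 := by
      apply poch_ne; intro l hl
      rw [mul_assoc, ← pow_add]; exact hd1 _ (by omega) (by omega)
    have hp : ∀ k ≤ y+z+2, poch q q k ≠ 0 := by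
      intro k hk; apply poch_ne; intro l hl; rw [← pow_succ']; exact hq1 _ (by omega) (by omega)
    have h4 := hp y (by omega)
    have h5 := hp z (by omega)
    have k1 : (1:ℂ)-d*q^(y+1) ≠ 0 := sub_ne_zero.2 (hd1 _ (by omega) (by omega)).symm
    have k2 : (1:ℂ)-d*q^(y+y+z+3) ≠ 0 := sub_ne_zero.2 (hd1 _ (by omega) (by omega)).symm
    have k3 : (1:ℂ)-d*q^(y+y+z+4) ≠ 0 := sub_ne_zero.2 (hd1 _ (by omega) (by omega)).symm
    have k4 : (1:ℂ)-q^(y+1) ≠ 0 := sub_ne_zero.2 (hq1 _ (by omega) (by omega)).symm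
    have k5 : (1:ℂ)-q^(z+1) ≠ 0 := sub_ne_zero.2 (hq1 _ (by omega) (by omega)).symm
    have p1 : poch q (d*q^(y+1)) (y+1+z+1) = (1-d*q^(y+1))*poch q (d*q^(y+2)) (y+1+z) := by
      rw [poch_succ']; ring_nf
    have p2 : poch q (d*q^(y+2)) (y+1+z+1) = poch q (d*q^(y+2)) (y+1+z)*(1-d*q^(y+y+z+3)) := by
      rw [poch_succ]; ring
    have p3 : poch q (d*q^(y+2)) (y+1+z+2) = poch q (d*q^(y+2)) (y+1+z)*(1-d*q^(y+y+z+3))*(1-d*q^(y+y+z+4)):= by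
      rw [poch_succ, p2]; ring
    have r1 : d*q^(y+1+z+1)*(u*q) = d*q^(y+1+z+1+1)*u := by ring
    have r2 : d*q^(y+1+z+1)*(v*q) = d*q^(y+1+z+1+1)*v := by ring
    rw [show y+1+z+1+1 = y+1+z+2 from rfl, show y+1+1 = y+2 from rfl] at *
    rw [p1, p2, p3, r1, r2, poch_succ' q u, hh_succ' q g v, poch_succ q (u*q), hh_succ q g (v*q),
      poch_succ q _ y, hh_succ q _ _ y, sg_succ, poch_succ q q y, poch_succ q q z]
    rw [← pow_succ', ← pow_succ']
    have f1 : y+1+z+(y+1)+2 = y+y+z+4 := by omega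
    have f2 : y+1+z+y+2 = y+y+z+3 := by omega
    rw [f1, f2]
    clear ih r1 r2 p1 p2 p3
    have hqy : q^(y+2) ≠ 0 := pow_ne_zero _ hq
    generalize poch q (d*q^(y+2)) (y+1+z) = W1 at *
    generalize poch q q y = W2 at *
    generalize poch q q z = W3 at *
    generalize poch q (u*q) z = W4 at *
    generalize hh q g (v*q) z = W5 at *
    generalize poch q _ y = W6 at *
    generalize hh q g _ y = W7 at *
    generalize sg q d y = W8 at *
    generalize a1 : 1-d*q^(y+1) = D1 at *
    generalize a2 : 1-d*q^(y+y+z+3) = D2 at *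
    generalize a3 : 1-d*q^(y+y+z+4) = D3 at *
    generalize a4 : 1-q^(y+1) = D4 at *
    generalize a5 : 1-q^(z+1) = D5 at *
    generalize a6 : q^(y+2) = D6 at *
    field_simp
    subst a1 a2 a3 a4 a5 a6
    ring
theorem sum65 (q d g : ℂ) (hq : q ≠ 0) (hd : d ≠ 0) (N : ℕ) : ∀ (u v : ℂ)
    (_ : ∀ k, 1 ≤ k → k ≤ N → q^k ≠ 1) (_ : ∀ k, 1 ≤ k → k ≤ 2*N+1 → d*q^k ≠ 1),
    ∑ y ∈ Finset.range (N+1), (1-d*q^(2*y+1))*e65 q d g u v N y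
      = sg q d N*hh q g (d*u*v*q^(N+1)) N / poch q q N := by
  induction N with
  | zero =>
    intro u v hq1 hd1
    have := sub_ne_zero.2 (hd1 1 (by omega) (by omega)).symm
    simp [e65, sg_zero, hh_zero, poch_zero, poch_succ]
    simp at this
    field_simp
  | succ N ih =>
    intro u v hq1 hd1
    have h := sum65_partial q d g u v hq hd N hq1 (fun k h1 h2 => hd1 k h1 (by omega)) N le_rfl
    have ih := ih (u*q) (v*q) (fun k h1 h2 => hq1 k h1 (by omega)) (fun k h1 h2 => hd1 k h1 (by omega))
    rw [Finset.sum_sub_distrib, ← Finset.mul_sum, ← Finset.mul_sum, ih] at h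
    rw [Finset.sum_range_succ]
    set S := ∑ y ∈ Finset.range (N+1), (1-d*q^(2*y+1))*e65 q d g u v (N+1) y
    have k1 : (1:ℂ)-q^(N+1) ≠ 0 := sub_ne_zero.2 (hq1 _ (by omega) (by omega)).symm
    have hqN : q^(N+2) ≠ 0 := pow_ne_zero _ hq
    apply mul_left_cancel₀ (mul_ne_zero k1 (mul_ne_zero (neg_ne_zero.2 hd) hqN))
    have hp : poch q q N ≠ 0 := by
      apply poch_ne; intro l hl; rw [← pow_succ']; exact hq1 _ (by omega) (by omega)
    have hpd : poch q (d*q^(N+2)) (N) ≠ 0 := by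
      apply poch_ne; intro l hl
      rw [mul_assoc, ← pow_add]; exact hd1 _ (by omega) (by omega)
    have k2 : (1:ℂ)-d*q^(N+1) ≠ 0 := sub_ne_zero.2 (hd1 _ (by omega) (by omega)).symm
    have k3 : (1:ℂ)-d*q^(N+N+2) ≠ 0 := sub_ne_zero.2 (hd1 _ (by omega) (by omega)).symm
    have k4 : (1:ℂ)-d*q^(N+N+3) ≠ 0 := sub_ne_zero.2 (hd1 _ (by omega) (by omega)).symm
    have p1 : poch q (d*q^(N+1)) (N+1) = (1-d*q^(N+1))*poch q (d*q^(N+2)) N := by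
      rw [poch_succ']; ring_nf
    have p2 : poch q (d*q^(N+1+1)) (N+1+1) = poch q (d*q^(N+2)) N*(1-d*q^(N+N+2))*(1-d*q^(N+N+3)) := by
      rw [poch_succ, poch_succ]; ring
    have last : (1-q^(N+1))*(-d*q^(N+2))*((1-d*q^(2*(N+1)+1))*e65 q d g u v (N+1) (N+1))
      = e65 q d g (u*q) (v*q) N N*(1-d*q^(N+1))*(1-d*q^(N+N+2)*u)*(g-d*q^(N+N+2)*v)/(1-d*q^(N+N+2)) := by
      simp only [e65, Nat.sub_self, poch_zero, hh_zero]
      have r1 : d*q^(N+1)*(u*q) = d*q^(N+2)*u := by ring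
      have r2 : d*q^(N+1)*(v*q) = d*q^(N+2)*v := by ring
      rw [p1, p2, r1, r2, sg_succ, show N+1+1 = N+2 from rfl, poch_succ q _ N, hh_succ q _ _ N, poch_succ q q N,
       ← pow_succ']
      have f1 : d*q^(N+2)*u*q^N = d*q^(N+N+2)*u := by ring
      have f2 : d*q^(N+2)*v*q^N = d*q^(N+N+2)*v := by ring
      have f3 : 2*(N+1)+1 = N+N+3 := by ring
      rw [f1, f2, f3]
      generalize 1-d*q^(N+1) = D1 at *
      generalize 1-q^(N+1) = D2 at *
      generalize 1-d*q^(N+N+2) = D3 at *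
      generalize 1-d*q^(N+N+3) = D4 at *
      field_simp
    have r3 : d*(u*q)*(v*q)*q^(N+1) = d*u*v*q^(N+1+1)*q := by ring
    have hs : sg q d (N+1)*(-d*q^(N+2)) = sg q d N := by
      rw [sg_succ]; field_simp
    rw [r3] at h
    have fin : (1-q^(N+1))*(-d*q^(N+2))*(sg q d (N+1)*hh q g (d*u*v*q^(N+1+1)) (N+1) / poch q q (N+1))
      = (g-d*u*v*q^(N+2))*(sg q d N*hh q g (d*u*v*q^(N+1+1)*q) N / poch q q N) := by
      rw [hh_succ', poch_succ q q N, ← pow_succ', ← hs]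
      field_simp
    linear_combination h+last-fin
end qR
namespace qR
def rr (q c1 c2 c3 : ℂ) (N n x : ℕ) : ℂ :=
  S4 q (q^n)⁻¹ (c2*c3*q^(n+1)) (q^x)⁻¹ (c1*c2*q^(x+1)) (q*c2) (c1*c2*c3*q^(N+2)) (q^N)⁻¹ (n+1)
lemma inv_pow_mul {q : ℂ} (hq : q ≠ 0) (n : ℕ) : (q^n)⁻¹*q^n = 1 :=
  inv_mul_cancel₀ (pow_ne_zero _ hq)
lemma rr_eq {q : ℂ} (hq : q ≠ 0) (c1 c2 c3 : ℂ) (N n x K : ℕ) (hK : n < K ∨ x < K) :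
    S4 q (q^n)⁻¹ (c2*c3*q^(n+1)) (q^x)⁻¹ (c1*c2*q^(x+1)) (q*c2) (c1*c2*c3*q^(N+2)) (q^N)⁻¹ K = rr q c1 c2 c3 N n x := by
  have hA := inv_pow_mul hq n
  have hC := inv_pow_mul hq x
  unfold rr
  rcases hK with h | h
  · rw [S4_trunc (Or.inl hA) h]
  · rcases le_or_gt n x with h' | h'
    · rw [S4_trunc (Or.inl hA) (lt_of_le_of_lt h' h)]
    · rw [S4_trunc (Or.inr hC) h, S4_trunc (Or.inr hC) (by omega : x < n+1)]
lemma rr_dual {q : ℂ} (hq : q ≠ 0) (c1 c2 c3 : ℂ) (N n x : ℕ) : rr q c1 c2 c3 N n x = rr q c3 c2 c1 N x n := by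
  rw [rr, S4_swap, ← rr_eq hq c3 c2 c1 N x n (n+1) (Or.inr (by omega))]
  congr 1 <;> ring
lemma rr_zero_left (q c1 c2 c3 : ℂ) (N x : ℕ) : rr q c1 c2 c3 N 0 x = 1 := by
  rw [rr, S4_one]
lemma rr_zero_right {q : ℂ} (hq : q ≠ 0) (c1 c2 c3 : ℂ) (N x : ℕ) : rr q c1 c2 c3 N x 0 = 1 := by
  rw [rr_dual hq, rr_zero_left]
/-- nonvanishing lemma -/
lemma poch_pow_ne {q c : ℂ} {M a k : ℕ} (h : ∀ k, 1 ≤ k → k ≤ M → c*q^k ≠ 1) (ha : 1 ≤ a) (hk : a+k ≤ M+1) :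
    poch q (c*q^a) k ≠ 0 := by
  apply poch_ne; intro l hl
  rw [mul_assoc, ← pow_add]; exact h _ (by omega) (by omega)
lemma poch_one_ne {q c : ℂ} {M k : ℕ} (h : ∀ k, 1 ≤ k → k ≤ M → c*q^k ≠ 1) (hk : k ≤ M) :
    poch q (q*c) k ≠ 0 := by
  have := poch_pow_ne h (a := 1) le_rfl (k := k) (by omega)
  rwa [pow_one, mul_comm c] at this
lemma poch_q_ne {q : ℂ} {M k : ℕ} (h : ∀ k, 1 ≤ k → k ≤ M → q^k ≠ 1) (hk : k ≤ M) :
    poch q q k ≠ 0 := by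
  apply poch_ne; intro l hl; rw [← pow_succ']; exact h _ (by omega) (by omega)
lemma poch_G_ne {q : ℂ} (hq : q ≠ 0) {M N k : ℕ} (h : ∀ k, 1 ≤ k → k ≤ M → q^k ≠ 1) (hN : N ≤ M) (hk : k ≤ N) :
    poch q (q^N)⁻¹ k ≠ 0 := by
  apply poch_ne; intro l hl hc
  have : q^(N-l) = 1 := by
    have e : q^N = q^(N-l)*q^l := by rw [← pow_add]; congr 1; omega
    have h2 : q^l ≠ 0 := pow_ne_zero _ hq
    rw [e, mul_inv, mul_assoc, inv_mul_cancel₀ h2, mul_one, inv_eq_one] at hc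
    exact hc
  exact h _ (by omega) (by omega) this
lemma one_sub_ne {q c : ℂ} {M k : ℕ} (h : ∀ k, 1 ≤ k → k ≤ M → c*q^k ≠ 1) (h1 : 1 ≤ k) (hk : k ≤ M) :
    1-c*q^k ≠ 0 := sub_ne_zero.2 (h k h1 hk).symm
lemma one_sub_q_ne {q : ℂ} {M k : ℕ} (h : ∀ k, 1 ≤ k → k ≤ M → q^k ≠ 1) (h1 : 1 ≤ k) (hk : k ≤ M) :
    1-q^k ≠ 0 := sub_ne_zero.2 (h k h1 hk).symm
/-- backward shift for rr at `x+1`. -/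
lemma rr_BS {q c1 c2 c3 : ℂ} (hq : q ≠ 0) (hc2 : c2 ≠ 0) (hc1 : c1 ≠ 0) (N n x : ℕ) (hn : n ≤ N)
    (hq1 : ∀ k, 1 ≤ k → k ≤ N+1 → q^k ≠ 1) (h2 : ∀ k, 1 ≤ k → k ≤ N+1 → c2*q^k ≠ 1)
    (h123 : ∀ k, 1 ≤ k → k ≤ 2*N+3 → c1*c2*c3*q^k ≠ 1) :
    (1-c2*q^(x+2))*(1-c1*c2*c3*q^(N+x+4))*(q^(N+1)-q^(x+1))*(1-c1*c2*q^(x+2))*rr q c1 (q*c2) (q*c3) N n (x+1)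
    - c2*q*(c1*q^(x+1)-1)*(q^(x+1)-c3*q^(N+2))*(c1*c2*q^(N+x+3)-1)*(q^(x+1)-1)*rr q c1 (q*c2) (q*c3) N n x
    = q^(x+1)*(1-c1*c2*q^(2*x+3))*((1-q*c2)*(1-c1*c2*c3*q^(N+3))*(q^(N+1)-1)* rr q c1 c2 c3 (N+1) (n+1) (x+1)) := by
  have hqx : q^(x+1) ≠ 0 := pow_ne_zero _ hq
  have hX : (q^(x+1))⁻¹*q^(x+1) = 1 := inv_pow_mul hq _
  have hNN : (q^(N+1))⁻¹*q^(N+1) = 1 := inv_pow_mul hq _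
  have hnn : (q^(n+1))⁻¹*q^(n+1) = 1 := inv_pow_mul hq _
  have b := BS q (q^(n+1))⁻¹ (c2*c3*q^(n+1+1)) (q^(x+1))⁻¹ (c1*c2*q^(x+1+1)) (q*c2) (c1*c2*c3*q^(N+1+2)) (q^(N+1))⁻¹ hq
    (by
      rw [show c2*c3*q^(n+1+1) = c2*c3*q*q^(n+1) by ring, show c1*c2*q^(x+1+1) = c1*c2*q*q^(x+1) by ring,
        show c1*c2*c3*q^(N+1+2) = c1*c2*c3*q^2*q^(N+1) by ring]
      linear_combination (c1*c2^2*c3*q^3*(q^(x+1))⁻¹*q^(x+1))*hnn+c1*c2^2*c3*q^3*hX-c1*c2^2*c3*q^3*hNN) n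
    (poch_one_ne h2 (by omega)) (poch_pow_ne h123 (by omega) (by omega)) (poch_G_ne hq hq1 le_rfl (by omega)) (poch_q_ne hq1 (by omega)) hnn
  rw [show n+2 = n+1+1 from rfl, ← rr] at b
  have i1 : ∀ k, (q^(k+1))⁻¹*q = (q^k)⁻¹ := by
    intro k; rw [pow_succ, mul_inv, mul_assoc, inv_mul_cancel₀ hq, mul_one]
  have e1 : S4 q ((q^(n+1))⁻¹*q) (c2*c3*q^(n+1+1)*q) (q^(x+1))⁻¹ (c1*c2*q^(x+1+1)*q) (q*c2*q) (c1*c2*c3*q^(N+1+2)*q) ((q^(N+1))⁻¹*q) (n+1)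
     = rr q c1 (q*c2) (q*c3) N n (x+1) := by
    rw [rr, i1, i1]; congr 1 <;> ring
  have e2 : S4 q ((q^(n+1))⁻¹*q) (c2*c3*q^(n+1+1)*q) ((q^(x+1))⁻¹*q) (c1*c2*q^(x+1+1)) (q*c2*q) (c1*c2*c3*q^(N+1+2)*q) ((q^(N+1))⁻¹*q) (n+1)
     = rr q c1 (q*c2) (q*c3) N n x := by
    rw [rr, i1, i1, i1]; congr 1 <;> ring
  rw [e1, e2] at b
  have hD : (c1*c2*q^(x+2))⁻¹*(c1*c2*q^(x+2)) = 1 := inv_mul_cancel₀ (by simp [*])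
  generalize rr q c1 (q*c2) (q*c3) N n (x+1) = R1 at *
  generalize rr q c1 (q*c2) (q*c3) N n x = R2 at *
  generalize rr q c1 c2 c3 (N+1) (n+1) (x+1) = R3 at *
  have hD0 : c1*c2*q^(x+2) ≠ 0 := by simp [*]
  have hqN : q^(N+1) ≠ 0 := pow_ne_zero _ hq
  have w1 : q^(x+2) = q*q^(x+1) := by ring
  have w2 : q^(x+1+1) = q*q^(x+1) := by ring
  have w3 : q^(N+1+2) = q^2*q^(N+1) := by ring
  have w4 : q^(N+3) = q^2*q^(N+1) := by ring
  have w5 : q^(2*x+3) = q*q^(x+1)*q^(x+1) := by ring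
  have w6 : q^(N+x+4) = q^2*q^(N+1)*q^(x+1) := by ring
  have w7 : q^(N+2) = q*q^(N+1) := by ring
  have w8 : q^(N+x+3) = q*q^(N+1)*q^(x+1) := by ring
  simp only [w1, w2, w3, w4, w5, w6, w7, w8] at b ⊢
  clear e1 e2 hX hNN hnn i1 w1 w2 w3 w4 w5 w6 w7 w8 hD hD0 hq1 h2 h123
  generalize q^(x+1) = X at *
  generalize q^(N+1) = Y at *
  field_simp at b ⊢
  linear_combination b
end qR
namespace qR
def Wt (q c1 c2 c3 : ℂ) (N x : ℕ) : ℂ :=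
  poch q q N*poch q (q*c3) (N-x)*(1-c1*c2*q^(2*x+1))*poch q (q*c2) x*poch q (c1*c2*c3*q^(N+2)) x
   / (poch q q x*poch q q (N-x)*(q*c2)^x*poch q (c1*c2*q^(x+1)) (N+1)*poch q (q*c1) x)
lemma hhsg {q c1 c2 : ℂ} (hq : q ≠ 0) (h1 : c1 ≠ 0) (h2 : c2 ≠ 0) (z : ℕ) : ∀ y N, y+z = N →
    (c1*q^N)^y*sg q (c1*c2) y*hh q (c1*q^N) 1 z*(q*c2)^y*poch q (q*c1) y
     = (c1*q^N)^N*sg q (c1*c2) N*(q*c2)^N*poch q (q*c1) N := by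
  induction z with
  | zero => rintro y N rfl; simp [hh_zero]
  | succ z ih =>
    intro y N h
    rw [← ih (y+1) N (by omega), hh_succ, poch_succ, sg_succ]
    subst h
    have : q^y ≠ 0 := pow_ne_zero _ hq
    have : q^z ≠ 0 := pow_ne_zero _ hq
    rw [show q^(y+2) = q^y*q^2 by ring, show q^(y+(z+1)) = q*q^y*q^z by ring]
    generalize hh q (c1*(q*q^y*q^z)) 1 z = H
    generalize sg q (c1*c2) y = S
    field_simp
    ring
lemma O_zero {q c1 c2 c3 : ℂ} (hq : q ≠ 0) (h1 : c1 ≠ 0) (h2 : c2 ≠ 0) (N : ℕ)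
    (hq1 : ∀ k, 1 ≤ k → k ≤ N → q^k ≠ 1) (g1 : ∀ k, 1 ≤ k → k ≤ N → c1*q^k ≠ 1)
    (g12 : ∀ k, 1 ≤ k → k ≤ 2*N+1 → c1*c2*q^k ≠ 1) :
    (q*c2)^N*poch q (q*c1) N*∑ x ∈ Finset.range (N+1), Wt q c1 c2 c3 N x = poch q (c2*c3*q^2) N := by
  have s := sum65 q (c1*c2) (c1*q^N) hq (mul_ne_zero h1 h2) N (q*c3) 1 hq1 g12
  have hQ : poch q q N ≠ 0 := poch_q_ne hq1 le_rfl
  have hX : ∀ k, q^k ≠ 0 := fun k => pow_ne_zero _ hq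
  have hs : ∀ k, sg q (c1*c2) k ≠ 0 := by
    intro k; rw [sg, Finset.prod_ne_zero_iff]; intro l _; simp [*]
  have e : ∀ k, hh q (c1*q^N) (c1*c2*(q*c3)*1*q^(N+1)) k = (c1*q^N)^k*poch q (c2*c3*q^2) k := by
    intro k; induction k with
    | zero => simp [hh_zero, poch_zero]
    | succ k ih => rw [hh_succ, ih, poch_succ]; ring
  have e' : ∀ k, hh q (c1*q^N) (c1*c2*q^(N+1)*1) k = (c1*q^N)^k*poch q (q*c2) k := by
    intro k; induction k with
    | zero => simp [hh_zero, poch_zero]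
    | succ k ih => rw [hh_succ, ih, poch_succ]; ring
  rw [e] at s
  have t : ∀ x ∈ Finset.range (N+1), (c1*q^N)^N*sg q (c1*c2) N*(q*c2)^N*poch q (q*c1) N*Wt q c1 c2 c3 N x
      = poch q q N*((1-c1*c2*q^(2*x+1))*e65 q (c1*c2) (c1*q^N) (q*c3) 1 N x) := by
    intro x hx
    rw [Finset.mem_range] at hx
    have hx : x ≤ N := by omega
    obtain ⟨z, rfl⟩ := Nat.exists_eq_add_of_le hx
    rw [← hhsg hq h1 h2 z x _ rfl, Wt, e65, e', Nat.add_sub_cancel_left]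
    have a1 : poch q (q*c1) x ≠ 0 := poch_one_ne g1 (by omega)
    have a2 : (q*c2)^x ≠ 0 := by simp [*]
    have a3 : c1*c2*q^(x+z+1)*(q*c3) = c1*c2*c3*q^(x+z+2) := by ring
    rw [a3]
    generalize poch q (q*c1) x = P1 at *
    generalize (q*c2)^x = P2 at *
    generalize 1-c1*c2*q^(2*x+1) = P3 at *
    rw [mul_div_assoc', mul_div_assoc', mul_div_assoc']
    rw [show poch q q x*poch q q z*P2*poch q (c1*c2*q^(x+1)) (x+z+1)*P1 = (P1*P2)*(poch q q x*poch q q z*poch q (c1*c2*q^(x+1)) (x+z+1)) by ring]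
    rw [← div_div]; congr 1
    field_simp
  have r : ((c1*q^N)^N*sg q (c1*c2) N)*((q*c2)^N*poch q (q*c1) N*∑ x ∈ Finset.range (N+1), Wt q c1 c2 c3 N x) =
     ((c1*q^N)^N*sg q (c1*c2) N)*poch q (c2*c3*q^2) N := by
    have := Finset.sum_congr rfl t
    rw [← Finset.mul_sum, ← Finset.mul_sum, s] at this
    rw [← mul_assoc, ← mul_assoc, this]
    field_simp
  exact mul_left_cancel₀ (mul_ne_zero (pow_ne_zero _ (mul_ne_zero h1 (hX _))) (hs _)) r
/-- lower weights without the linear factor -/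
def bt (q c1 c2 c3 : ℂ) (N x : ℕ) : ℂ :=
  poch q q N*poch q (q*(q*c3)) (N-x)*poch q (q*(q*c2)) x*poch q (c1*(q*c2)*(q*c3)*q^(N+2)) x
   / (poch q q x*poch q q (N-x)*(q*c2)^x*poch q (c1*(q*c2)*q^(x+1)) (N+1)*poch q (q*c1) x)
lemma Wt_bt {q : ℂ} (hq : q ≠ 0) (c1 c2 c3 : ℂ) (N x : ℕ) :
    q^x*Wt q c1 (q*c2) (q*c3) N x = bt q c1 c2 c3 N x*(1-c1*c2*q^(2*x+2)) := by
  have : q^x ≠ 0 := pow_ne_zero _ hq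
  rw [Wt, bt, mul_pow q (q*c2), div_mul_eq_mul_div, mul_div_assoc',
    show poch q q x*poch q q (N-x)*(q^x*(q*c2)^x)*poch q (c1*(q*c2)*q^(x+1)) (N+1)*poch q (q*c1) x = q^x*(poch q q x*poch q q (N-x)*((q*c2)^x)*poch q (c1*(q*c2)*q^(x+1)) (N+1)*poch q (q*c1) x) by ring, mul_div_mul_left _ _ this]
  congr 1; ring
lemma bt_eq1 {q c1 c2 c3 : ℂ} (hq : q ≠ 0) (h2 : c2 ≠ 0) (N x : ℕ) (hx : x ≤ N)
    (hq1 : ∀ k, 1 ≤ k → k ≤ N+1 → q^k ≠ 1) (g1 : ∀ k, 1 ≤ k → k ≤ N+1 → c1*q^k ≠ 1)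
    (g12 : ∀ k, 1 ≤ k → k ≤ 2*N+3 → c1*c2*q^k ≠ 1) :
    (1-q*c3)*bt q c1 c2 c3 N x*(q^(x+1)*(1-c1*c2*q^(2*x+3))*((1-q*c2)*(1-c1*c2*c3*q^(N+3))*(q^(N+1)-1)))
     = Wt q c1 c2 c3 (N+1) (x+1)*(c2*q*(c1*q^(x+1)-1)*(q^(x+1)-c3*q^(N+2))*(c1*c2*q^(N+x+3)-1)*(q^(x+1)-1)) := by
  obtain ⟨z, rfl⟩ := Nat.exists_eq_add_of_le hx
  rw [Wt, bt, Nat.add_sub_cancel_left, show x+z+1-(x+1) = z by omega]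
  have u1 := poch_shift q (q*c3) z
  rw [show q*c3*q = q*(q*c3) by ring] at u1
  rw [poch_succ' q (q*c2), poch_succ q q (x+z), poch_succ' q (c1*c2*c3*q^(x+z+1+2)), poch_succ q q x, poch_succ q (c1*c2*q^(x+1+1)),
    poch_succ q (q*c1) x, show q*c2*q = q*(q*c2) by ring, show c1*c2*c3*q^(x+z+1+2)*q = c1*(q*c2)*(q*c3)*q^(x+z+2) by ring,
    show c1*(q*c2)*q^(x+1) = c1*c2*q^(x+1+1) by ring]
  have a1 : poch q (q*c1) x ≠ 0 := poch_one_ne g1 (by omega)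
  have a2 : q*c2 ≠ 0 := by simp [*]
  have a3 : poch q q x ≠ 0 := poch_q_ne hq1 (by omega)
  have a4 : poch q q z ≠ 0 := poch_q_ne hq1 (by omega)
  have a5 : poch q (c1*c2*q^(x+1+1)) (x+z+1) ≠ 0 := poch_pow_ne g12 (by omega) (by omega)
  have a6 : 1-c1*q^(x+1) ≠ 0 := one_sub_ne g1 (by omega) (by omega)
  have a7 : 1-q^(x+1) ≠ 0 := one_sub_q_ne hq1 (by omega) (by omega)
  have a8 : 1-c1*c2*q^(x+z+x+3) ≠ 0 := one_sub_ne g12 (by omega) (by omega)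
  rw [show q*c1*q^x = c1*q^(x+1) by ring, show q*q^x = q^(x+1) by ring, show c1*c2*q^(x+1+1)*q^(x+z+1) = c1*c2*q^(x+z+x+3) by ring,
    show (c1*q^(x+1)-1) = -(1-c1*q^(x+1)) by ring, show (c1*c2*q^(x+z+x+3)-1) = -(1-c1*c2*q^(x+z+x+3)) by ring,
    show q^(x+1)-1 = -(1-q^(x+1)) by ring, show q^(x+1)-c3*q^(x+z+2) = q^(x+1)*(1-q*c3*q^z) by ring,
    show (q^(x+z+1)-1) = -(1-q*q^(x+z)) by ring, show c1*c2*q^(2*(x+1)+1) = c1*c2*q^(2*x+3) by ring,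
    show c1*c2*c3*q^(x+z+1+2) = c1*c2*c3*q^(x+z+3) by ring]
  rw [pow_succ (q*c2)]
  generalize 1-c1*q^(x+1) = P1 at *
  generalize 1-q^(x+1) = P2 at *
  generalize 1-c1*c2*q^(x+z+x+3) = P3 at *
  generalize poch q (c1*c2*q^(x+1+1)) (x+z+1) = P4 at *
  generalize poch q q x = P5 at *
  generalize poch q q z = P6 at *
  generalize poch q (q*c1) x = P7 at *
  generalize poch q (q*(q*c3)) z = P8 at *
  generalize poch q (q*c3) z = P9 at *
  generalize 1-q*c3*q^z = P10 at *
  generalize 1-q*c2 = P11 at *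
  generalize 1-c1*c2*q^(2*x+3) = P12 at *
  generalize 1-c1*c2*c3*q^(x+z+3) = P13 at *
  generalize 1-q*q^(x+z) = P14 at *
  generalize 1-q*c3 = P15 at *
  generalize poch q (c1*(q*c2)*(q*c3)*q^(x+z+2)) x = P16 at *
  generalize poch q (q*(q*c2)) x = P17 at *
  generalize poch q q (x+z) = P18 at *
  have hX : q^(x+1) ≠ 0 := pow_ne_zero _ hq
  generalize q^(x+1) = X at *
  have a9 : (q*c2)^x ≠ 0 := pow_ne_zero _ a2
  generalize (q*c2)^x = Y at *
  field_simp
  linear_combination (-(P18*P17*P16*P12*P11*P13*P14))*u1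
lemma bt_eq2 {q c1 c2 c3 : ℂ} (hq : q ≠ 0) (h2 : c2 ≠ 0) (N x : ℕ) (hx : x+1 ≤ N)
    (hq1 : ∀ k, 1 ≤ k → k ≤ N+1 → q^k ≠ 1) (g1 : ∀ k, 1 ≤ k → k ≤ N+1 → c1*q^k ≠ 1)
    (g12 : ∀ k, 1 ≤ k → k ≤ 2*N+3 → c1*c2*q^k ≠ 1) :
    (1-q*c3)*bt q c1 c2 c3 N (x+1)*(q^(x+1)*(1-c1*c2*q^(2*x+3))*((1-q*c2)*(1-c1*c2*c3*q^(N+3))*(q^(N+1)-1)))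
     = Wt q c1 c2 c3 (N+1) (x+1)*((1-c2*q^(x+2))*(1-c1*c2*c3*q^(N+x+4))*(q^(N+1)-q^(x+1))*(1-c1*c2*q^(x+2))) := by
  obtain ⟨z, rfl⟩ := Nat.exists_eq_add_of_le hx
  rw [Wt, bt, Nat.add_sub_cancel_left, show x+1+z+1-(x+1) = z+1 by omega]
  rw [poch_succ' q (q*c3), poch_succ q q (x+1+z), poch_succ' q (c1*c2*q^(x+1+1)), poch_succ q q z,
    show q*c3*q = q*(q*c3) by ring, show c1*c2*q^(x+1+1)*q = c1*(q*c2)*q^(x+1+1) by ring]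
  have u2 := poch_shift q (q*c2) (x+1)
  have u3 := poch_shift q (c1*c2*c3*q^(x+1+z+1+2)) (x+1)
  rw [show q*c2*q = q*(q*c2) by ring] at u2
  rw [show c1*c2*c3*q^(x+1+z+1+2)*q = c1*(q*c2)*(q*c3)*q^(x+1+z+2) by ring] at u3
  have a1 : poch q (q*c1) (x+1) ≠ 0 := poch_one_ne g1 (by omega)
  have a2 : q*c2 ≠ 0 := by simp [*]
  have a3 : poch q q (x+1) ≠ 0 := poch_q_ne hq1 (by omega)
  have a4 : poch q q z ≠ 0 := poch_q_ne hq1 (by omega)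
  have a5 : poch q (c1*c2*q^(x+3)) (x+1+z+1) ≠ 0 := poch_pow_ne g12 (by omega) (by omega)
  have a7 : 1-q^(z+1) ≠ 0 := one_sub_q_ne hq1 (by omega) (by omega)
  have a8 : 1-c1*c2*q^(x+2) ≠ 0 := one_sub_ne g12 (by omega) (by omega)
  rw [show c1*(q*c2)*q^(x+1+1) = c1*c2*q^(x+3) by ring, show q*q^z = q^(z+1) by ring, show c1*c2*q^(x+1+1) = c1*c2*q^(x+2) by ring,
    show q^(x+1+z+1)-q^(x+1) = -q^(x+1)*(1-q^(z+1)) by ring, show q^(x+1+z+1)-1 = -(1-q*q^(x+1+z)) by ring,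
    show c2*q^(x+2) = q*c2*q^(x+1) by ring, show c1*c2*c3*q^(x+1+z+x+4) = c1*c2*c3*q^(x+1+z+1+2)*q^(x+1) by ring,
    show c1*c2*q^(2*(x+1)+1) = c1*c2*q^(2*x+3) by ring,
    show c1*c2*c3*q^(x+1+z+3) = c1*c2*c3*q^(x+1+z+1+2) by ring]
  generalize 1-c1*c2*q^(x+2) = P1 at *
  generalize 1-q^(z+1) = P2 at *
  generalize poch q (c1*c2*q^(x+3)) (x+1+z+1) = P4 at *
  generalize poch q q (x+1) = P5 at *
  generalize poch q q z = P6 at *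
  generalize poch q (q*c1) (x+1) = P7 at *
  generalize poch q (q*(q*c3)) z = P8 at *
  generalize 1-q*c2*q^(x+1) = P10 at *
  generalize 1-q*c2 = P11 at *
  generalize 1-c1*c2*q^(2*x+3) = P12 at *
  generalize 1-c1*c2*c3*q^(x+1+z+1+2)*q^(x+1) = P13 at *
  generalize 1-c1*c2*c3*q^(x+1+z+1+2) = P19 at *
  generalize 1-q*q^(x+1+z) = P14 at *
  generalize 1-q*c3 = P15 at *
  generalize poch q (c1*(q*c2)*(q*c3)*q^(x +1+ z+2)) (x+1) = P16 at *
  generalize poch q (c1*c2*c3*q^(x+1+z+1+2)) (x+1) = P20 at *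
  generalize poch q (q*(q*c2)) (x+1) = P17 at *
  generalize poch q (q*c2) (x+1) = P21 at *
  generalize poch q q (x+1+z) = P18 at *
  have hX : q^(x+1) ≠ 0 := pow_ne_zero _ hq
  generalize q^(x+1) = X at *
  have a9 : (q*c2)^(x+1) ≠ 0 := pow_ne_zero _ a2
  generalize (q*c2)^(x+1) = Y at *
  field_simp
  linear_combination (-(P15*P18*P8*P12*P14))*(P19*P16*u2+P21*P10*u3)
end qR
namespace qR
/-- genericity for three parameters -/
def Gen3 (q : ℂ) (M : ℕ) (c1 c2 c3 : ℂ) : Prop :=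
  ∀ k, 1 ≤ k → k ≤ M → c1*q^k ≠ 1 ∧ c2*q^k ≠ 1 ∧ c3*q^k ≠ 1 ∧ c1*c2*q^k ≠ 1 ∧ c2*c3*q^k ≠ 1 ∧ c1*c3*q^k ≠ 1 ∧
    c1*c2*c3*q^k ≠ 1
lemma rr_FS {q c1 c2 c3 : ℂ} (hq : q ≠ 0) (N m x : ℕ) (hm : m ≤ N)
    (hq1 : ∀ k, 1 ≤ k → k ≤ N+1 → q^k ≠ 1) (h2 : ∀ k, 1 ≤ k → k ≤ N+1 → c2*q^k ≠ 1)
    (h123 : ∀ k, 1 ≤ k → k ≤ 2*N+3 → c1*c2*c3*q^k ≠ 1) :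
    q^x*q^(m+1)*((1-q*c2)*(1-c1*c2*c3*q^(N+3))*(q^(N+1)-1))*(rr q c1 c2 c3 (N+1) (m+1) x-rr q c1 c2 c3 (N+1) (m+1) (x+1))
     = q^(N+1)*(1-c1*c2*q^(2*x+2))*(q^(m+1)-1)*(1-c2*c3*q^(m+2))*rr q c1 (q*c2) (q*c3) N m x := by
  have b := FS q (q^(m+1))⁻¹ (c2*c3*q^(m+1+1)) (q^(x+1))⁻¹ (c1*c2*q^(x+1)) (q*c2) (c1*c2*c3*q^(N+1+2)) (q^(N+1))⁻¹ (m+1)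
    (poch_one_ne h2 (by omega)) (poch_pow_ne h123 (by omega) (by omega)) (poch_G_ne hq hq1 le_rfl (by omega)) (poch_q_ne hq1 (by omega))
  have i1 : ∀ k, (q^(k+1))⁻¹*q = (q^k)⁻¹ := by
    intro k; rw [pow_succ, mul_inv, mul_assoc, inv_mul_cancel₀ hq, mul_one]
  rw [i1, i1, i1, ← rr, show c1*c2*q^(x+1)*q = c1*c2*q^(x+1+1) by ring, ← rr] at b
  have e2 : S4 q (q^m)⁻¹ (c2*c3*q^(m+1+1)*q) (q^x)⁻¹ (c1*c2*q^(x+1+1)) (q*c2*q) (c1*c2*c3*q^(N+1+2)*q) (q^N)⁻¹ (m+1)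
     = rr q c1 (q*c2) (q*c3) N m x := by
    rw [rr]; congr 1 <;> ring
  rw [e2] at b
  have hqN : q^(N+1) ≠ 0 := pow_ne_zero _ hq
  have hqm : q^(m+1) ≠ 0 := pow_ne_zero _ hq
  have hqx : q^x ≠ 0 := pow_ne_zero _ hq
  generalize rr q c1 (q*c2) (q*c3) N m x = R1 at *
  generalize rr q c1 c2 c3 (N+1) (m+1) x = R2 at *
  generalize rr q c1 c2 c3 (N+1) (m+1) (x+1) = R3 at *
  have w1 : q^(N+1+2) = q^2*q^(N+1) := by ring
  have w2 : q^(N+3) = q^2*q^(N+1) := by ring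
  have w3 : q^(x+1) = q*q^x := by ring
  have w4 : q^(m+1+1) = q*q^(m+1) := by ring
  have w5 : q^(m+2) = q*q^(m+1) := by ring
  have w6 : q^(2*x+2) = q^2*q^x*q^x := by ring
  simp only [w1,w2,w3,w4,w5,w6] at b ⊢
  clear e2 i1 w1 w2 w3 w4 w5 w6 hq1 h2 h123
  generalize q^x = X at *
  generalize q^(N+1) = Y at *
  generalize q^(m+1) = Z at *
  field_simp at b ⊢
  linear_combination b
lemma O_partial {q c1 c2 c3 : ℂ} (hq : q ≠ 0) (h1 : c1 ≠ 0) (h2 : c2 ≠ 0) (N n : ℕ) (hn : n ≤ N)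
    (hq1 : ∀ k, 1 ≤ k → k ≤ N+1 → q^k ≠ 1) (g : Gen3 q (2*N+4) c1 c2 c3) (f : ℕ → ℂ) (X : ℕ) (hX : X ≤ N) :
    ∑ x ∈ Finset.range (X+1), Wt q c1 c2 c3 (N+1) x*rr q c1 c2 c3 (N+1) (n+1) x*f x
     = (1-q*c3)*(∑ x ∈ Finset.range X, bt q c1 c2 c3 N x*rr q c1 (q*c2) (q*c3) N n x*(f x-f (x+1))
        + bt q c1 c2 c3 N X*rr q c1 (q*c2) (q*c3) N n X*f X) := by
  have k2 : ∀ k, 1 ≤ k → k ≤ N+1 → c2*q^k ≠ 1 := fun k a b => (g k a (by omega)).2.1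
  have k1 : ∀ k, 1 ≤ k → k ≤ N+1 → c1*q^k ≠ 1 := fun k a b => (g k a (by omega)).1
  have k12 : ∀ k, 1 ≤ k → k ≤ 2*N+3 → c1*c2*q^k ≠ 1 := fun k a b => (g k a (by omega)).2.2.2.1
  have k123 : ∀ k, 1 ≤ k → k ≤ 2*N+3 → c1*c2*c3*q^k ≠ 1 := fun k a b => (g k a (by omega)).2.2.2.2.2.2
  induction X with
  | zero =>
    simp only [Finset.range_zero, Finset.sum_empty, zero_add, Finset.sum_range_one, rr_zero_right hq]
    have a0 : 1-c1*c2*q^1 ≠ 0 := one_sub_ne k12 (by omega) (by omega)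
    rw [pow_one] at a0
    rw [Wt, bt]
    simp only [poch_zero, Nat.sub_zero, pow_zero, mul_zero, zero_add, pow_one]
    rw [poch_succ' q (q*c3), poch_succ' q (c1*c2*q), show q*c3*q = q*(q*c3) by ring, show c1*c2*q*q = c1*(q*c2)*q by ring]
    have a1 : poch q q N ≠ 0 := poch_q_ne hq1 (by omega)
    have a2 : poch q q (N+1) ≠ 0 := poch_q_ne hq1 (by omega)
    have a3 : poch q (c1*(q*c2)*q) (N+1) ≠ 0 := by
      have := poch_pow_ne k12 (a := 2) (k := N+1) (by omega) (by omega)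
      rwa [show c1*(q*c2)*q = c1*c2*q^2 by ring]
    generalize poch q (c1*(q*c2)*q) (N+1) = P1 at *
    generalize 1-c1*c2*q = P2 at *
    field_simp
  | succ x ih =>
    have ih := ih (by omega)
    rw [Finset.sum_range_succ, ih, Finset.sum_range_succ]
    have b := rr_BS (c3 := c3) hq h2 h1 N n x hn hq1 k2 k123
    have e1 := bt_eq1 (c3 := c3) hq h2 N x (by omega) hq1 k1 k12
    have e2 := bt_eq2 (c3 := c3) hq h2 N x hX hq1 k1 k12
    have a1 : q^(x+1) ≠ 0 := pow_ne_zero _ hq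
    have a2 : 1-c1*c2*q^(2*x+3) ≠ 0 := one_sub_ne k12 (by omega) (by omega)
    have a3 : 1-q*c2 ≠ 0 := by have := one_sub_ne k2 (k := 1) (by omega) (by omega); rwa [pow_one, mul_comm] at this
    have a4 : 1-c1*c2*c3*q^(N+3) ≠ 0 := one_sub_ne k123 (by omega) (by omega)
    have a5 : q^(N+1)-1 ≠ 0 := sub_ne_zero.2 (hq1 _ (by omega) le_rfl)
    apply mul_left_cancel₀ (mul_ne_zero (mul_ne_zero a1 a2) (mul_ne_zero (mul_ne_zero a3 a4) a5))
    linear_combination (-Wt q c1 c2 c3 (N+1) (x+1)*f (x+1))*b-(rr q c1 (q*c2) (q*c3) N n (x+1)*f (x+1))*e2+(rr q c1 (q*c2) (q*c3) N n x*f (x+1))*e1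
lemma O_full {q c1 c2 c3 : ℂ} (hq : q ≠ 0) (h1 : c1 ≠ 0) (h2 : c2 ≠ 0) (N n : ℕ) (hn : n ≤ N)
    (hq1 : ∀ k, 1 ≤ k → k ≤ N+1 → q^k ≠ 1) (g : Gen3 q (2*N+4) c1 c2 c3) (f : ℕ → ℂ) :
    ∑ x ∈ Finset.range (N+2), Wt q c1 c2 c3 (N+1) x*rr q c1 c2 c3 (N+1) (n+1) x*f x
     = (1-q*c3)*(∑ x ∈ Finset.range (N+1), bt q c1 c2 c3 N x*rr q c1 (q*c2) (q*c3) N n x*(f x-f (x+1))) := by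
  have k2 : ∀ k, 1 ≤ k → k ≤ N+1 → c2*q^k ≠ 1 := fun k a b => (g k a (by omega)).2.1
  have k1 : ∀ k, 1 ≤ k → k ≤ N+1 → c1*q^k ≠ 1 := fun k a b => (g k a (by omega)).1
  have k12 : ∀ k, 1 ≤ k → k ≤ 2*N+3 → c1*c2*q^k ≠ 1 := fun k a b => (g k a (by omega)).2.2.2.1
  have k123 : ∀ k, 1 ≤ k → k ≤ 2*N+3 → c1*c2*c3*q^k ≠ 1 := fun k a b => (g k a (by omega)).2.2.2.2.2.2
  rw [Finset.sum_range_succ, O_partial hq h1 h2 N n hn hq1 g f N le_rfl, Finset.sum_range_succ]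
  have b := rr_BS (c3 := c3) hq h2 h1 N n N hn hq1 k2 k123
  have e1 := bt_eq1 (c3 := c3) hq h2 N N (by omega) hq1 k1 k12
  have a1 : q^(N+1) ≠ 0 := pow_ne_zero _ hq
  have a2 : 1-c1*c2*q^(2*N+3) ≠ 0 := one_sub_ne k12 (by omega) (by omega)
  have a3 : 1-q*c2 ≠ 0 := by have := one_sub_ne k2 (k := 1) (by omega) (by omega); rwa [pow_one, mul_comm] at this
  have a4 : 1-c1*c2*c3*q^(N+3) ≠ 0 := one_sub_ne k123 (by omega) (by omega)
  have a5 : q^(N+1)-1 ≠ 0 := sub_ne_zero.2 (hq1 _ (by omega) le_rfl)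
  apply mul_left_cancel₀ (mul_ne_zero (mul_ne_zero a1 a2) (mul_ne_zero (mul_ne_zero a3 a4) a5))
  rw [sub_self, mul_zero, zero_mul, zero_mul, zero_sub] at b
  linear_combination (-Wt q c1 c2 c3 (N+1) (N+1)*f (N+1))*b+(rr q c1 (q*c2) (q*c3) N n N*f (N+1))*e1
lemma div_aux {n d n' d' a b c r : ℂ} (h1 : d ≠ 0) (h2 : d' ≠ 0) (h : n*a*b*d' = r*(n'*c)*d) : n/d*a*b = r*(n'/d'*c) := by
  field_simp
  linear_combination h
lemma Wt_low {q c1 c2 c3 : ℂ} (hq : q ≠ 0) (h2 : c2 ≠ 0) (N n : ℕ) (hn : n ≤ N)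
    (hq1 : ∀ k, 1 ≤ k → k ≤ N+1 → q^k ≠ 1) (g : Gen3 q (2*N+4) c1 c2 c3) :
    Wt q c3 c2 c1 (N+1) (n+1)*(q*c2)^(N+1)*((1-q*c3)*(q^(N+1)*(q^(n+1)-1)*(1-c2*c3*q^(n+2))))
     = q^(n+1)*((1-q*c2)*(1-c1*c2*c3*q^(N+3))*(q^(N+1)-1))*(Wt q (q*c3) (q*c2) c1 N n*(q*(q*c2))^N) := by
  obtain ⟨z, rfl⟩ := Nat.exists_eq_add_of_le hn
  have k2 : ∀ k, 1 ≤ k → k ≤ n+z+1 → c2*q^k ≠ 1 := fun k a b => (g k a (by omega)).2.1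
  have k3 : ∀ k, 1 ≤ k → k ≤ n+z+1 → c3*q^k ≠ 1 := fun k a b => (g k a (by omega)).2.2.1
  have k23 : ∀ k, 1 ≤ k → k ≤ 2*(n+z)+4 → c2*c3*q^k ≠ 1 := fun k a b => (g k a (by omega)).2.2.2.2.1
  have k123 : ∀ k, 1 ≤ k → k ≤ 2*(n+z)+3 → c1*c2*c3*q^k ≠ 1 := fun k a b => (g k a (by omega)).2.2.2.2.2.2
  rw [Wt, Wt, Nat.add_sub_cancel_left, show n+z+1-(n+1) = z by omega]
  rw [poch_succ' q (q*c2), poch_succ q q (n+z), poch_succ' q (c3*c2*c1*q^(n+z+1+2)), poch_succ q q n, poch_succ' q (c3*c2*q^(n+1+1)),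
    poch_succ' q (q*c3), show q*c2*q = q*(q*c2) by ring, show q*c3*q = q*(q*c3) by ring]
  rw [show c3*c2*c1*q^(n+z+1+2) = c1*c2*c3*q^(n+z+3) by ring, show c1*c2*c3*q^(n+z+3)*q = c1*c2*c3*q^(n+z+4) by ring,
    show q*c3*(q*c2)*c1*q^(n+z+2) = c1*c2*c3*q^(n+z+4) by ring, show c3*c2*q^(n+1+1) = c2*c3*q^(n+2) by ring,
    show c2*c3*q^(n+2)*q = c2*c3*q^(n+3) by ring, show q*c3*(q*c2)*q^(n+1) = c2*c3*q^(n+3) by ring,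
    show c3*c2*q^(2*(n+1)+1) = c2*c3*q^(2*n+3) by ring, show q*c3*(q*c2)*q^(2*n+1) = c2*c3*q^(2*n+3) by ring,
    show q*q^n = q^(n+1) by ring, show q*q^(n+z) = q^(n+z+1) by ring,
    show q^(n+1)-1 = -(1-q^(n+1)) by ring, show q^(n+z+1)-1 = -(1-q^(n+z+1)) by ring]
  have a1 : poch q (q*(q*c3)) n ≠ 0 := by
      have := poch_pow_ne k3 (a := 2) (k := n) (by omega) (by omega)
      rwa [show q*(q*c3) = c3*q^2 by ring]
  have a3 : poch q q n ≠ 0 := poch_q_ne hq1 (by omega)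
  have a4 : poch q q z ≠ 0 := poch_q_ne hq1 (by omega)
  have a5 : poch q (c2*c3*q^(n+3)) (n+z+1) ≠ 0 := poch_pow_ne k23 (by omega) (by omega)
  have a6 : 1-q*c3 ≠ 0 := by have := one_sub_ne k3 (k := 1) (by omega) (by omega); rwa [pow_one, mul_comm] at this
  have a7 : 1-q^(n+1) ≠ 0 := one_sub_q_ne hq1 (by omega) (by omega)
  have a8 : 1-c2*c3*q^(n+2) ≠ 0 := one_sub_ne k23 (by omega) (by omega)
  generalize 1-c2*c3*q^(n+2) = P1 at *
  generalize 1-q^(n+1) = P2 at *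
  generalize 1-q*c3 = P3 at *
  generalize poch q (c2*c3*q^(n+3)) (n+z+1) = P4 at *
  generalize poch q q n = P5 at *
  generalize poch q q z = P6 at *
  generalize poch q (q*(q*c3)) n = P7 at *
  generalize 1-q*c2 = P11 at *
  generalize 1-c2*c3*q^(2*n+3) = P12 at *
  generalize 1-c1*c2*c3*q^(n+z+3) = P13 at *
  generalize 1-q^(n+z+1) = P14 at *
  generalize poch q (c1*c2*c3*q^(n+z+4)) n = P16 at *
  generalize poch q (q*(q*c2)) n = P17 at *
  generalize poch q q (n+z) = P18 at *
  generalize poch q (q*c1) z = P19 at *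
  rw [mul_pow q (q*c2), mul_pow q (q*c2), pow_succ (q*c2), pow_succ (q*c2), pow_add (q*c2), pow_add q (n+z), pow_add q n z, pow_add q n 1, pow_one]
  have hX : q^n ≠ 0 := pow_ne_zero _ hq
  have hc : q*c2 ≠ 0 := by simp [*]
  have hY : (q*c2)^n ≠ 0 := pow_ne_zero _ hc
  generalize q^n = X at *
  generalize (q*c2)^n = Y at *
  generalize q^z = Z at *
  generalize (q*c2)^z = Y' at *
  clear k2 k3 k23 k123 g hq1 hn
  apply div_aux (by simp [*]) (by simp [*])
  ring
theorem O_rr {q : ℂ} (hq : q ≠ 0) (N : ℕ) : ∀ (c1 c2 c3 : ℂ) (_ : c1 ≠ 0) (_ : c2 ≠ 0)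
    (_ : ∀ k, 1 ≤ k → k ≤ N → q^k ≠ 1) (_ : Gen3 q (2*N+2) c1 c2 c3) (n m : ℕ) (_ : n ≤ N) (_ : m ≤ N),
    Wt q c3 c2 c1 N n*(q*c2)^N*∑ x ∈ Finset.range (N+1), Wt q c1 c2 c3 N x*rr q c1 c2 c3 N n x*rr q c1 c2 c3 N m x
      = if n = m then 1 else 0 := by
  have base : ∀ (N : ℕ) (c1 c2 c3 : ℂ) (_ : c1 ≠ 0) (_ : c2 ≠ 0)
    (_ : ∀ k, 1 ≤ k → k ≤ N → q^k ≠ 1) (_ : Gen3 q (2*N+2) c1 c2 c3), Wt q c3 c2 c1 N 0*(q*c2)^N*∑ x ∈ Finset.range (N+1), Wt q c1 c2 c3 N x*rr q c1 c2 c3 N 0 x*rr q c1 c2 c3 N 0 x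
      = 1 := by
    intro N c1 c2 c3 h1 h2 hq1 g
    have k23 : ∀ k, 1 ≤ k → k ≤ 2*N+2 → c2*c3*q^k ≠ 1 := fun k a b => (g k a (by omega)).2.2.2.2.1
    have o := O_zero (c3 := c3) hq h1 h2 N hq1 (fun k a b => (g k a (by omega)).1) (fun k a b => (g k a (by omega)).2.2.2.1)
    simp only [rr_zero_left, mul_one]
    have a1 : poch q q N ≠ 0 := poch_q_ne hq1 le_rfl
    have a2 : 1-c2*c3*q ≠ 0 := by have := one_sub_ne k23 (k := 1) (by omega) (by omega); rwa [pow_one] at this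
    have a3 : poch q (c2*c3*q^2) N ≠ 0 := poch_pow_ne k23 (by omega) (by omega)
    have e : Wt q c3 c2 c1 N 0 = poch q (q*c1) N / poch q (c2*c3*q^2) N := by
      rw [Wt]
      simp only [poch_zero, Nat.sub_zero, pow_zero, mul_zero, zero_add, pow_one]
      rw [poch_succ' q (c3*c2*q), show c3*c2*q*q = c2*c3*q^2 by ring, show c3*c2*q = c2*c3*q by ring]
      generalize poch q (c2*c3*q^2) N = P1 at *
      generalize 1-c2*c3*q = P2 at *
      field_simp
    rw [e]
    generalize poch q (c2*c3*q^2) N = P1 at *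
    rw [div_mul_eq_mul_div, div_mul_eq_mul_div, div_eq_one_iff_eq a3, ← o]; ring
  induction N with
  | zero =>
    intro c1 c2 c3 h1 h2 hq1 g n m hn hm
    obtain rfl : n = 0 := by omega
    obtain rfl : m = 0 := by omega
    simpa using base 0 c1 c2 c3 h1 h2 hq1 g
  | succ N ih =>
    intro c1 c2 c3 h1 h2 hq1 g n m hn hm
    have z : ∀ n ≤ N, ∑ x ∈ Finset.range (N+1+1), Wt q c1 c2 c3 (N+1) x*rr q c1 c2 c3 (N+1) (n+1) x*1 = 0 := by
      intro n hn
      rw [O_full hq h1 h2 N n hn hq1 g]; simp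
    rcases n with _ | n
    · rcases m with _ | m
      · simpa using base (N+1) c1 c2 c3 h1 h2 hq1 g
      · have := z m (by omega)
        simp only [rr_zero_left, mul_one] at this ⊢
        rw [this]; simp
    · rcases m with _ | m
      · have := z n (by omega)
        simp only [rr_zero_left, mul_one] at this ⊢
        rw [this]; simp
      · have ih := ih c1 (q*c2) (q*c3) h1 (mul_ne_zero hq h2) (fun k a b => hq1 k a (by omega))
          (by
            intro k a b
            have u1 := g k a (by omega)
            have u2 := g (k+1) (by omega) (by omega)
            have u3 := g (k+2) (by omega) (by omega)
            refine ⟨u1.1, ?_, ?_, ?_, ?_, ?_, ?_⟩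
            · convert u2.2.1 using 1; ring
            · convert u2.2.2.1 using 1; ring
            · convert u2.2.2.2.1 using 1; ring
            · convert u3.2.2.2.2.1 using 1; ring
            · convert u2.2.2.2.2.2.1 using 1; ring
            · convert u3.2.2.2.2.2.2 using 1; ring) n m (by omega) (by omega)
        rw [O_full hq h1 h2 N n (by omega) hq1 g]
        have k2 : ∀ k, 1 ≤ k → k ≤ N+1 → c2*q^k ≠ 1 := fun k a b => (g k a (by omega)).2.1
        have k123 : ∀ k, 1 ≤ k → k ≤ 2*N+3 → c1*c2*c3*q^k ≠ 1 := fun k a b => (g k a (by omega)).2.2.2.2.2.2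
        have a3 : 1-q*c2 ≠ 0 := by have := one_sub_ne k2 (k := 1) (by omega) (by omega); rwa [pow_one, mul_comm] at this
        have a4 : 1-c1*c2*c3*q^(N+3) ≠ 0 := one_sub_ne k123 (by omega) (by omega)
        have a5 : q^(N+1)-1 ≠ 0 := sub_ne_zero.2 (hq1 _ (by omega) le_rfl)
        have hM : q^(m+1)*((1-q*c2)*(1-c1*c2*c3*q^(N+3))*(q^(N+1)-1)) ≠ 0 := mul_ne_zero (pow_ne_zero _ hq) (mul_ne_zero (mul_ne_zero a3 a4) a5)
        have st : ∀ x ∈ Finset.range (N+1), q^(m+1)*((1-q*c2)*(1-c1*c2*c3*q^(N+3))*(q^(N+1)-1))*(bt q c1 c2 c3 N x*rr q c1 (q*c2) (q*c3) N n x*(rr q c1 c2 c3 (N+1) (m+1) x-rr q c1 c2 c3 (N+1) (m+1) (x+1)))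
           = (q^(N+1)*(q^(m+1)-1)*(1-c2*c3*q^(m+2)))*(Wt q c1 (q*c2) (q*c3) N x*rr q c1 (q*c2) (q*c3) N n x*rr q c1 (q*c2) (q*c3) N m x) := by
          intro x _
          have f := rr_FS (c1 := c1) (c2 := c2) (c3 := c3) hq N m x (by omega) hq1 k2 k123
          have w := Wt_bt hq c1 c2 c3 N x
          apply mul_left_cancel₀ (pow_ne_zero x hq)
          linear_combination (bt q c1 c2 c3 N x*rr q c1 (q*c2) (q*c3) N n x)*f-(q^(N+1)*(q^(m+1)-1)*(1-c2*c3*q^(m+2))*rr q c1 (q*c2) (q*c3) N n x*rr q c1 (q*c2) (q*c3) N m x)*w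
        have st := Finset.sum_congr rfl st
        rw [← Finset.mul_sum, ← Finset.mul_sum] at st
        have wl := Wt_low (c1 := c1) (c3 := c3) hq h2 N n (by omega) hq1 g
        apply mul_left_cancel₀ hM
        by_cases hnm : n = m
        · subst hnm
          simp only [if_true] at ih ⊢
          generalize ∑ x ∈ Finset.range (N+1), (bt q c1 c2 c3 N x*rr q c1 (q*c2) (q*c3) N n x*(rr q c1 c2 c3 (N+1) (n+1) x-rr q c1 c2 c3 (N+1) (n+1) (x+1))) = T1 at *
          generalize ∑ x ∈ Finset.range (N+1), Wt q c1 (q*c2) (q*c3) N x*rr q c1 (q*c2) (q*c3) N n x*rr q c1 (q*c2) (q*c3) N n x = T2 at *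
          linear_combination (Wt q c3 c2 c1 (N+1) (n+1)*(q*c2)^(N+1)*(1-q*c3))*st+T2*wl+q^(n+1)*((1-q*c2)*(1-c1*c2*c3*q^(N+3))*(q^(N+1)-1))*ih
        · simp only [hnm, if_false, add_left_inj] at ih ⊢
          have b1 : q^(n+1)-1 ≠ 0 := sub_ne_zero.2 (hq1 _ (by omega) (by omega))
          have b2 : 1-c2*c3*q^(n+2) ≠ 0 := sub_ne_zero.2 (g (n+2) (by omega) (by omega)).2.2.2.2.1.symm
          have b3 : q^(N+1) ≠ 0 := pow_ne_zero _ hq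
          apply mul_left_cancel₀ (mul_ne_zero (mul_ne_zero b3 b1) b2)
          generalize ∑ x ∈ Finset.range (N+1), (bt q c1 c2 c3 N x*rr q c1 (q*c2) (q*c3) N n x*(rr q c1 c2 c3 (N+1) (m+1) x-rr q c1 c2 c3 (N+1) (m+1) (x+1))) = T1 at *
          generalize ∑ x ∈ Finset.range (N+1), Wt q c1 (q*c2) (q*c3) N x*rr q c1 (q*c2) (q*c3) N n x*rr q c1 (q*c2) (q*c3) N m x = T2 at *
          linear_combination (q^(N+1)*(q^(n+1)-1)*(1-c2*c3*q^(n+2))*Wt q c3 c2 c1 (N+1) (n+1)*(q*c2)^(N+1)*(1-q*c3))*st+(q^(N+1)*(q^(m+1)-1)*(1-c2*c3*q^(m+2))*T2)*wl+(q^(N+1)*(q^(m+1)-1)*(1-c2*c3*q^(m+2)))*q^(n+1)*((1-q*c2)*(1-c1*c2*c3*q^(N+3))*(q^(N+1)-1))*ih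
end qR
namespace qR
lemma TIIb (q A B C D E F G : ℂ) (hq : q ≠ 0) (hb : A*B*C*D*q^2 = E*F*G) (K : ℕ)
    (hE : poch q E (K+1) ≠ 0) (hF : poch q F (K+2) ≠ 0) (hG : poch q G (K+1) ≠ 0)
    (hQ : poch q q (K+1) ≠ 0) (hA : B*q^(K+1) = 1) :
    q^2*(F-A)*(F-D)*B*C*(C-B)*S4 q A D (B*q) (C*q) E (F*q) G (K+2)
    = F*(1-F)* (C*(B*q-E)*(B*q-G)*S4 q A D B (C*q) E F G (K+2)
       - B*(C*q-E)*(C*q-G)*S4 q A D (B*q) C E F G (K+2)) := by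
  have := TII_partial q A B C D E F G hq hb (K+1) hE hF hG hQ
  rw [show tm q A D (B*q) (C*q) E (F*q) G (K+1) = 0 by
    rw [tm, poch_eq_zero (show B*q*q^K = 1 by rw [← hA]; ring) (by omega)]; simp] at this
  rw [this]; ring
lemma S4_cancel (q B C D E F t : ℂ) (K : ℕ) (h : ∀ k < K, poch q t k ≠ 0) :
    S4 q t B C D E F t K = S4 q 0 B C D E F 0 K := by
  unfold S4; apply Finset.sum_congr rfl; intro k hk
  have h0 : poch q 0 k = 1 := by simp [poch]
  have ht := h k (Finset.mem_range.1 hk)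
  simp only [tm, h0]
  generalize poch q t k = P at *
  rw [show P*poch q B k*poch q C k*poch q D k*q^k = P*(1*poch q B k*poch q C k*poch q D k*q^k) by ring,
    show poch q E k*poch q F k*P*poch q q k = P*(poch q E k*poch q F k*1*poch q q k) by ring, mul_div_mul_left _ _ ht]
lemma aff_A (q A B C D E F G : ℂ) (K : ℕ) :
    aff q A B C D E F G A K = (1-A)*S4 q (A*q) B C D E F G K := by
  rw [S4_swap, ← aff_C]
  simp only [aff, tm]; apply Finset.sum_congr rfl; intros; ring
lemma aff_B (q A B C D E F G : ℂ) (K : ℕ) :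
    aff q A B C D E F G B K = (1-B)*S4 q A (B*q) C D E F G K := by
  rw [S4_swap, ← aff_D]
  simp only [aff, tm]; apply Finset.sum_congr rfl; intros; ring
lemma aff_G (q A B C D E F G : ℂ) (K : ℕ) (hF : ∀ k < K, poch q (G*q) k ≠ 0)
    (hF' : ∀ k < K, poch q G k ≠ 0) :
    aff q A B C D E F (G*q) G K = (1-G)*S4 q A B C D E F G K := by
  rw [S4_swapFG, ← aff_F _ _ _ _ _ _ _ _ _ hF hF']
  simp only [aff, tm]; apply Finset.sum_congr rfl; intros; ring
lemma poch_q_ne_of {q F : ℂ} {K : ℕ} (h : poch q F (K+1) ≠ 0) : ∀ k < K+1, poch q (F*q) k ≠ 0 := by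
  intro k hk
  have := poch_ne_of_le (m := k+1) h (by omega)
  rw [poch_succ'] at this
  exact right_ne_zero_of_mul this
/-- bracket lemma -/
lemma BR (q A B C D E F G : ℂ) (hq : q ≠ 0) (hb : A*B*C*D*q^2 = E*F*G) (K : ℕ)
    (hE : poch q E K ≠ 0) (hF : poch q F (K+1) ≠ 0) (hG : poch q G (K+1) ≠ 0)
    (hQ : poch q q K ≠ 0) (hA : A*q^K = 1) (hFG : F ≠ G) :
    q^2*C*D*(D-C)*(B*(A-F)*(A-G)*(1-B)*S4 q A (B*q) (C*q) (D*q) E (F*q) (G*q) (K+1)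
       - A*(B-F)*(B-G)*(1-A)*S4 q (A*q) B (C*q) (D*q) E (F*q) (G*q) (K+1))
     = (A-B)*F*G*(1-F)*(1-G)*(C*(D*q-E)*S4 q A B (C*q) D E F G (K+1)-D*(C*q-E)*S4 q A B C (D*q) E F G (K+1)) := by
  have t1 := TII q A C D B E F G hq (by linear_combination hb) K hE hF (poch_ne_of_le hG (by omega)) hQ (Or.inl hA)
  have t2 := TII q A C D B E G F hq (by linear_combination hb) K hE hG (poch_ne_of_le hF (by omega)) hQ (Or.inl hA)
  rw [S4_swapFG q A B (C*q) D E G F, S4_swapFG q A B C (D*q) E G F, S4_swapFG q A B (C*q) (D*q) E (G*q) F] at t2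
  have f1 := aff_rel q A B (C*q) (D*q) E (F*q) (G*q) A F G (K+1)
  have f2 := aff_rel q A B (C*q) (D*q) E (F*q) (G*q) B F G (K+1)
  have hF' : ∀ k < K+1, poch q F k ≠ 0 := fun k hk => poch_ne_of_le hF (by omega)
  have hG' : ∀ k < K+1, poch q G k ≠ 0 := fun k hk => poch_ne_of_le hG (by omega)
  rw [aff_A, aff_F _ _ _ _ _ _ _ _ _ (poch_q_ne_of hF) hF', aff_G _ _ _ _ _ _ _ _ _ (poch_q_ne_of hG) hG'] at f1
  rw [aff_B, aff_F _ _ _ _ _ _ _ _ _ (poch_q_ne_of hF) hF', aff_G _ _ _ _ _ _ _ _ _ (poch_q_ne_of hG) hG'] at f2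
  apply mul_left_cancel₀ (sub_ne_zero.2 hFG)
  linear_combination q^2*C*D*(D-C)*(B*(A-F)*(A-G)*f2-A*(B-F)*(B-G)*f1)+(A-B)*F*(1-F)*t2-(A-B)*G*(1-G)*t1
lemma BRb (q A B C D E F : ℂ) (hq : q ≠ 0) (hb : B*C*D*q^2 = E*F) (K : ℕ)
    (hE : poch q E (K+1) ≠ 0) (hF : poch q F (K+2) ≠ 0) (hG : poch q A (K+1) ≠ 0)
    (hQ : poch q q (K+1) ≠ 0) (hA : C*q^(K+1) = 1) (hA0 : A ≠ 0) :
    q^2*C*D*(D-C)*(B-F)*S4 q (A*q) B (C*q) (D*q) E (F*q) (A*q) (K+1)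
     = F*(1-F)*(C*(D*q-E)*S4 q A B (C*q) D E F A (K+2)-D*(C*q-E)*S4 q A B C (D*q) E F A (K+2)) := by
  have t1 := TIIb q A C D B E F A hq (by linear_combination A*hb) K hE hF hG hQ hA
  have t0 := TIIb q 0 C D B E F 0 hq (by ring) K hE hF (by simp [poch]) hQ hA
  have hA' : ∀ k < K+2, poch q A k ≠ 0 := fun k hk => poch_ne_of_le hG (by omega)
  have e : S4 q (A*q) B (C*q) (D*q) E (F*q) (A*q) (K+1) = S4 q 0 B (C*q) (D*q) E (F*q) 0 (K+2) := by
    rw [S4_cancel _ _ _ _ _ _ _ _ (poch_q_ne_of hG), S4_trunc (Or.inr (show C*q*q^K = 1 by rw [← hA]; ring)) (show K < K+2 by omega)]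
  rw [e]
  rw [S4_cancel _ _ _ _ _ _ _ _ hA', S4_cancel _ _ _ _ _ _ _ _ hA', S4_cancel _ _ _ _ _ _ _ _ hA'] at t1
  rw [S4_cancel _ _ _ _ _ _ _ _ hA', S4_cancel _ _ _ _ _ _ _ _ hA']
  apply mul_left_cancel₀ hA0
  linear_combination t1-t0
end qR
namespace qR
lemma i1 {q : ℂ} (hq : q ≠ 0) (k : ℕ) : (q^(k+1))⁻¹*q = (q^k)⁻¹ := by
  rw [pow_succ, mul_inv, mul_assoc, inv_mul_cancel₀ hq, mul_one]
lemma rr_BR {q c1 c2 c3 : ℂ} (hq : q ≠ 0) (h1 : c1 ≠ 0) (h2 : c2 ≠ 0) (h3 : c3 ≠ 0) (N a b : ℕ) (ha : a ≤ N) (hb : b ≤ N+1)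
    (hq1 : ∀ k, 1 ≤ k → k ≤ N+1 → q^k ≠ 1) (g : Gen3 q (2*N+4) c1 c2 c3) :
    (1-c1*c2*c3*q^(N+3))*(q^(N+1)-1)*(1-c1*c3*q^(2*b+1))*q^b*((1-c2*q^(a+1))*rr q c2 c1 c3 (N+1) b a
       + c2*q^(a+1)*(1-c1*q^(a+1))*rr q c2 c1 c3 (N+1) b (a+1))
     = (1-c1*c2*q^(2*a+2))*(q^b*(1-c1*c2*c3*q^(N+b+3))*(q^(N+1)-q^b)*(1-c1*c3*q^(b+1))*rr q (q*c2) c1 (q*c3) N b a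
       + (q^b-c2*q^(N+2))*(1-c1*c3*q^(N+b+2))*(q^b-1)*rr q (q*c2) c1 (q*c3) N (b-1) a) := by
  have k1 : ∀ k, 1 ≤ k → k ≤ N+1 → c1*q^k ≠ 1 := fun k a b => (g k a (by omega)).1
  have k123 : ∀ k, 1 ≤ k → k ≤ 2*N+4 → c2*c1*c3*q^k ≠ 1 := fun k a b => by rw [mul_comm c2]; exact (g k a (by omega)).2.2.2.2.2.2
  have hX : (q^(a+1))⁻¹*q^(a+1) = 1 := inv_pow_mul hq _
  have hNN : (q^(N+1))⁻¹*q^(N+1) = 1 := inv_pow_mul hq _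
  have pX : q^(a+1) ≠ 0 := pow_ne_zero _ hq
  have pY : q^(N+1) ≠ 0 := pow_ne_zero _ hq
  rcases b with _ | b
  · simp only [rr_zero_left, pow_zero]; ring
  rw [Nat.add_sub_cancel]
  have hbb : (q^(b+1))⁻¹*q^(b+1) = 1 := inv_pow_mul hq _
  have pB : q^(b+1) ≠ 0 := pow_ne_zero _ hq
  have s1 : q^(a+1+1) = q*q^(a+1) := by ring
  have s2 : q^(N+1+2) = q^2*q^(N+1) := by ring
  have s3 : q^(b+1+1) = q*q^(b+1) := by ring
  have s4 : q^(N+3) = q^2*q^(N+1) := by ring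
  have s5 : q^(N+2) = q*q^(N+1) := by ring
  have s6 : q^(2*(b+1)+1) = q*q^(b+1)*q^(b+1) := by ring
  have s7 : q^(2*a+2) = q^(a+1)*q^(a+1) := by ring
  have s8 : q^(N+(b+1)+3) = q^2*q^(N+1)*q^(b+1) := by ring
  have s9 : q^(N+(b+1)+2) = q*q^(N+1)*q^(b+1) := by ring
  rcases Nat.lt_or_ge b N with hbN | hbN
  · have t := BR q (q^(b+1))⁻¹ (c1*c3*q^(b+1+1)) (q^(a+1))⁻¹ (c2*c1*q^(a+1)) (q*c1) (c2*c1*c3*q^(N+1+2)) (q^(N+1))⁻¹ hq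
      (by
        rw [s2, s3]
        linear_combination (c1^2*c2*c3*q^3*(q^(a+1))⁻¹*q^(a+1))*hbb+c1^2*c2*c3*q^3*hX-c1^2*c2*c3*q^3*hNN) (b+1)
      (poch_one_ne k1 (by omega)) (poch_pow_ne k123 (by omega) (by omega)) (poch_G_ne hq hq1 le_rfl (by omega)) (poch_q_ne hq1 (by omega)) hbb
      (by
        intro h
        have := k123 (2*N+4) (by omega) le_rfl
        apply this
        rw [show q^(2*N+4) = q^(N+1+2)*q^(N+1) by ring, ← mul_assoc, h, hNN])
    rw [i1 hq, i1 hq, i1 hq, show c2*c1*q^(a+1)*q = c2*c1*q^(a+1+1) by ring, ← rr, ← rr] at t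
    have e1 : S4 q (q^(b+1))⁻¹ (c1*c3*q^(b+1+1)*q) (q^a)⁻¹ (c2*c1*q^(a+1+1)) (q*c1) (c2*c1*c3*q^(N+1+2)*q) (q^N)⁻¹ (b+1+1) = rr q (q*c2) c1 (q*c3) N (b+1) a := by
      rw [rr]; congr 1 <;> ring
    have e2 : S4 q (q^b)⁻¹ (c1*c3*q^(b+1+1)) (q^a)⁻¹ (c2*c1*q^(a+1+1)) (q*c1) (c2*c1*c3*q^(N+1+2)*q) (q^N)⁻¹ (b+1+1) = rr q (q*c2) c1 (q*c3) N b a := by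
      rw [← rr_eq hq _ _ _ N b a (b+1+1) (Or.inl (by omega))]; congr 1 <;> ring
    rw [e1, e2, ← i1 hq a] at t
    generalize rr q (q*c2) c1 (q*c3) N b a = R1 at *
    generalize rr q (q*c2) c1 (q*c3) N (b+1) a = R2 at *
    generalize rr q c2 c1 c3 (N+1) (b+1) a = R3 at *
    generalize rr q c2 c1 c3 (N+1) (b+1) (a+1) = R4 at *
    simp only [s1,s2,s3,s4,s5,s6,s7,s8,s9] at t ⊢
    clear e1 e2 k1 k123 hq1 g hX hNN hbb s1 s2 s3 s4 s5 s6 s7 s8 s9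
    generalize q^(a+1) = X at *
    generalize q^(N+1) = Y at *
    generalize q^(b+1) = Q at *
    field_simp at t
    linear_combination t
  · obtain rfl : b = N := by omega
    have t := BRb q (q^(b+1))⁻¹ (c1*c3*q^(b+1+1)) (q^(a+1))⁻¹ (c2*c1*q^(a+1)) (q*c1) (c2*c1*c3*q^(b+1+2)) hq
      (by
        rw [s2, s3]
        linear_combination c1^2*c2*c3*q^3*q^(b+1)*hX) a
      (poch_one_ne k1 (by omega)) (poch_pow_ne k123 (by omega) (by omega)) (poch_G_ne hq hq1 le_rfl (by omega)) (poch_q_ne hq1 (by omega)) hX (inv_ne_zero pB)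
    rw [i1 hq, i1 hq, show c2*c1*q^(a+1)*q = c2*c1*q^(a+1+1) by ring, rr_eq hq _ _ _ _ _ _ _ (Or.inr (by omega)), rr_eq hq _ _ _ _ _ _ _ (Or.inr (by omega))] at t
    have e2 : S4 q (q^b)⁻¹ (c1*c3*q^(b+1+1)) (q^a)⁻¹ (c2*c1*q^(a+1+1)) (q*c1) (c2*c1*c3*q^(b+1+2)*q) (q^b)⁻¹ (a+1) = rr q (q*c2) c1 (q*c3) b b a := by
      rw [← rr_eq hq _ _ _ b b a (a+1) (Or.inr (by omega))]; congr 1 <;> ring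
    rw [e2, ← i1 hq a] at t
    generalize rr q (q*c2) c1 (q*c3) b b a = R1 at *
    generalize rr q c2 c1 c3 (b+1) (b+1) a = R3 at *
    generalize rr q c2 c1 c3 (b+1) (b+1) (a+1) = R4 at *
    simp only [s1,s2,s3,s4,s5,s6,s7,s8,s9] at t ⊢
    rw [sub_self, mul_zero, zero_mul, zero_mul, zero_add]
    clear e2 k1 k123 hq1 g hX hNN hbb s1 s2 s3 s4 s5 s6 s7 s8 s9
    generalize q^(a+1) = X at *
    generalize q^(b+1) = Q at *
    field_simp at t
    linear_combination (Q-1)*(1-q*c1*c3*Q^2)*Q*t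
end qR
namespace qR
def kk (q c : ℂ) (n : ℕ) : ℂ := ∏ l ∈ Finset.range n, (-c*q^(l+1))
lemma kk_zero (q c : ℂ) : kk q c 0 = 1 := by simp [kk]
lemma kk_succ (q c : ℂ) (n : ℕ) : kk q c (n+1) = kk q c n*(-c*q^(n+1)) := by
  simp [kk, Finset.prod_range_succ]
lemma kk_q (q c : ℂ) (n : ℕ) : kk q (q*c) n = q^n*kk q c n := by
  induction n with
  | zero => simp [kk_zero]
  | succ n ih => rw [kk_succ, kk_succ, ih]; ring
lemma kk_succ' (q c : ℂ) (n : ℕ) : kk q c (n+1) = (-c*q)*kk q (q*c) n := by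
  rw [kk_succ, kk_q]; ring
lemma kk_ne {q c : ℂ} (hq : q ≠ 0) (hc : c ≠ 0) (n : ℕ) : kk q c n ≠ 0 := by
  rw [kk, Finset.prod_ne_zero_iff]; intro l _; simp [*]
def ww (q c c' : ℂ) (n : ℕ) : ℂ := kk q c n*poch q (q*c') n / poch q (q*c) n
lemma ww_zero (q c c' : ℂ) : ww q c c' 0 = 1 := by simp [ww, kk_zero, poch_zero]
lemma hh01_sq (q : ℂ) (n : ℕ) : hh q 0 1 n*hh q 0 1 n*q^n = q^(n*n) := by
  induction n with
  | zero => simp [hh_zero]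
  | succ n ih =>
    rw [hh_succ, show q^((n+1)*(n+1)) = q^(n*n)*q^(2*n+1) by ring, ← ih]; ring
lemma hh01_add (q : ℂ) (a z : ℕ) : hh q 0 1 (a+z) = hh q 0 1 a*q^(a*z)*hh q 0 1 z := by
  induction z with
  | zero => simp [hh_zero]
  | succ z ih => rw [← add_assoc, hh_succ, hh_succ, ih]; ring
lemma kk_hh (q c : ℂ) (n : ℕ) : kk q c n = (q*c)^n*hh q 0 1 n := by
  induction n with
  | zero => simp [hh_zero, kk_zero]
  | succ n ih => rw [kk_succ, hh_succ, ih]; ring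
lemma sg_hh {q d : ℂ} (hq : q ≠ 0) (hd : d ≠ 0) (e : ℂ) (a : ℕ) : sg q d a*hh q 0 (d*q*e) a*q^a = e^a := by
  induction a with
  | zero => simp [hh_zero, sg_zero]
  | succ n ih =>
    rw [sg_succ, hh_succ, pow_succ e, ← ih, pow_succ q (n+1)]
    have := pow_ne_zero n hq
    field_simp; ring
lemma R_zero {q c1 c2 c3 : ℂ} (hq : q ≠ 0) (h1 : c1 ≠ 0) (h2 : c2 ≠ 0) (N : ℕ)
    (hq1 : ∀ k, 1 ≤ k → k ≤ N → q^k ≠ 1) (g : Gen3 q (2*N+2) c1 c2 c3) :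
    ∑ a ∈ Finset.range (N+1), ww q c2 c1 a*Wt q c1 c2 c3 N a = kk q c3 N := by
  have s := sum65 q (c1*c2) 0 hq (mul_ne_zero h1 h2) N (q*c3) 1 hq1 (fun k a b => (g k a (by omega)).2.2.2.1)
  have hQ : poch q q N ≠ 0 := poch_q_ne hq1 le_rfl
  have hH : hh q 0 1 N ≠ 0 := by
    rw [hh, Finset.prod_ne_zero_iff]; intro l _; simp [*]
  have hX : q^N ≠ 0 := pow_ne_zero _ hq
  have e1 : sg q (c1*c2) N*hh q 0 (c1*c2*(q*c3)*1*q^(N+1)) N = hh q 0 1 N*kk q c3 N := by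
    apply mul_right_cancel₀ hX
    have := sg_hh hq (mul_ne_zero h1 h2) (c3*q^(N+1)) N
    rw [show c1*c2*q*(c3*q^(N+1)) = c1*c2*(q*c3)*1*q^(N+1) by ring] at this
    rw [this, kk_hh, mul_pow q c3]
    linear_combination (-q^N*c3^N)*hh01_sq q N
  rw [e1] at s
  apply mul_left_cancel₀ hH
  apply mul_left_cancel₀ (inv_ne_zero hQ)
  trans hh q 0 1 N*kk q c3 N / poch q q N
  swap
  · field_simp
  rw [← s, Finset.mul_sum, Finset.mul_sum]
  apply Finset.sum_congr rfl
  intro a ha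
  rw [Finset.mem_range] at ha
  obtain ⟨z, rfl⟩ := Nat.exists_eq_add_of_le (show a ≤ N by omega)
  have k1 : ∀ k, 1 ≤ k → k ≤ 2*(a+z)+2 → c1*q^k ≠ 1 := fun k a b => (g k a (by omega)).1
  have k2 : ∀ k, 1 ≤ k → k ≤ 2*(a+z)+2 → c2*q^k ≠ 1 := fun k a b => (g k a (by omega)).2.1
  have p1 : poch q (q*c1) a ≠ 0 := poch_one_ne k1 (by omega)
  have p2 : poch q (q*c2) a ≠ 0 := poch_one_ne k2 (by omega)
  have e2 : sg q (c1*c2) a*hh q 0 1 z*hh q 0 (c1*c2*q^(a+z+1)*1) a = hh q 0 1 a*hh q 0 1 (a+z) := by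
    apply mul_right_cancel₀ (pow_ne_zero a hq)
    have := sg_hh hq (mul_ne_zero h1 h2) (q^(a+z)) a
    rw [show c1*c2*q*q^(a+z) = c1*c2*q^(a+z+1)*1 by ring] at this
    rw [hh01_add]
    have t := hh01_sq q a
    rw [← pow_mul, show (a+z)*a = a*a+a*z by ring, pow_add q (a*a)] at this
    linear_combination hh q 0 1 z*this-q^(a*z)*hh q 0 1 z*t
  rw [e65, ww, Wt, kk_hh, Nat.add_sub_cancel_left, show c1*c2*c3*q^(a+z+2) = c1*c2*q^(a+z+1)*(q*c3) by ring]
  generalize poch q (c1*c2*q^(a+z+1)*(q*c3)) a = P1 at *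
  generalize poch q (c1*c2*q^(a+1)) (a+z+1) = P2 at *
  generalize poch q (q*c1) a = P3 at *
  generalize poch q (q*c2) a = P4 at *
  generalize poch q q (a+z) = P5 at *
  have hc : (q*c2)^a ≠ 0 := by simp [*]
  generalize (q*c2)^a = P6 at *
  generalize poch q (q*c3) z = P7 at *
  generalize 1-c1*c2*q^(2*a+1) = P8 at *
  have e3 : (P5)⁻¹*(hh q 0 1 (a+z)*(P6*hh q 0 1 a*P3/P4*(P5*P7*P8*P4*P1/(poch q q a*poch q q z*P6*P2*P3))))
     = (hh q 0 1 a*hh q 0 1 (a+z))*(P7*P8*P1/(poch q q a*poch q q z*P2)) := by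
    field_simp
  rw [e3, ← e2]; ring
lemma Gen3_low {q c1 c2 c3 : ℂ} {N : ℕ} (g : Gen3 q (N+2) c1 c2 c3) : Gen3 q N c1 (q*c2) (q*c3) := by
  intro k a b
  have u1 := g k a (by omega)
  have u2 := g (k+1) (by omega) (by omega)
  have u3 := g (k+2) (by omega) (by omega)
  refine ⟨u1.1, ?_, ?_, ?_, ?_, ?_, ?_⟩
  · convert u2.2.1 using 1; ring
  · convert u2.2.2.1 using 1; ring
  · convert u2.2.2.2.1 using 1; ring
  · convert u3.2.2.2.2.1 using 1; ring
  · convert u2.2.2.2.2.2.1 using 1; ring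
  · convert u3.2.2.2.2.2.2 using 1; ring
lemma Gen3_swap12 {q c1 c2 c3 : ℂ} {N : ℕ} (g : Gen3 q N c1 c2 c3) : Gen3 q N c2 c1 c3 := by
  intro k a b
  obtain ⟨u1,u2,u3,u4,u5,u6,u7⟩ := g k a b
  rw [mul_comm c2 c1]
  exact ⟨u2,u1,u3,u4,u6,u5,u7⟩
lemma Gen3_swap23 {q c1 c2 c3 : ℂ} {N : ℕ} (g : Gen3 q N c1 c2 c3) : Gen3 q N c1 c3 c2 := by
  intro k a b
  obtain ⟨u1,u2,u3,u4,u5,u6,u7⟩ := g k a b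
  refine ⟨u1,u3,u2,u6,?_,u4,?_⟩
  · rwa [mul_comm c3 c2]
  · rwa [mul_assoc c1, mul_comm c3 c2, ← mul_assoc]
lemma Gen3_mono {q c1 c2 c3 : ℂ} {N M : ℕ} (g : Gen3 q N c1 c2 c3) (h : M ≤ N) : Gen3 q M c1 c2 c3 :=
  fun k a b => g k a (by omega)
lemma ww_up {q c c' : ℂ} (hq : q ≠ 0) (n : ℕ) (h : ∀ k, 1 ≤ k → k ≤ n+1 → c*q^k ≠ 1) :
    ww q c c' n*(q^n*(1-q*c)) = (1-c*q^(n+1))*ww q (q*c) c' n := by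
  rw [ww, ww, kk_q]
  have a1 : poch q (q*c) n ≠ 0 := poch_one_ne h (by omega)
  have a2 : 1-q*c ≠ 0 := by have := one_sub_ne h (k := 1) (by omega) (by omega); rwa [pow_one, mul_comm] at this
  have a3 : poch q (q*(q*c)) n ≠ 0 := by
    have := poch_pow_ne h (a := 2) (k := n) (by omega) (by omega)
    rwa [show q*(q*c) = c*q^2 by ring]
  have := poch_shift q (q*c) n
  rw [show q*c*q = q*(q*c) by ring, show q*c*q^n = c*q^(n+1) by ring] at this
  generalize poch q (q*(q*c)) n = P1 at *
  generalize poch q (q*c) n = P2 at *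
  field_simp
  linear_combination (kk q c n*poch q (q*c') n)*this
lemma ww_succ_lo {q c c' : ℂ} (n : ℕ) (h : ∀ k, 1 ≤ k → k ≤ n+1 → c*q^k ≠ 1) :
    ww q c c' (n+1)*(1-q*c) = -c*q*(1-c'*q^(n+1))*ww q (q*c) c' n := by
  rw [ww, ww, kk_succ', poch_succ' q (q*c), poch_succ q (q*c')]
  have a2 : 1-q*c ≠ 0 := by have := one_sub_ne h (k := 1) (by omega) (by omega); rwa [pow_one, mul_comm] at this
  have a3 : poch q (q*(q*c)) n ≠ 0 := by
    have := poch_pow_ne h (a := 2) (k := n) (by omega) (by omega)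
    rwa [show q*(q*c) = c*q^2 by ring]
  rw [show q*c*q = q*(q*c) by ring]
  generalize poch q (q*(q*c)) n = P1 at *
  generalize 1-q*c = P2 at *
  field_simp
  ring
lemma ww_succ_lo2 {q c c' : ℂ} (n : ℕ) (h : ∀ k, 1 ≤ k → k ≤ n+1 → c*q^k ≠ 1) :
    ww q c c' (n+1)*(1-q*c) = -c*q*(1-q*c')*ww q (q*c) (q*c') n := by
  rw [ww, ww, kk_succ', poch_succ' q (q*c), poch_succ' q (q*c')]
  have a2 : 1-q*c ≠ 0 := by have := one_sub_ne h (k := 1) (by omega) (by omega); rwa [pow_one, mul_comm] at this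
  have a3 : poch q (q*(q*c)) n ≠ 0 := by
    have := poch_pow_ne h (a := 2) (k := n) (by omega) (by omega)
    rwa [show q*(q*c) = c*q^2 by ring]
  rw [show q*c*q = q*(q*c) by ring, show q*c'*q = q*(q*c') by ring]
  generalize poch q (q*(q*c)) n = P1 at *
  generalize poch q (q*(q*c')) n = P3 at *
  generalize 1-q*c = P2 at *
  generalize kk q (q*c) n = P4 at *
  field_simp
lemma ww_succ {q c c' : ℂ} (n : ℕ) (h : ∀ k, 1 ≤ k → k ≤ n+1 → c*q^k ≠ 1) :
    ww q c c' (n+1)*(1-c*q^(n+1)) = -c*q^(n+1)*(1-c'*q^(n+1))*ww q c c' n := by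
  rw [ww, ww, kk_succ, poch_succ q (q*c), poch_succ q (q*c')]
  have a2 : 1-c*q^(n+1) ≠ 0 := one_sub_ne h (k := n+1) (by omega) (by omega)
  have a3 : poch q (q*c) n ≠ 0 := poch_one_ne h (by omega)
  rw [show q*c*q^n = c*q^(n+1) by ring, show q*c'*q^n = c'*q^(n+1) by ring]
  generalize poch q (q*c) n = P1 at *
  generalize 1-c*q^(n+1) = P2 at *
  field_simp
end qR
namespace qR
def RS (q c1 c2 c3 : ℂ) (N i b : ℕ) : ℂ :=
  ∑ a ∈ Finset.range (N+1), ww q c2 c1 a*Wt q c1 c2 c3 N a*(rr q c1 c2 c3 N i a*rr q c2 c1 c3 N b a)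
lemma RS_refl {q c1 c2 c3 : ℂ} (hq : q ≠ 0) (h1 : c1 ≠ 0) (h2 : c2 ≠ 0) (N : ℕ)
    (g : Gen3 q (2*N+2) c1 c2 c3) (i b : ℕ) : RS q c1 c2 c3 N i b = RS q c2 c1 c3 N b i := by
  rw [RS, RS]
  apply Finset.sum_congr rfl
  intro a ha
  rw [Finset.mem_range] at ha
  have k1 : ∀ k, 1 ≤ k → k ≤ 2*N+2 → c1*q^k ≠ 1 := fun k a b => (g k a (by omega)).1
  have k2 : ∀ k, 1 ≤ k → k ≤ 2*N+2 → c2*q^k ≠ 1 := fun k a b => (g k a (by omega)).2.1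
  have p1 : poch q (q*c1) a ≠ 0 := poch_one_ne k1 (by omega)
  have p2 : poch q (q*c2) a ≠ 0 := poch_one_ne k2 (by omega)
  have e : ww q c2 c1 a*Wt q c1 c2 c3 N a = ww q c1 c2 a*Wt q c2 c1 c3 N a := by
    rw [ww, ww, Wt, Wt, kk_hh, kk_hh, mul_comm c2 c1]
    have hc : (q*c2)^a ≠ 0 := by simp [*]
    have hc1 : (q*c1)^a ≠ 0 := by simp [*]
    generalize (q*c1)^a = P1 at *
    generalize (q*c2)^a = P2 at *
    generalize poch q (q*c1) a = P3 at *
    generalize poch q (q*c2) a = P4 at *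
    field_simp
  rw [e]; ring
lemma RS_step {q c1 c2 c3 : ℂ} (hq : q ≠ 0) (h1 : c1 ≠ 0) (h2 : c2 ≠ 0) (h3 : c3 ≠ 0) (N i b : ℕ) (hi : i ≤ N) (hb : b ≤ N+1)
    (hq1 : ∀ k, 1 ≤ k → k ≤ N+1 → q^k ≠ 1) (g : Gen3 q (2*N+4) c1 c2 c3) :
    (1-q*c2)*((1-c1*c2*c3*q^(N+3))*(q^(N+1)-1)*(1-c1*c3*q^(2*b+1))*q^b)*RS q c1 c2 c3 (N+1) (i+1) b
     = (1-q*c3)*((q^b*(1-c1*c2*c3*q^(N+b+3))*(q^(N+1)-q^b)*(1-c1*c3*q^(b+1)))*RS q c1 (q*c2) (q*c3) N i b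
       + ((q^b-c2*q^(N+2))*(1-c1*c3*q^(N+b+2))*(q^b-1))*RS q c1 (q*c2) (q*c3) N i (b-1)) := by
  have k2 : ∀ k, 1 ≤ k → k ≤ 2*N+4 → c2*q^k ≠ 1 := fun k a b => (g k a (by omega)).2.1
  have o := O_full (c3 := c3) hq h1 h2 N i hi hq1 g (fun a => ww q c2 c1 a*rr q c2 c1 c3 (N+1) b a)
  have e : RS q c1 c2 c3 (N+1) (i+1) b = ∑ x ∈ Finset.range (N+2), Wt q c1 c2 c3 (N+1) x*rr q c1 c2 c3 (N+1) (i+1) x*(ww q c2 c1 x*rr q c2 c1 c3 (N+1) b x) := by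
    rw [RS]; apply Finset.sum_congr rfl; intro x _; ring
  rw [e, o, RS, RS]
  simp only [Finset.mul_sum]
  rw [← Finset.sum_add_distrib, Finset.mul_sum]
  apply Finset.sum_congr rfl
  intro a ha
  rw [Finset.mem_range] at ha
  have t := rr_BR hq h1 h2 h3 N a b (by omega) hb hq1 g
  have w := Wt_bt hq c1 c2 c3 N a
  have w1 := ww_up (c' := c1) hq a (fun k x y => k2 k x (by omega))
  have w2 := ww_succ (c' := c1) a (fun k x y => k2 k x (by omega))
  have a1 : q^a ≠ 0 := pow_ne_zero _ hq
  have a2 : 1-c2*q^(a+1) ≠ 0 := one_sub_ne k2 (by omega) (by omega)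
  generalize rr q (q*c2) c1 (q*c3) N (b-1) a = R1 at *
  generalize rr q (q*c2) c1 (q*c3) N b a = R2 at *
  generalize rr q c2 c1 c3 (N+1) b a = R3 at *
  generalize rr q c2 c1 c3 (N+1) b (a+1) = R4 at *
  generalize rr q c1 (q*c2) (q*c3) N i a = R5 at *
  generalize Wt q c1 (q*c2) (q*c3) N a = W1 at *
  generalize bt q c1 c2 c3 N a = B at *
  generalize ww q c2 c1 (a+1) = w1' at *
  generalize ww q c2 c1 a = w0 at *
  generalize ww q (q*c2) c1 a = wl at *
  apply mul_left_cancel₀ (mul_ne_zero a1 a2)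
  generalize hA0 : q^b*(1-c1*c2*c3*q^(N+b+3))*(q^(N+1)-q^b)*(1-c1*c3*q^(b+1)) = A0 at *
  generalize hA1 : (q^b-c2*q^(N+2))*(1-c1*c3*q^(N+b+2))*(q^b-1) = A1 at *
  generalize (1-c1*c2*c3*q^(N+3))*(q^(N+1)-1)*(1-c1*c3*q^(2*b+1))*q^b = M at *
  linear_combination (q^a*(1-q*c3)*(1-q*c2)*B*R5*w0)*t+(-q^a*(1-q*c3)*(1-q*c2)*B*R5*M*R4)*w2+(1-q*c3)*R5*(B*(1-c1*c2*q^(2*a+2))*(A0*R2+A1*R1))*w1-(1-q*c3)*R5*(1-c2*q^(a+1))*wl*(A0*R2+A1*R1)*w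
theorem R_rr {q : ℂ} (hq : q ≠ 0) (N : ℕ) : ∀ (c1 c2 c3 : ℂ) (_ : c1 ≠ 0) (_ : c2 ≠ 0) (_ : c3 ≠ 0)
    (_ : ∀ k, 1 ≤ k → k ≤ N → q^k ≠ 1) (_ : Gen3 q (2*N+2) c1 c2 c3) (i b : ℕ) (_ : i ≤ N) (_ : b ≤ N),
    ww q c3 c2 i*ww q c3 c1 b*RS q c1 c2 c3 N i b = kk q c3 N*rr q c1 c3 c2 N i b := by
  have base : ∀ (N : ℕ) (c1 c2 c3 : ℂ) (_ : c1 ≠ 0) (_ : c2 ≠ 0)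
    (_ : ∀ k, 1 ≤ k → k ≤ N → q^k ≠ 1) (_ : Gen3 q (2*N+2) c1 c2 c3), ww q c3 c2 0*ww q c3 c1 0*RS q c1 c2 c3 N 0 0 = kk q c3 N*rr q c1 c3 c2 N 0 0 := by
    intro N c1 c2 c3 h1 h2 hq1 g
    rw [rr_zero_left, ← R_zero hq h1 h2 N hq1 g, RS]
    simp only [rr_zero_left, ww_zero]; ring
  induction N with
  | zero =>
    intro c1 c2 c3 h1 h2 h3 hq1 g i b hn hm
    obtain rfl : i = 0 := by omega
    obtain rfl : b = 0 := by omega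
    exact base 0 c1 c2 c3 h1 h2 hq1 g
  | succ N ih =>
    have st : ∀ (c1 c2 c3 : ℂ) (_ : c1 ≠ 0) (_ : c2 ≠ 0) (_ : c3 ≠ 0)
     (_ : ∀ k, 1 ≤ k → k ≤ N+1 → q^k ≠ 1) (_ : Gen3 q (2*N+4) c1 c2 c3) (i b : ℕ) (_ : i ≤ N) (_ : b ≤ N+1),
      ww q c3 c2 (i+1)*ww q c3 c1 b*RS q c1 c2 c3 (N+1) (i+1) b = kk q c3 (N+1)*rr q c1 c3 c2 (N+1) (i+1) b := by
      intro c1 c2 c3 h1 h2 h3 hq1 g i b hi hb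
      have ih := ih c1 (q*c2) (q*c3) h1 (mul_ne_zero hq h2) (mul_ne_zero hq h3) (fun k a b => hq1 k a (by omega)) (Gen3_low g) i
      have k2 : ∀ k, 1 ≤ k → k ≤ 2*N+4 → c2*q^k ≠ 1 := fun k a b => (g k a (by omega)).2.1
      have k3 : ∀ k, 1 ≤ k → k ≤ 2*N+4 → c3*q^k ≠ 1 := fun k a b => (g k a (by omega)).2.2.1
      have k13 : ∀ k, 1 ≤ k → k ≤ 2*N+4 → c1*c3*q^k ≠ 1 := fun k a b => (g k a (by omega)).2.2.2.2.2.1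
      have k123 : ∀ k, 1 ≤ k → k ≤ 2*N+4 → c1*c2*c3*q^k ≠ 1 := fun k a b => (g k a (by omega)).2.2.2.2.2.2
      have k132 : ∀ k, 1 ≤ k → k ≤ 2*N+4 → c1*c3*c2*q^k ≠ 1 := fun k a b => by rw [mul_right_comm c1]; exact k123 k a b
      have s := RS_step hq h1 h2 h3 N i b hi hb hq1 g
      have a1 : 1-q*c2 ≠ 0 := by have := one_sub_ne k2 (k := 1) (by omega) (by omega); rwa [pow_one, mul_comm] at this
      have a2 : 1-q*c3 ≠ 0 := by have := one_sub_ne k3 (k := 1) (by omega) (by omega); rwa [pow_one, mul_comm] at this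
      have a4 : 1-c1*c2*c3*q^(N+3) ≠ 0 := one_sub_ne k123 (by omega) (by omega)
      have a5 : q^(N+1)-1 ≠ 0 := sub_ne_zero.2 (hq1 _ (by omega) le_rfl)
      have a6 : 1-c1*c3*q^(2*b+1) ≠ 0 := one_sub_ne k13 (by omega) (by omega)
      have a7 : q^b ≠ 0 := pow_ne_zero _ hq
      have w1 := ww_succ_lo2 (c' := c2) i (fun k x y => k3 k x (by omega))
      rw [kk_succ']
      rcases b with _ | b
      · have ih0 := ih 0 hi (by omega)
        rw [rr_zero_right hq] at ih0 ⊢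
        simp only [ww_zero, pow_zero, sub_self, mul_zero, zero_mul, zero_add, add_zero, one_mul, mul_one, pow_one] at *
        apply mul_left_cancel₀ (mul_ne_zero (mul_ne_zero (mul_ne_zero a1 a2) a6) (mul_ne_zero a4 a5))
        linear_combination (ww q c3 c2 (i+1)*(1-q*c3))*s +(-(-1+q*c3)*((1-c1*c2*c3*q^(N+3))*(q^(N+1)-1)*(1-c1*c3*q)))*(RS q c1 (q*c2) (q*c3) N i 0*w1-c3*q*(1-q*c2)*ih0)
      · rw [Nat.add_sub_cancel] at s
        have ih0 := ih b hi (by omega)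
        have wa := ww_succ_lo (c' := c1) b (fun k x y => k3 k x (by omega))
        have bs := rr_BS (c1 := c1) (c2 := c3) (c3 := c2) hq h3 h1 N i b hi hq1 (fun k x y => k3 k x (by omega)) (fun k x y => k132 k x (by omega))
        apply mul_left_cancel₀ (mul_ne_zero (mul_ne_zero (mul_ne_zero a1 (pow_ne_zero 2 a2)) a7) (mul_ne_zero a6 (mul_ne_zero a4 a5)))
        have k : (q^(N+1)-q^(b+1))*(ww q (q*c3) (q*c2) i*(ww q c3 c1 (b+1)*(q^(b+1)*(1-q*c3)))*RS q c1 (q*c2) (q*c3) N i (b+1))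
           = (q^(N+1)-q^(b+1))*((1-c3*q^(b+2))*(kk q (q*c3) N*rr q c1 (q*c3) (q*c2) N i (b+1))) := by
          rcases Nat.lt_or_ge b N with hbN | hbN
          · have ih1 := ih (b+1) hi (by omega)
            have wb := ww_up (c' := c1) hq (b+1) (fun k x y => k3 k x (by omega))
            rw [wb]
            linear_combination (q^(N+1)-q^(b+1))*(1-c3*q^(b+2))*ih1
          · obtain rfl : b = N := by omega
            rw [sub_self, zero_mul, zero_mul]
        generalize RS q c1 (q*c2) (q*c3) N i (b+1) = S1 at *
        generalize RS q c1 (q*c2) (q*c3) N i b = S0 at *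
        generalize RS q c1 c2 c3 (N+1) (i+1) (b+1) = S2 at *
        generalize rr q c1 (q*c3) (q*c2) N i (b+1) = R1 at *
        generalize rr q c1 (q*c3) (q*c2) N i b = R0 at *
        generalize rr q c1 c3 c2 (N+1) (i+1) (b+1) = R2 at *
        generalize ww q c3 c2 (i+1) = wi at *
        generalize ww q (q*c3) (q*c2) i = wi0 at *
        generalize ww q c3 c1 (b+1) = wb1 at *
        generalize ww q (q*c3) c1 b = wb0 at *
        generalize kk q (q*c3) N = KN at *
        have n1 : q^(2*(b+1)+1) = q^(b+1)*q^(b+1)*q := by ring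
        have n2 : q^(N+(b+1)+3) = q^(N+1)*q^(b+1)*q^2 := by ring
        have n3 : q^(N+(b+1)+2) = q^(N+1)*q^(b+1)*q := by ring
        have n4 : q^(b+1+1) = q^(b+1)*q := by ring
        have n5 : q^(b+2) = q^(b+1)*q := by ring
        have n6 : q^(N+2) = q^(N+1)*q := by ring
        have n7 : q^(N+3) = q^(N+1)*q^2 := by ring
        have n8 : q^(N+b+4) = q^(N+1)*q^(b+1)*q^2 := by ring
        have n9 : q^(N+b+3) = q^(N+1)*q^(b+1)*q := by ring
        have n10 : q^(2*b+3) = q^(b+1)*q^(b+1)*q := by ring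
        simp only [n1,n2,n3,n4,n5,n6,n7,n8,n9,n10] at *
        clear n1 n2 n3 n4 n5 n6 n7 n8 n9 n10
        generalize q^(b+1) = B at *
        generalize q^(N+1) = Y at *
        linear_combination (wi*wb1*(1-q*c3)^2)*s+(1-q*c3)^2*wb1*(B*(1-c1*c2*c3*(Y*B*q^2))*(Y-B)*(1-c1*c3*(B*q))*S1+(B-c2*(Y*q))*(1-c1*c3*(Y*B*q))*(B-1)*S0)*w1-c3*q*(1-q*c2)*(1-q*c3)*((1-c1*c2*c3*(Y*B*q^2))*(1-c1*c3*(B*q))*k+(B-c2*(Y*q))*(1-c1*c3*(Y*B*q))*(B-1)*(wi0*S0*wa + -c3*q*(1-c1*B)*ih0)+KN*bs)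
    intro c1 c2 c3 h1 h2 h3 hq1 g i b hi hb
    rcases i with _ | i
    · rcases b with _ | b
      · exact base (N+1) c1 c2 c3 h1 h2 hq1 g
      · rw [RS_refl hq h1 h2 _ g, rr_dual hq, ← st c2 c1 c3 h2 h1 h3 hq1 (Gen3_swap12 g) b 0 (by omega) (by omega)]; ring
    · exact st c1 c2 c3 h1 h2 h3 hq1 g i b (by omega) hb
end qR
namespace qR
lemma rrI_G {q c1 c2 c3 : ℂ} (hq : q ≠ 0) (M n x : ℕ) (hn : n ≤ M)
    (hq1 : ∀ k, 1 ≤ k → k ≤ M+1 → q^k ≠ 1) :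
    (c1*c2*q*(q^x*q^x)-1)*(q^(M+1)-1)*rr q c1 c2 c3 (M+1) n x
     = (q^x-q^(M+1))*(1-c1*c2*q*q^x)*rr q (q*c1) c2 c3 M n x
       + (c1*c2*q*q^x*q^(M+1)-1)*(q^x-1)*rr q (q*c1) c2 c3 M n (x-1) := by
  rcases x with _ | x
  · simp only [rr_zero_right hq, pow_zero]; ring
  rw [Nat.add_sub_cancel]
  have pX : q^(x+1) ≠ 0 := pow_ne_zero _ hq
  have pM : q^(M+1) ≠ 0 := pow_ne_zero _ hq
  have r := aff_rel q (q^n)⁻¹ (c2*c3*q^(n+1)) (q^(x+1))⁻¹ (c1*c2*q^(x+1+1)) (q*c2) (c1*c2*c3*q^(M+1+2)) ((q^(M+1))⁻¹*q)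
    (q^(x+1))⁻¹ (c1*c2*q^(x+1+1)) (q^(M+1))⁻¹ (n+1)
  rw [aff_C, aff_D, aff_G _ _ _ _ _ _ _ _ _
    (fun k hk => by rw [i1 hq]; exact poch_G_ne hq hq1 (by omega) (by omega))
    (fun k hk => poch_G_ne hq hq1 (by omega) (by omega)), ← rr] at r
  have e1 : S4 q (q^n)⁻¹ (c2*c3*q^(n+1)) ((q^(x+1))⁻¹*q) (c1*c2*q^(x+1+1)) (q*c2) (c1*c2*c3*q^(M+1+2)) ((q^(M+1))⁻¹*q) (n+1)
    = rr q (q*c1) c2 c3 M n x := by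
    rw [rr, i1 hq, i1 hq]; congr 1 <;> ring
  have e2 : S4 q (q^n)⁻¹ (c2*c3*q^(n+1)) (q^(x+1))⁻¹ (c1*c2*q^(x+1+1)*q) (q*c2) (c1*c2*c3*q^(M+1+2)) ((q^(M+1))⁻¹*q) (n+1)
    = rr q (q*c1) c2 c3 M n (x+1) := by
    rw [rr, i1 hq]; congr 1 <;> ring
  rw [e1, e2, pow_succ q (x+1)] at r
  clear e1 e2
  generalize rr q (q*c1) c2 c3 M n (x+1) = R1 at *
  generalize rr q (q*c1) c2 c3 M n x = R2 at *
  generalize rr q c1 c2 c3 (M+1) n (x+1) = R3 at *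
  generalize q^(x+1) = X at *
  generalize q^(M+1) = Y at *
  field_simp at r
  linear_combination -r
lemma rrI_F {q c1 c2 c3 : ℂ} (hq : q ≠ 0) (M n x L : ℕ) (hn : n ≤ M) (hL : 2*M+3 ≤ L)
    (h123 : ∀ k, 1 ≤ k → k ≤ L → c1*c2*c3*q^k ≠ 1) :
    (c1*c2*q*(q^x*q^x)-1)*(1-c1*c2*c3*q^(M+2))*rr q c1 c2 c3 M n x
     = (c1*c2*c3*q^(M+2)*q^x-1)*(1-c1*c2*q*q^x)*rr q (q*c1) c2 c3 M n x
       + (c1*c2*q*q^x-c1*c2*c3*q^(M+2))*(q^x-1)*rr q (q*c1) c2 c3 M n (x-1) := by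
  rcases x with _ | x
  · simp only [rr_zero_right hq, pow_zero]; ring
  rw [Nat.add_sub_cancel]
  have pX : q^(x+1) ≠ 0 := pow_ne_zero _ hq
  have r := aff_rel q (q^n)⁻¹ (c2*c3*q^(n+1)) (q^(x+1))⁻¹ (c1*c2*q^(x+1+1)) (q*c2) (c1*c2*c3*q^(M+2)*q) (q^M)⁻¹
    (q^(x+1))⁻¹ (c1*c2*q^(x+1+1)) (c1*c2*c3*q^(M+2)) (n+1)
  rw [aff_C, aff_D, aff_F _ _ _ _ _ _ _ _ _
    (fun k hk => by rw [mul_assoc, ← pow_succ]; exact poch_pow_ne h123 (by omega) (by omega))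
    (fun k hk => poch_pow_ne h123 (by omega) (by omega)), ← rr] at r
  have e1 : S4 q (q^n)⁻¹ (c2*c3*q^(n+1)) ((q^(x+1))⁻¹*q) (c1*c2*q^(x+1+1)) (q*c2) (c1*c2*c3*q^(M+2)*q) (q^M)⁻¹ (n+1)
    = rr q (q*c1) c2 c3 M n x := by
    rw [rr, i1 hq]; congr 1 <;> ring
  have e2 : S4 q (q^n)⁻¹ (c2*c3*q^(n+1)) (q^(x+1))⁻¹ (c1*c2*q^(x+1+1)*q) (q*c2) (c1*c2*c3*q^(M+2)*q) (q^M)⁻¹ (n+1)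
    = rr q (q*c1) c2 c3 M n (x+1) := by
    rw [rr]; congr 1 <;> ring
  rw [e1, e2, pow_succ q (x+1)] at r
  clear e1 e2
  generalize rr q (q*c1) c2 c3 M n (x+1) = R1 at *
  generalize rr q (q*c1) c2 c3 M n x = R2 at *
  generalize rr q c1 c2 c3 M n (x+1) = R3 at *
  generalize q^(x+1) = X at *
  generalize q^(M+2) = Y at *
  field_simp at r
  linear_combination -r
/-- backward shift valid for all `x`. -/
lemma rr_BS' {q c1 c2 c3 : ℂ} (hq : q ≠ 0) (hc2 : c2 ≠ 0) (hc1 : c1 ≠ 0) (N n x : ℕ) (hn : n ≤ N)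
    (hq1 : ∀ k, 1 ≤ k → k ≤ N+1 → q^k ≠ 1) (h2 : ∀ k, 1 ≤ k → k ≤ N+1 → c2*q^k ≠ 1)
    (h123 : ∀ k, 1 ≤ k → k ≤ 2*N+3 → c1*c2*c3*q^k ≠ 1) :
    (1-c2*q*q^x)*(1-c1*c2*c3*q^2*q^(N+1)*q^x)*(q^(N+1)-q^x)*(1-c1*c2*q*q^x)*rr q c1 (q*c2) (q*c3) N n x
    - c2*q*(c1*q^x-1)*(q^x-c3*q*q^(N+1))*(c1*c2*q*q^(N+1)*q^x-1)*(q^x-1)*rr q c1 (q*c2) (q*c3) N n (x-1)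
    = q^x*(1-c1*c2*q*(q^x*q^x))*((1-q*c2)*(1-c1*c2*c3*q^2*q^(N+1))*(q^(N+1)-1)* rr q c1 c2 c3 (N+1) (n+1) x) := by
  rcases x with _ | x
  · simp only [rr_zero_right hq, pow_zero]; ring
  rw [Nat.add_sub_cancel]
  have b := rr_BS hq hc2 hc1 N n x hn hq1 h2 h123
  rw [show q^(x+2) = q*q^(x+1) by ring, show q^(N+x+4) = q^2*q^(N+1)*q^(x+1) by ring,
   show q^(N+x+3) = q*q^(N+1)*q^(x+1) by ring, show q^(2*x+3)=q*(q^(x+1)*q^(x+1)) by ring,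
   show q^(N+3) = q^2*q^(N+1) by ring, show q^(N+2) = q*q^(N+1) by ring] at b
  linear_combination b
def JJ (q u : ℂ) (m y : ℕ) : ℂ := if y ≤ m then poch q u (m-y) / poch q q (m-y) else 0
def vv (q d c1 : ℂ) (N m y : ℕ) : ℂ :=
  poch q q (N-y)*poch q (d*q^(y+m+2)) (N-m)*JJ q (q*c1) m y*poch q (d*c1*q^(m+2)) y
lemma JJ_zero {q u : ℂ} {m y : ℕ} (h : m < y) : JJ q u m y = 0 := by
  rw [JJ, if_neg (by omega)]
lemma vv_zero {q d c1 : ℂ} {N m y : ℕ} (h : m < y) : vv q d c1 N m y = 0 := by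
  rw [vv, JJ_zero h]; ring
lemma TX {q d c1 k0 : ℂ} (N x y : ℕ) (hq1 : ∀ k, 1 ≤ k → k ≤ N+1 → q^k ≠ 1) (hx : x ≤ N)
    (hcon : d*k0*q^(2*N+5) = 1) :
    vv q d c1 (N+1) (N+1-x) y*((q^(N+1)-q^x*q^y)*(q^y-k0*q^2*q^x*q^(N+1)))
     = (q^x*q^x)*(q^(N+1)-q^y)*(q^y-k0*q^2*q^(N+1))*(1-q*c1)*vv q d (q*c1) N (N-x) y := by
  rcases Nat.lt_or_ge (N-x) y with h | h
  · rw [vv_zero h]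
    rcases Nat.lt_or_ge (N+1-x) y with h' | h'
    · rw [vv_zero h']; ring
    · have : q^(N+1) = q^x*q^y := by rw [← pow_add]; congr 1; omega
      rw [this]; ring
  obtain ⟨m, rfl⟩ := Nat.exists_eq_add_of_le hx
  rw [Nat.add_sub_cancel_left] at h ⊢
  obtain ⟨z, rfl⟩ := Nat.exists_eq_add_of_le h
  have u : vv q d c1 (x+(y+z)+1) (x+(y+z)+1-x) y*((1-d*q^(y+(y+z)+2))*(1-q*q^z))
     = (1-q*q^(x+z))*(1-d*q^(y+(y+z)+2)*q^x)*(1-q*c1)*vv q d (q*c1) (x+(y+z)) (y+z) y := by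
    rw [vv, vv, JJ, JJ, if_pos (by omega), if_pos (by omega)]
    rw [show x+(y+z)+1-y = x+z+1 by omega, show x+(y+z)+1-(x+(y+z)+1-x) = x by omega,
      show x+(y+z)+1-x = y+z+1 by omega, show y+z+1-y=z+1 by omega, show x+(y+z)-y=x+z by omega,
      show x+(y+z)-(y+z)=x by omega, show y+z-y=z by omega, poch_succ q q, poch_succ' q (q*c1),
      poch_succ q q]
    have s1 := poch_shift q (d*q^(y+(y+z)+2)) x
    rw [show q*c1*q = q*(q*c1) by ring, show d*q^(y+(y+z+1)+2) = d*q^(y+(y+z)+2)*q by ring,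
      show d*c1*q^(y+z+1+2) = d*(q*c1)*q^(y+z+2) by ring]
    have h1 : poch q q z ≠ 0 := poch_q_ne hq1 (by omega)
    have h2 : 1-q*q^z ≠ 0 := by rw [← pow_succ']; exact one_sub_q_ne hq1 (by omega) (by omega)
    generalize poch q q z = p1 at *
    generalize poch q (d*q^(y+(y+z)+2)*q) x = p2 at *
    generalize poch q (d*q^(y+(y+z)+2)) x = p3 at *
    generalize poch q (q*(q*c1)) z = p4 at *
    generalize poch q (d*(q*c1)*q^(y+z+2)) y = p5 at *
    generalize d*q^(y+(y+z)+2) = w at *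
    generalize 1-q*q^z = w2 at *
    field_simp
    linear_combination ((1-q*q^(x+z))*(1-q*c1)*p4*poch q q (x+z)*p5)*s1
  rw [show q^(x+(y+z)+1) = q^x*q^y*(q*q^z) by ring]
  rw [show q^(x+z) = q^x*q^z by ring, show q^(y+(y+z)+2) = q^y*q^y*q*(q*q^z) by ring] at u
  rw [show q^(2*(x+(y+z))+5) = q^3*(q^x)^2*(q^y)^2*(q*q^z)^2 by ring] at hcon
  generalize vv q d c1 (x+(y+z)+1) (x+(y+z)+1-x) y = U at *
  generalize vv q d (q*c1) (x+(y+z)) (y+z) y = L at *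
  generalize hZ : q*q^z = Z at *
  rw [show q*(q^x*q^z) = q^x*Z by rw [← hZ]; ring] at u
  generalize q^x = X at *
  generalize q^y = Y at *
  linear_combination X*Y^2*(k0*q^2*X^2*Z)*u-(X*Y^2*(Z-1)*U-X^2*Y^2*(X*Z-1)*(1-q*c1)*L)*hcon
lemma TY {q d c1 k0 : ℂ} (N x y : ℕ) (hq1 : ∀ k, 1 ≤ k → k ≤ N+1 → q^k ≠ 1) (hx : x ≤ N)
    (hcon : d*(c1*k0)*q^(2*N+5) = 1) :
    vv q d c1 (N+1) (N+1-(x+1)) y*((q^(x+1)*q^y-c1*q*q^(N+1))*(k0*q*q^(x+1)*q^(N+1)-q^y)*(c1*q))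
     = q^(x+1)*(q^(N+1)-q^y)*(q^y-c1*k0*q^2*q^(N+1))*(1-q*c1)*(q^(x+1)-d*c1*q^2*q^(N+1))*vv q d (q*c1) N (N-x) y := by
  rw [Nat.succ_sub_succ]
  rcases Nat.lt_or_ge (N-x) y with h | h
  · rw [vv_zero h, vv_zero h]; ring
  obtain ⟨m, rfl⟩ := Nat.exists_eq_add_of_le hx
  rw [Nat.add_sub_cancel_left] at h ⊢
  obtain ⟨z, rfl⟩ := Nat.exists_eq_add_of_le h
  have u : vv q d c1 (x+(y+z)+1) (y+z) y*((1-q*c1*q^z)*(1-d*c1*q^(y+z+2)*q^y))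
     = (1-q*q^(x+z))*(1-d*q^(y+(y+z)+2)*q^x)*(1-q*c1)*(1-d*c1*q^(y+z+2))*vv q d (q*c1) (x+(y+z)) (y+z) y := by
    rw [vv, vv, JJ, JJ, if_pos (by omega), if_pos (by omega)]
    rw [show x+(y+z)+1-y = x+z+1 by omega, show x+(y+z)+1-(y+z) = x+1 by omega,
      show x+(y+z)-y=x+z by omega,
      show x+(y+z)-(y+z)=x by omega, show y+z-y=z by omega, poch_succ q q, poch_succ]
    have s1 := poch_shift q (d*c1*q^(y+z+2)) y
    have s2 := poch_shift q (q*c1) z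
    rw [show q*c1*q = q*(q*c1) by ring] at s2
    rw [show d*(q*c1)*q^(y+z+2) = d*c1*q^(y+z+2)*q by ring]
    have h1 : poch q q z ≠ 0 := poch_q_ne hq1 (by omega)
    generalize poch q q z = p1 at *
    generalize poch q (d*c1*q^(y+z+2)*q) y = p2 at *
    generalize poch q (d*c1*q^(y+z+2)) y = p3 at *
    generalize poch q (q*(q*c1)) z = p4 at *
    generalize poch q (q*c1) z = p5 at *
    generalize d*q^(y+(y+z)+2) = w at *
    generalize d*c1*q^(y+z+2) = w2 at *
    field_simp
    linear_combination -(poch q q (x+z)*(1-q*q^(x+z))*poch q w x*(1-w*q^x)*p3*(1-w2*q^y))*s2-(poch q q (x+z)*(1-q*q^(x+z))*poch q w x*(1-w*q^x)*(1-q*c1)*p4)*s1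
  rw [show q^(x+(y+z)+1) = q^(x+1)*q^y*q^z by ring]
  rw [show q*q^(x+z) = q^(x+1)*q^z by ring, show d*q^(y+(y+z)+2)*q^x = d*q*(q^y*q^y*q^z)*q^(x+1) by ring,
    show q^(y+z+2) = q^2*q^y*q^z by ring] at u
  rw [show q^(2*(x+(y+z))+5) = q^3*(q^(x+1))^2*(q^y)^2*(q^z)^2 by ring] at hcon
  generalize vv q d c1 (x+(y+z)+1) (y+z) y = U at *
  generalize vv q d (q*c1) (x+(y+z)) (y+z) y = L at *
  generalize q^(x+1) = X at *
  generalize q^y = Y at *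
  generalize q^z = Z at *
  linear_combination X*Y^2*c1*q*(k0*q*X^2*Z)*u+(X*Y^2*(1-c1*q*Z)*c1*q*U-X^2*Y^2*(1-X*Z)*(1-q*c1)*(1-d*c1*q^2*Y*Z)*L)*hcon
end qR
namespace qR
def Psi (q c0 c1 c2 c3 c4 : ℂ) (N a x b y : ℕ) : ℂ :=
  vv q (c0*c3) c1 N (N-x) y*rr q c4 c2 c1 (N-y) a x*rr q c1 c3 c0 (N-x) y b
def Gen5 (q : ℂ) (M : ℕ) (c0 c1 c2 c3 c4 : ℂ) : Prop :=
  ∀ e0 e1 e2 e3 e4 k : ℕ, e0 ≤ 1 → e1 ≤ 1 → e2 ≤ 1 → e3 ≤ 1 → e4 ≤ 1 →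
    1 ≤ e0+e1+e2+e3+e4 → e0+e1+e2+e3+e4 ≤ 4 → 1 ≤ k → k ≤ M →
    c0^e0*c1^e1*c2^e2*c3^e3*c4^e4*q^k ≠ 1
structure Hyp (q : ℂ) (N : ℕ) (c0 c1 c2 c3 c4 : ℂ) : Prop where
  hq : q ≠ 0
  h0 : c0 ≠ 0
  h1 : c1 ≠ 0
  h2 : c2 ≠ 0
  h3 : c3 ≠ 0
  h4 : c4 ≠ 0
  con : c0*c1*c2*c3*c4*q^(2*N+3) = 1
  q1 : ∀ k, 1 ≤ k → k ≤ N → q^k ≠ 1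
  g : Gen5 q (2*N+5) c0 c1 c2 c3 c4
lemma Hyp.swap {q : ℂ} {N : ℕ} {c0 c1 c2 c3 c4 : ℂ} (h : Hyp q N c0 c1 c2 c3 c4) : Hyp q N c0 c2 c1 c4 c3 where
  hq := h.hq
  h0 := h.h0
  h1 := h.h2
  h2 := h.h1
  h3 := h.h4
  h4 := h.h3
  con := by rw [← h.con]; ring
  q1 := h.q1
  g := by
    intro e0 e1 e2 e3 e4 k i0 i1 i2 i3 i4 j1 j2 k1 k2
    have := h.g e0 e2 e1 e4 e3 k i0 i2 i1 i4 i3 (by omega) (by omega) k1 k2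
    intro hh; apply this; rw [← hh]; ring
lemma Hyp.refl {q : ℂ} {N : ℕ} {c0 c1 c2 c3 c4 : ℂ} (h : Hyp q N c0 c1 c2 c3 c4) : Hyp q N c3 c4 c2 c0 c1 where
  hq := h.hq
  h0 := h.h3
  h1 := h.h4
  h2 := h.h2
  h3 := h.h0
  h4 := h.h1
  con := by rw [← h.con]; ring
  q1 := h.q1
  g := by
    intro e0 e1 e2 e3 e4 k i0 i1 i2 i3 i4 j1 j2 k1 k2
    have := h.g e3 e4 e2 e0 e1 k i3 i4 i2 i0 i1 (by omega) (by omega) k1 k2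
    intro hh; apply this; rw [← hh]; ring
lemma Hyp.low12 {q : ℂ} {N : ℕ} {c0 c1 c2 c3 c4 : ℂ} (h : Hyp q (N+1) c0 c1 c2 c3 c4) : Hyp q N c0 (q*c1) (q*c2) c3 c4 where
  hq := h.hq
  h0 := h.h0
  h1 := mul_ne_zero h.hq h.h1
  h2 := mul_ne_zero h.hq h.h2
  h3 := h.h3
  h4 := h.h4
  con := by rw [← h.con]; ring
  q1 := fun k a b => h.q1 k a (by omega)
  g := by
    intro e0 e1 e2 e3 e4 k i0 i1 i2 i3 i4 j1 j2 k1 k2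
    have := h.g e0 e1 e2 e3 e4 (k+e1+e2) i0 i1 i2 i3 i4 (by omega) (by omega) (by omega) (by omega)
    intro hh; apply this; rw [← hh, mul_pow, mul_pow, pow_add, pow_add]; ring
lemma Hyp.low04 {q : ℂ} {N : ℕ} {c0 c1 c2 c3 c4 : ℂ} (h : Hyp q (N+1) c0 c1 c2 c3 c4) : Hyp q N (q*c0) c1 c2 c3 (q*c4) where
  hq := h.hq
  h0 := mul_ne_zero h.hq h.h0
  h1 := h.h1
  h2 := h.h2
  h3 := h.h3
  h4 := mul_ne_zero h.hq h.h4
  con := by rw [← h.con]; ring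
  q1 := fun k a b => h.q1 k a (by omega)
  g := by
    intro e0 e1 e2 e3 e4 k i0 i1 i2 i3 i4 j1 j2 k1 k2
    have := h.g e0 e1 e2 e3 e4 (k+e0+e4) i0 i1 i2 i3 i4 (by omega) (by omega) (by omega) (by omega)
    intro hh; apply this; rw [← hh, mul_pow, mul_pow, pow_add, pow_add]; ring
lemma Hyp.u {q : ℂ} {N : ℕ} {c0 c1 c2 c3 c4 : ℂ} (h : Hyp q N c0 c1 c2 c3 c4) (e0 e1 e2 e3 e4 k : ℕ) (e : (e0 ≤ 1 ∧ e1 ≤ 1 ∧ e2 ≤ 1 ∧ e3 ≤ 1 ∧ e4 ≤ 1) ∧ 1 ≤ e0+e1+e2+e3+e4 ∧ e0+e1+e2+e3+e4 ≤ 4) (a : 1 ≤ k) (b : k ≤ 2*N+5) : c0^e0*c1^e1*c2^e2*c3^e3*c4^e4*q^k ≠ 1 :=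
  h.g e0 e1 e2 e3 e4 k e.1.1 e.1.2.1 e.1.2.2.1 e.1.2.2.2.1 e.1.2.2.2.2 e.2.1 e.2.2 a b
lemma Hyp.n0 {q : ℂ} {N : ℕ} {c0 c1 c2 c3 c4 : ℂ} (h : Hyp q N c0 c1 c2 c3 c4) : ∀ k, 1 ≤ k → k ≤ 2*N+5 → c0*q^k ≠ 1 := fun k a b => by simpa using h.u 1 0 0 0 0 k (by omega) a b
lemma Hyp.n1 {q : ℂ} {N : ℕ} {c0 c1 c2 c3 c4 : ℂ} (h : Hyp q N c0 c1 c2 c3 c4) : ∀ k, 1 ≤ k → k ≤ 2*N+5 → c1*q^k ≠ 1 := fun k a b => by simpa using h.u 0 1 0 0 0 k (by omega) a b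
lemma Hyp.n2 {q : ℂ} {N : ℕ} {c0 c1 c2 c3 c4 : ℂ} (h : Hyp q N c0 c1 c2 c3 c4) : ∀ k, 1 ≤ k → k ≤ 2*N+5 → c2*q^k ≠ 1 := fun k a b => by simpa using h.u 0 0 1 0 0 k (by omega) a b
lemma Hyp.n3 {q : ℂ} {N : ℕ} {c0 c1 c2 c3 c4 : ℂ} (h : Hyp q N c0 c1 c2 c3 c4) : ∀ k, 1 ≤ k → k ≤ 2*N+5 → c3*q^k ≠ 1 := fun k a b => by simpa using h.u 0 0 0 1 0 k (by omega) a b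
lemma Hyp.n4 {q : ℂ} {N : ℕ} {c0 c1 c2 c3 c4 : ℂ} (h : Hyp q N c0 c1 c2 c3 c4) : ∀ k, 1 ≤ k → k ≤ 2*N+5 → c4*q^k ≠ 1 := fun k a b => by simpa using h.u 0 0 0 0 1 k (by omega) a b
lemma Hyp.n24 {q : ℂ} {N : ℕ} {c0 c1 c2 c3 c4 : ℂ} (h : Hyp q N c0 c1 c2 c3 c4) : ∀ k, 1 ≤ k → k ≤ 2*N+5 → c2*c4*q^k ≠ 1 := fun k a b => by simpa using h.u 0 0 1 0 1 k (by omega) a b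
lemma Hyp.n13 {q : ℂ} {N : ℕ} {c0 c1 c2 c3 c4 : ℂ} (h : Hyp q N c0 c1 c2 c3 c4) : ∀ k, 1 ≤ k → k ≤ 2*N+5 → c1*c3*q^k ≠ 1 := fun k a b => by simpa using h.u 0 1 0 1 0 k (by omega) a b
lemma Hyp.n03 {q : ℂ} {N : ℕ} {c0 c1 c2 c3 c4 : ℂ} (h : Hyp q N c0 c1 c2 c3 c4) : ∀ k, 1 ≤ k → k ≤ 2*N+5 → c0*c3*q^k ≠ 1 := fun k a b => by simpa using h.u 1 0 0 1 0 k (by omega) a b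
lemma Hyp.n124 {q : ℂ} {N : ℕ} {c0 c1 c2 c3 c4 : ℂ} (h : Hyp q N c0 c1 c2 c3 c4) : ∀ k, 1 ≤ k → k ≤ 2*N+5 → c1*c2*c4*q^k ≠ 1 := fun k a b => by simpa using h.u 0 1 1 0 1 k (by omega) a b
lemma Hyp.n013 {q : ℂ} {N : ℕ} {c0 c1 c2 c3 c4 : ℂ} (h : Hyp q N c0 c1 c2 c3 c4) : ∀ k, 1 ≤ k → k ≤ 2*N+5 → c0*c1*c3*q^k ≠ 1 := fun k a b => by simpa using h.u 1 1 0 1 0 k (by omega) a b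
def eg1 (q c1 c2 c3 c4 n X B : ℂ) : ℂ :=
  (1-q*c1)*(1-c2*q*X)*(1-c2*c4*q*X)*X/((1-c2*c4*q*(X*X))*(1-q*c2)*((c1*c3*q*(B*B)-1)*(n-X)))
def eg2 (q c1 c2 c3 c4 X B : ℂ) : ℂ :=
  -((1-q*c1)*c2*(c4*X-1)*(X-1)/(c1*(1-c2*c4*q*(X*X))*(1-q*c2)*(c1*c3*q*(B*B)-1)))
def ee1 (q c1 c2 c3 c4 n X B : ℂ) : ℂ := eg1 q c1 c2 c3 c4 n X B*((X*B-n)*(1-c1*c3*q*B))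
def ee2 (q c1 c2 c3 c4 n X B : ℂ) : ℂ := eg1 q c1 c2 c3 c4 n X B*((c1*c3*q*B*n-X)*(B-1))
def ee3 (q c0 c1 c2 c3 c4 n X B : ℂ) : ℂ := eg2 q c1 c2 c3 c4 X B*((c0*c1*c3*q^2*n*B-X)*(1-c1*c3*q*B))
def ee4 (q c0 c1 c2 c3 c4 n X B : ℂ) : ℂ := eg2 q c1 c2 c3 c4 X B*(c1*c3*q*(B*X-c0*q*n)*(B-1))
lemma Psi_expand {q c0 c1 c2 c3 c4 : ℂ} {N : ℕ} (h : Hyp q (N+1) c0 c1 c2 c3 c4) (a x b y : ℕ)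
    (hay : a+y ≤ N) (hx : x ≤ N+1) (hb : b ≤ N+1) :
    Psi q c0 c1 c2 c3 c4 (N+1) (a+1) x b y
     = ee1 q c1 c2 c3 c4 (q^(N+1)) (q^x) (q^b)*Psi q c0 (q*c1) (q*c2) c3 c4 N a x b y
     + ee2 q c1 c2 c3 c4 (q^(N+1)) (q^x) (q^b)*Psi q c0 (q*c1) (q*c2) c3 c4 N a x (b-1) y
     + ee3 q c0 c1 c2 c3 c4 (q^(N+1)) (q^x) (q^b)*Psi q c0 (q*c1) (q*c2) c3 c4 N a (x-1) b y
     + ee4 q c0 c1 c2 c3 c4 (q^(N+1)) (q^x) (q^b)*Psi q c0 (q*c1) (q*c2) c3 c4 N a (x-1) (b-1) y := by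
  have hq := h.hq
  have h1 := h.h1
  obtain ⟨w, rfl⟩ : ∃ w, N = y+w := ⟨N-y, by omega⟩
  have hcon : c0*c3*(c1*(c2*c4))*q^(2*(y+w)+5) = 1 := by rw [← h.con]; ring
  have bs := rr_BS' (c1 := c4) (c2 := c2) (c3 := c1) hq h.h2 h.h4 w a x (by omega)
    (fun k i j => h.q1 k i (by omega)) (fun k i j => h.n2 k i (by omega))
    (fun k i j => by rw [show c4*c2*c1 = c1*c2*c4 by ring]; exact h.n124 k i (by omega))
  have pX : q^x ≠ 0 := pow_ne_zero _ hq
  have pY : q^y ≠ 0 := pow_ne_zero _ hq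
  have pn : q^(y+w+1) = q^y*q^(w+1) := by ring
  have d1 : 1-c2*c4*q*(q^x*q^x) ≠ 0 := by
    have := one_sub_ne h.n24 (k := 2*x+1) (by omega) (by omega)
    rwa [show c2*c4*q^(2*x+1) = c2*c4*q*(q^x*q^x) by ring] at this
  have d2 : 1-q*c2 ≠ 0 := by
    have := one_sub_ne h.n2 (k := 1) (by omega) (by omega)
    rwa [pow_one, mul_comm] at this
  have d3 : c1*c3*q*(q^b*q^b)-1 ≠ 0 := by
    have := one_sub_ne h.n13 (k := 2*b+1) (by omega) (by omega)
    rw [show c1*c3*q^(2*b+1) = c1*c3*q*(q^b*q^b) by ring] at this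
    intro h'; apply this; linear_combination -h'
  have d4 : 1-c4*c2*c1*q^2*q^(w+1) ≠ 0 := by
    have := one_sub_ne h.n124 (k := w+3) (by omega) (by omega)
    rwa [show c1*c2*c4*q^(w+3) = c4*c2*c1*q^2*q^(w+1) by ring] at this
  have d5 : q^(w+1)-1 ≠ 0 := by
    have := one_sub_q_ne h.q1 (k := w+1) (by omega) (by omega)
    intro h'; apply this; linear_combination -h'
  -- first part
  have E1 : vv q (c0*c3) c1 (y+w+1) (y+w+1-x) y*rr q c1 c3 c0 (y+w+1-x) y b*((1-c4*c2*c1*q^2*q^(w+1)*q^x)*(q^(w+1)-q^x))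
      = q^x*q^x*(1-c4*c2*c1*q^2*q^(w+1))*(q^(w+1)-1)*(1-q*c1)*vv q (c0*c3) (q*c1) (y+w) (y+w-x) y *
        (((q^x*q^b-q^(y+w+1))*(1-c1*c3*q*q^b)*rr q (q*c1) c3 c0 (y+w-x) y b
        + (c1*c3*q*q^b*q^(y+w+1)-q^x)*(q^b-1)*rr q (q*c1) c3 c0 (y+w-x) y (b-1))/((c1*c3*q*(q^b*q^b)-1)*(q^(y+w+1)-q^x))) := by
    rcases Nat.lt_or_ge (y+w) x with hx' | hx'
    · obtain rfl : x = y+w+1 := by omega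
      rw [sub_self (q^(y+w+1)), mul_zero, div_zero, mul_zero]
      rcases Nat.eq_zero_or_pos y with rfl | hy
      · rw [zero_add]; ring
      · rw [vv_zero (by omega)]; ring
    · have t := TX (c1 := c1) (k0 := c1*(c2*c4)) (y+w) x y h.q1 hx' hcon
      have d6 : q^(y+w+1)-q^x ≠ 0 := by
        have := one_sub_q_ne h.q1 (k := y+w+1-x) (by omega) (by omega)
        have e : q^(y+w+1) = q^x*q^(y+w+1-x) := by rw [← pow_add]; congr 1; omega
        rw [e]; intro h'; apply this; apply mul_left_cancel₀ pX; linear_combination -h'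
      rw [pn] at t
      have t' : vv q (c0*c3) c1 (y+w+1) (y+w+1-x) y*((1-c4*c2*c1*q^2*q^(w+1)*q^x)*(q^(w+1)-q^x))
         = q^x*q^x*(1-c4*c2*c1*q^2*q^(w+1))*(q^(w+1)-1)*(1-q*c1)*vv q (c0*c3) (q*c1) (y+w) (y+w-x) y := by
        apply mul_left_cancel₀ (mul_ne_zero pY pY)
        linear_combination t
      rcases Nat.lt_or_ge (y+w-x) y with h' | h'
      · rw [vv_zero h'] at t' ⊢
        linear_combination rr q c1 c3 c0 (y+w+1-x) y b*t'
      · have r := rrI_G (c1 := c1) (c2 := c3) (c3 := c0) hq (y+w-x) y b h' (fun k i j => h.q1 k i (by omega))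
        rw [show y+w-x+1 = y+w+1-x by omega] at r
        have e : q^(y+w+1) = q^x*q^(y+w+1-x) := by rw [← pow_add]; congr 1; omega
        have r' : rr q c1 c3 c0 (y+w+1-x) y b = ((q^x*q^b-q^(y+w+1))*(1-c1*c3*q*q^b)*rr q (q*c1) c3 c0 (y+w-x) y b
        + (c1*c3*q*q^b*q^(y+w+1)-q^x)*(q^b-1)*rr q (q*c1) c3 c0 (y+w-x) y (b-1))/((c1*c3*q*(q^b*q^b)-1)*(q^(y+w+1)-q^x)) := by
          rw [eq_div_iff (mul_ne_zero d3 d6), e]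
          linear_combination q^x*r
        rw [← r']
        linear_combination rr q c1 c3 c0 (y+w+1-x) y b*t'
  have E2 : (q^x-1)*(vv q (c0*c3) c1 (y+w+1) (y+w+1-x) y*rr q c1 c3 c0 (y+w+1-x) y b*((q^x-c1*q*q^(w+1))*(c4*c2*q*q^(w+1)*q^x-1)*(c1*q)))
      = (q^x-1)*(q^x*(1-c4*c2*c1*q^2*q^(w+1))*(q^(w+1)-1)*(1-q*c1)*vv q (c0*c3) (q*c1) (y+w) (y+w-(x-1)) y *
        (((c0*c1*c3*q^2*q^(y+w+1)*q^b-q^x)*(1-c1*c3*q*q^b)*rr q (q*c1) c3 c0 (y+w-(x-1)) y b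
        + c1*c3*q*(q^b*q^x-c0*q*q^(y+w+1))*(q^b-1)*rr q (q*c1) c3 c0 (y+w-(x-1)) y (b-1))/(c1*c3*q*(q^b*q^b)-1))) := by
    rcases x with _ | x
    · rw [pow_zero]; ring
    congr 1
    rw [Nat.add_sub_cancel]
    have t := TY (c1 := c1) (k0 := c2*c4) (y+w) x y h.q1 (by omega) hcon
    rw [Nat.succ_sub_succ] at t ⊢
    rw [pn] at t
    have t' : vv q (c0*c3) c1 (y+w+1) (y+w-x) y*((q^(x+1)-c1*q*q^(w+1))*(c4*c2*q*q^(w+1)*q^(x+1)-1)*(c1*q))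
         = q^(x+1)*(1-c4*c2*c1*q^2*q^(w+1))*(q^(w+1)-1)*(1-q*c1)*vv q (c0*c3) (q*c1) (y+w) (y+w-x) y*(q^(x+1)-c0*c1*c3*q^2*q^(y+w+1)) := by
      apply mul_left_cancel₀ (mul_ne_zero pY pY)
      rw [pn]
      linear_combination t
    rcases Nat.lt_or_ge (y+w-x) y with h' | h'
    · rw [vv_zero h', vv_zero h']; ring
    have r := rrI_F (c1 := c1) (c2 := c3) (c3 := c0) hq (y+w-x) y b (2*(y+w+1)+5) h' (by omega)
      (fun k i j => by rw [show c1*c3*c0 = c0*c1*c3 by ring]; exact h.n013 k i (by omega))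
    have e : q^(x+1)*q^(y+w-x+2) = q^2*q^(y+w+1) := by rw [← pow_add, ← pow_add]; congr 1; omega
    have r' : (q^(x+1)-c0*c1*c3*q^2*q^(y+w+1))*rr q c1 c3 c0 (y+w-x) y b = ((c0*c1*c3*q^2*q^(y+w+1)*q^b-q^(x+1))*(1-c1*c3*q*q^b)*rr q (q*c1) c3 c0 (y+w-x) y b
        + c1*c3*q*(q^b*q^(x+1)-c0*q*q^(y+w+1))*(q^b-1)*rr q (q*c1) c3 c0 (y+w-x) y (b-1))/(c1*c3*q*(q^b*q^b)-1) := by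
      rw [eq_div_iff d3]
      generalize rr q c1 c3 c0 (y+w-x) y b = R1 at *
      generalize rr q (q*c1) c3 c0 (y+w-x) y b = R2 at *
      generalize rr q (q*c1) c3 c0 (y+w-x) y (b-1) = R3 at *
      generalize q^(y+w-x+2) = Z at *
      generalize q^(y+w+1) = Z' at *
      generalize q^(x+1) = X at *
      linear_combination X*r+(R1*c1*c3*c0*(c1*c3*q*(q^b*q^b)-1)+c1*c3*c0*q^b*(1-c1*c3*q*q^b)*R2-c1*c3*c0*(q^b-1)*R3)*e
    rw [← r']
    linear_combination rr q c1 c3 c0 (y+w-x) y b*t'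
  simp only [Psi, Nat.add_sub_cancel_left, ee1, ee2, ee3, ee4, eg1, eg2] at *
  rw [show y+w+1-y = w+1 by omega]
  have hc1q : c1*q ≠ 0 := mul_ne_zero h1 hq
  clear hcon pn h hay hx hb
  generalize vv q (c0*c3) c1 (y+w+1) (y+w+1-x) y = U at *
  generalize rr q c1 c3 c0 (y+w+1-x) y b = R at *
  generalize vv q (c0*c3) (q*c1) (y+w) (y+w-x) y = L at *
  generalize vv q (c0*c3) (q*c1) (y+w) (y+w-(x-1)) y = L' at *
  generalize rr q (q*c1) c3 c0 (y+w-x) y b = R1 at *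
  generalize rr q (q*c1) c3 c0 (y+w-x) y (b-1) = R2 at *
  generalize rr q (q*c1) c3 c0 (y+w-(x-1)) y b = R3 at *
  generalize rr q (q*c1) c3 c0 (y+w-(x-1)) y (b-1) = R4 at *
  generalize rr q c4 (q*c2) (q*c1) w a x = S1 at *
  generalize rr q c4 (q*c2) (q*c1) w a (x-1) = S2 at *
  generalize rr q c4 c2 c1 (w+1) (a+1) x = S at *
  generalize q^(y+w+1) = n at *
  generalize q^(w+1) = W at *
  generalize q^x = X at *
  generalize q^b = B at *
  rw [mul_comm c4 c2] at *
  generalize hD1 : 1-c2*c4*q*(X*X) = D1 at *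
  generalize hD2 : 1-q*c2 = D2 at *
  generalize hD3 : c1*c3*q*(B*B)-1 = D3 at *
  generalize hD4 : 1-c2*c4*c1*q^2*W = D4 at *
  generalize hD5 : W-1 = D5 at *
  rw [show (D3*(n-X)) = D3*(n-X) from rfl] at E1
  apply mul_left_cancel₀ (mul_ne_zero (mul_ne_zero pX (mul_ne_zero d1 d2)) (mul_ne_zero (mul_ne_zero d4 d5) hc1q))
  generalize hiD : (n-X)⁻¹ = iD at *
  simp only [div_eq_mul_inv, mul_inv] at E1 E2 ⊢
  rw [hiD] at *
  have k1 : D1*D1⁻¹ = 1 := mul_inv_cancel₀ d1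
  have k2 : D2*D2⁻¹ = 1 := mul_inv_cancel₀ d2
  have k3 : c1*c1⁻¹ = 1 := mul_inv_cancel₀ h1
  generalize D1⁻¹ = I1 at *
  generalize D2⁻¹ = I2 at *
  generalize D3⁻¹ = I3 at *
  generalize c1⁻¹ = ic at *
  linear_combination (-(U*R*c1*q))*bs+c1*q*(1-c2*q*X)*(1-c2*c4*q*X)*S1*E1-c2*q*(c4*X-1)*S2*E2
    - (X*D4*D5*c1*q*(1-q*c1)*(1-c2*q*X)*(1-c2*c4*q*X)*X*I3*iD*L*S1*((X*B-n)*(1-c1*c3*q*B)*R1+(c1*c3*q*B*n-X)*(B-1)*R2))*(D2*I2*k1+k2)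
    - (-(X*D4*D5*q*(1-q*c1)*c2*(c4*X-1)*(X-1)*I3*L'*S2*((c0*c1*c3*q^2*n*B-X)*(1-c1*c3*q*B)*R3+c1*c3*q*(B*X-c0*q*n)*(B-1)*R4)))*(D2*I2*c1*ic*k1+c1*ic*k2+k3)
end qR
namespace qR
def fx (q A c2 c4 : ℂ) (N x : ℕ) : ℂ := poch q (q*c4) x/(A^x*poch q (q*c2) x*poch q q (N-x))
def fb (q Bc c1 c3 : ℂ) (N b : ℕ) : ℂ := Bc^b*poch q (q*c1) b*poch q q (N-b)/poch q (q*c3) b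
def hf (q c1 c2 c3 c4 : ℂ) (N a x b : ℕ) : ℂ :=
  (c1*c4*q^(N+1))^N*(fx q (c1*c4*q^(N+1)) c2 c1 N a*fx q (c1*c4*q^(N+1)) c2 c4 N x*fb q (c2*c3*q^(N+1)) c1 c3 N b)
lemma sub_pow_ne {q : ℂ} (hq : q ≠ 0) {N x : ℕ} (hx : x ≤ N) (hq1 : ∀ k, 1 ≤ k → k ≤ N+1 → q^k ≠ 1) : q^(N+1)-q^x ≠ 0 := by
  have := one_sub_q_ne hq1 (k := N+1-x) (by omega) (by omega)
  have e : q^(N+1) = q^x*q^(N+1-x) := by rw [← pow_add]; congr 1; omega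
  rw [e]; intro h'; apply this; apply mul_left_cancel₀ (pow_ne_zero x hq); linear_combination -h'
lemma fx_up0 {q : ℂ} (hq : q ≠ 0) (A c2 c4 : ℂ) (N x : ℕ) (hx : x ≤ N) (hA : A ≠ 0)
    (hq1 : ∀ k, 1 ≤ k → k ≤ N+1 → q^k ≠ 1) (h2 : ∀ k, 1 ≤ k → k ≤ N+2 → c2*q^k ≠ 1) :
    fx q A c2 c4 (N+1) x = (1-c2*q*q^x)*q^x*fx q A (q*c2) c4 N x/((1-q*c2)*(q^x-q^(N+1))) := by
  have d6 := sub_pow_ne hq hx hq1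
  have d7 : q^x-q^(N+1) ≠ 0 := by intro h; apply d6; linear_combination -h
  have d2 : 1-q*c2 ≠ 0 := by
    have := one_sub_ne h2 (k := 1) (by omega) (by omega)
    rwa [pow_one, mul_comm] at this
  have p1 := poch_one_ne h2 (k := x) (by omega)
  have p0 : poch q (q*c2) (x+1) ≠ 0 := poch_one_ne h2 (by omega)
  rw [poch_succ'] at p0
  have p2 := right_ne_zero_of_mul p0
  have s := poch_shift q (q*c2) x
  have p3 : poch q q (N-x) ≠ 0 := poch_q_ne hq1 (by omega)
  have p4 : poch q q (N+1-x) ≠ 0 := poch_q_ne hq1 (by omega)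
  have e : poch q q (N+1-x) = poch q q (N-x)*(1-q*q^(N-x)) := by
    rw [show N+1-x = N-x+1 by omega, poch_succ]
  have e2 : q^(N+1) = q^x*(q*q^(N-x)) := by rw [← pow_succ', ← pow_add]; congr 1; omega
  have pA := pow_ne_zero x hA
  rw [fx, fx, show q*(q*c2) = q*c2*q by ring]
  generalize poch q (q*c2) x = P1 at *
  generalize poch q (q*c2*q) x = P2 at *
  generalize poch q q (N-x) = P3 at *
  generalize poch q q (N+1-x) = P4 at *
  rw [e2] at d7 ⊢
  have hP4 : q^x*P4 = P3*(q^x-q^x*(q*q^(N-x))) := by rw [e]; ring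
  generalize q*q^(N-x) = w at *
  generalize q^x = X at *
  generalize A^x = AX at *
  generalize hu : X-X*w = u at *
  generalize hv : 1-q*c2 = v at *
  field_simp
  linear_combination poch q (q*c4) x*((P3*u)*s-P1*(1-c2*q*X)*hP4)
lemma fx_up1 {q : ℂ} (hq : q ≠ 0) (A c2 c4 : ℂ) (N x : ℕ) (hx : x ≤ N) (hA : A ≠ 0)
    (h2 : ∀ k, 1 ≤ k → k ≤ N+2 → c2*q^k ≠ 1) :
    fx q A c2 c4 (N+1) (x+1) = (1-c4*q^(x+1))*fx q A (q*c2) c4 N x/((1-q*c2)*A) := by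
  rw [fx, fx, Nat.succ_sub_succ, poch_succ' q (q*c2), poch_succ, show q*(q*c2) = q*c2*q by ring, pow_succ A, show 1-q*c4*q^x = 1-c4*q^(x+1) by ring,
   div_eq_mul_inv, div_eq_mul_inv, div_eq_mul_inv]
  simp only [mul_inv]
  ring
lemma fb_up0 {q : ℂ} (hq : q ≠ 0) (A c1 c3 : ℂ) (N b : ℕ) (hx : b ≤ N)
    (h1 : ∀ k, 1 ≤ k → k ≤ N+2 → c1*q^k ≠ 1) :
    fb q A c1 c3 (N+1) b = (1-q*c1)*(q^b-q^(N+1))*fb q A (q*c1) c3 N b/((1-c1*q*q^b)*q^b) := by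
  have p0 : poch q (q*c1) (b+1) ≠ 0 := poch_one_ne h1 (by omega)
  have s := poch_shift q (q*c1) b
  rw [poch_succ] at p0
  have p2 := right_ne_zero_of_mul p0
  have e : poch q q (N+1-b) = poch q q (N-b)*(1-q*q^(N-b)) := by
    rw [show N+1-b = N-b+1 by omega, poch_succ]
  have e2 : q^(N+1) = q^b*(q*q^(N-b)) := by rw [← pow_succ', ← pow_add]; congr 1; omega
  have pX : q^b ≠ 0 := pow_ne_zero _ hq
  rw [fb, fb, e, e2, show q*(q*c1) = q*c1*q by ring]
  rw [show c1*q*q^b = q*c1*q^b by ring]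
  generalize poch q (q*c1) b = P1 at *
  generalize poch q (q*c1*q) b = P2 at *
  generalize poch q q (N-b) = P3 at *
  rw [div_eq_mul_inv (A^b*P1*_)]
  rw [div_eq_mul_inv (A^b*P2*_)]
  generalize (poch q (q*c3) b)⁻¹ = I at *
  generalize A^b = AX at *
  generalize q*q^(N-b) = w at *
  rw [eq_div_iff (mul_ne_zero p2 pX)]
  linear_combination -(AX*P3*(1-w)*I*q^b)*s
lemma fb_up1 {q : ℂ} (A c1 c3 : ℂ) (N b : ℕ) :
    fb q A c1 c3 (N+1) (b+1) = A*(1-q*c1)*fb q A (q*c1) c3 N b/(1-c3*q^(b+1)) := by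
  rw [fb, fb, Nat.succ_sub_succ, poch_succ', poch_succ, show q*(q*c1) = q*c1*q by ring, pow_succ A, show 1-q*c3*q^b = 1-c3*q^(b+1) by ring,
   div_eq_mul_inv, div_eq_mul_inv, div_eq_mul_inv]
  simp only [mul_inv]
  ring
section
variable {q c0 c1 c2 c3 c4 : ℂ} {N : ℕ}
lemma hf_low (a x b : ℕ) : hf q (q*c1) (q*c2) c3 c4 N a x b = (c1*c4*q^(N+1+1))^N*(fx q (c1*c4*q^(N+1+1)) (q*c2) (q*c1) N a*fx q (c1*c4*q^(N+1+1)) (q*c2) c4 N x*fb q (c2*c3*q^(N+1+1)) (q*c1) c3 N b) := by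
  rw [hf, show q*c1*c4*q^(N+1) = c1*c4*q^(N+1+1) by ring, show q*c2*c3*q^(N+1) = c2*c3*q^(N+1+1) by ring]
lemma fa_up (A : ℂ) (a : ℕ) :
    fx q A c2 c1 (N+1) (a+1) = (1-q*c1)*fx q A (q*c2) (q*c1) N a/((1-q*c2)*A) := by
  rw [fx, fx, Nat.succ_sub_succ, poch_succ', poch_succ', show q*(q*c2) = q*c2*q by ring, pow_succ A, show q*(q*c1) = q*c1*q by ring,
   div_eq_mul_inv, div_eq_mul_inv, div_eq_mul_inv]
  simp only [mul_inv]
  ring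
lemma Hyp.base (h : Hyp q (N+1) c0 c1 c2 c3 c4) : 1-q*c1 ≠ 0 ∧ 1-q*c2 ≠ 0 ∧ c1*c4*q^(N+1+1) ≠ 0 := by
  have d2 : 1-q*c2 ≠ 0 := by
    have := one_sub_ne h.n2 (k := 1) (by omega) (by omega)
    rwa [pow_one, mul_comm] at this
  have d1 : 1-q*c1 ≠ 0 := by
    have := one_sub_ne h.n1 (k := 1) (by omega) (by omega)
    rwa [pow_one, mul_comm] at this
  exact ⟨d1, d2, mul_ne_zero (mul_ne_zero h.h1 h.h4) (pow_ne_zero _ h.hq)⟩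
lemma Hyp.d13 (h : Hyp q (N+1) c0 c1 c2 c3 c4) (b : ℕ) (hb : b ≤ N+1) : c1*c3*q*(q^b*q^b)-1 ≠ 0 := by
  have := one_sub_ne h.n13 (k := 2*b+1) (by omega) (by omega)
  rw [show c1*c3*q^(2*b+1) = c1*c3*q*(q^b*q^b) by ring] at this
  intro h'; apply this; linear_combination -h'
lemma Hyp.d24 (h : Hyp q (N+1) c0 c1 c2 c3 c4) (b : ℕ) (hb : b ≤ N+1) : c2*c4*q*(q^b*q^b)-1 ≠ 0 := by
  have := one_sub_ne h.n24 (k := 2*b+1) (by omega) (by omega)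
  rw [show c2*c4*q^(2*b+1) = c2*c4*q*(q^b*q^b) by ring] at this
  intro h'; apply this; linear_combination -h'
lemma hf1 (h : Hyp q (N+1) c0 c1 c2 c3 c4) (a x b : ℕ) (hxb : x+b ≤ N) :
   hf q c1 c2 c3 c4 (N+1) (a+1) x b*ee1 q c2 c1 c4 c3 (q^(N+1)) (q^b) (q^x)
    = ee1 q c1 c2 c3 c4 (q^(N+1)) (q^x) (q^b)*hf q (q*c1) (q*c2) c3 c4 N a x b := by
  obtain ⟨d1, d2, hA⟩ := h.base
  have d3 := h.d13 b (by omega)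
  have d4 := h.d24 x (by omega)
  have d5 := sub_pow_ne h.hq (by omega : x ≤ N) h.q1
  have d6 := sub_pow_ne h.hq (by omega : b ≤ N) h.q1
  have d8 := one_sub_ne h.n1 (k := b+1) (by omega) (by omega)
  rw [hf_low, hf, fa_up _ _, fx_up0 h.hq _ _ _ N x (by omega) hA h.q1 (fun k i j => h.n2 k i (by omega)),
    fb_up0 h.hq _ _ _ N b (by omega) (fun k i j => h.n1 k i (by omega)), ee1, ee1, eg1, eg1]
  have pB : q^b ≠ 0 := pow_ne_zero _ h.hq
  rw [show c1*q^(b+1) = c1*q*q^b by ring] at d8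
  have f1 : 1-c1*c3*q*(q^b*q^b) = -(c1*c3*q*(q^b*q^b)-1) := by ring
  have f2 : 1-c2*c4*q*(q^x*q^x) = -(c2*c4*q*(q^x*q^x)-1) := by ring
  have f3 : q^x-q^(N+1) = -(q^(N+1)-q^x) := by ring
  have f4 : q^b-q^(N+1) = -(q^(N+1)-q^b) := by ring
  rw [f1, f2, f3, f4, pow_succ _ N]
  generalize c1*c3*q*(q^b*q^b)-1 = D3 at *
  generalize c2*c4*q*(q^x*q^x)-1 = D4 at *
  generalize q^(N+1)-q^x = D5 at *
  generalize q^(N+1)-q^b = D6 at *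
  generalize 1-c1*q*q^b = D8 at *
  generalize 1-q*c1 = D1 at *
  generalize 1-q*c2 = D2 at *
  generalize fx q _ (q*c2) (q*c1) N a = Fa at *
  generalize fx q _ (q*c2) c4 N x = Fx at *
  generalize fb q _ (q*c1) c3 N b = Fb at *
  generalize c1*c4*q^(N+1+1) = A at *
  generalize A^N = AN at *
  generalize q^(N+1) = n at *
  generalize q^x = X at *
  generalize q^b = B at *
  clear f1 f2 f3 f4 h hxb
  simp only [div_div, mul_div_assoc', div_mul_eq_mul_div]
  rw [div_eq_div_iff (by simp [*]) (by simp [*])]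
  ring
lemma hf2 (h : Hyp q (N+1) c0 c1 c2 c3 c4) (a x b : ℕ) (hxb : x+b ≤ N) :
   hf q c1 c2 c3 c4 (N+1) (a+1) (x+1) b*ee2 q c2 c1 c4 c3 (q^(N+1)) (q^b) (q^(x+1))
    = ee3 q c0 c1 c2 c3 c4 (q^(N+1)) (q^(x+1)) (q^b)*hf q (q*c1) (q*c2) c3 c4 N a x b := by
  obtain ⟨d1, d2, hA⟩ := h.base
  have d3 := h.d13 b (by omega)
  have d4 := h.d24 (x+1) (by omega)
  have d6 := sub_pow_ne h.hq (by omega : b ≤ N) h.q1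
  have d8 := one_sub_ne h.n1 (k := b+1) (by omega) (by omega)
  rw [hf_low, hf, fa_up _ _, fx_up1 h.hq _ _ _ N x (by omega) hA (fun k i j => h.n2 k i (by omega)),
    fb_up0 h.hq _ _ _ N b (by omega) (fun k i j => h.n1 k i (by omega)), ee2, ee3, eg1, eg2]
  have pB : q^b ≠ 0 := pow_ne_zero _ h.hq
  have pn : q^(N+1) ≠ 0 := pow_ne_zero _ h.hq
  have h1 := h.h1
  have h4 := h.h4
  have h2 := h.h2
  have hq := h.hq
  have con : c0*c1*c2*c3*c4*q^3*(q^(N+1)*q^(N+1)) = 1 := by rw [← h.con]; ring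
  have con' : c0*c1*c3*q^2*q^(N+1) = (c2*c4*q*q^(N+1))⁻¹ := by
    apply eq_inv_of_mul_eq_one_left; linear_combination con
  rw [show c1*q^(b+1) = c1*q*q^b by ring] at d8
  have f1 : 1-c1*c3*q*(q^b*q^b) = -(c1*c3*q*(q^b*q^b)-1) := by ring
  have f2 : 1-c2*c4*q*(q^(x+1)*q^(x+1)) = -(c2*c4*q*(q^(x+1)*q^(x+1))-1) := by ring
  have f4 : q^b-q^(N+1) = -(q^(N+1)-q^b) := by ring
  rw [f1, f2, f4, con', pow_succ _ N]
  generalize c1*c3*q*(q^b*q^b)-1 = D3 at *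
  generalize c2*c4*q*(q^(x+1)*q^(x+1))-1 = D4 at *
  generalize q^(N+1)-q^b = D6 at *
  generalize 1-c1*q*q^b = D8 at *
  generalize 1-q*c1 = D1 at *
  generalize 1-q*c2 = D2 at *
  generalize fx q _ (q*c2) (q*c1) N a = Fa at *
  generalize fx q _ (q*c2) c4 N x = Fx at *
  generalize fb q _ (q*c1) c3 N b = Fb at *
  generalize hAA : c1*c4*q^(N+1+1) = A at *
  generalize A^N = AN at *
  rw [show c1*c4*q^(N+1+1) = c1*c4*q*q^(N+1) by ring] at hAA
  generalize q^(N+1) = n at *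
  generalize q^(x+1) = X at *
  generalize q^b = B at *
  clear f1 f2 f4 h con con'
  subst hAA
  field_simp
  ring
lemma hf3 (h : Hyp q (N+1) c0 c1 c2 c3 c4) (a x b : ℕ) (hxb : x+b ≤ N) :
   hf q c1 c2 c3 c4 (N+1) (a+1) x (b+1)*ee3 q c0 c2 c1 c4 c3 (q^(N+1)) (q^(b+1)) (q^x)
    = ee2 q c1 c2 c3 c4 (q^(N+1)) (q^x) (q^(b+1))*hf q (q*c1) (q*c2) c3 c4 N a x b := by
  obtain ⟨d1, d2, hA⟩ := h.base
  have d3 := h.d13 (b+1) (by omega)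
  have d4 := h.d24 x (by omega)
  have d5 := sub_pow_ne h.hq (by omega : x ≤ N) h.q1
  have d8 := one_sub_ne h.n3 (k := b+1) (by omega) (by omega)
  rw [hf_low, hf, fa_up _ _, fx_up0 h.hq _ _ _ N x (by omega) hA h.q1 (fun k i j => h.n2 k i (by omega)),
    fb_up1, ee2, ee3, eg1, eg2]
  have pn : q^(N+1) ≠ 0 := pow_ne_zero _ h.hq
  have h1 := h.h1
  have h3 := h.h3
  have h2 := h.h2
  have hq := h.hq
  have con : c0*c1*c2*c3*c4*q^3*(q^(N+1)*q^(N+1)) = 1 := by rw [← h.con]; ring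
  have con' : c0*c2*c4*q^2*q^(N+1) = (c1*c3*q*q^(N+1))⁻¹ := by
    apply eq_inv_of_mul_eq_one_left; linear_combination con
  have f1 : 1-c1*c3*q*(q^(b+1)*q^(b+1)) = -(c1*c3*q*(q^(b+1)*q^(b+1))-1) := by ring
  have f2 : 1-c2*c4*q*(q^x*q^x) = -(c2*c4*q*(q^x*q^x)-1) := by ring
  have f3 : q^x-q^(N+1) = -(q^(N+1)-q^x) := by ring
  have f4 : c3*q^(b+1)-1 = -(1-c3*q^(b+1)) := by ring
  rw [f1, f2, f3, f4, con', pow_succ _ N, show c2*c3*q^(N+1+1) = c2*c3*q*q^(N+1) by ring]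
  generalize c1*c3*q*(q^(b+1)*q^(b+1))-1 = D3 at *
  generalize c2*c4*q*(q^x*q^x)-1 = D4 at *
  generalize q^(N+1)-q^x = D5 at *
  generalize 1-c3*q^(b+1) = D8 at *
  generalize 1-q*c1 = D1 at *
  generalize 1-q*c2 = D2 at *
  generalize fx q _ (q*c2) (q*c1) N a = Fa at *
  generalize fx q _ (q*c2) c4 N x = Fx at *
  generalize fb q _ (q*c1) c3 N b = Fb at *
  generalize hAA : c1*c4*q^(N+1+1) = A at *
  generalize A^N = AN at *
  generalize q^(N+1) = n at *
  generalize q^(b+1) = B at *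
  generalize q^x = X at *
  clear f1 f2 f3 f4 h con con' hAA hxb
  rw [inv_mul_eq_div, div_sub' (by simp [*])]
  simp only [div_div, mul_div_assoc', div_mul_eq_mul_div, ← neg_div]
  rw [div_eq_div_iff (by simp [*]) (by simp [*])]
  ring
lemma hf4 (h : Hyp q (N+1) c0 c1 c2 c3 c4) (a x b : ℕ) (hxb : x+1+b ≤ N) :
   hf q c1 c2 c3 c4 (N+1) (a+1) (x+1) (b+1)*ee4 q c0 c2 c1 c4 c3 (q^(N+1)) (q^(b+1)) (q^(x+1))
    = ee4 q c0 c1 c2 c3 c4 (q^(N+1)) (q^(x+1)) (q^(b+1))*hf q (q*c1) (q*c2) c3 c4 N a x b := by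
  obtain ⟨d1, d2, hA⟩ := h.base
  have d3 := h.d13 (b+1) (by omega)
  have d4 := h.d24 (x+1) (by omega)
  have d8 := one_sub_ne h.n3 (k := b+1) (by omega) (by omega)
  rw [hf_low, hf, fa_up _ _, fx_up1 h.hq _ _ _ N x (by omega) hA (fun k i j => h.n2 k i (by omega)),
    fb_up1, ee4, ee4, eg2, eg2]
  have pn : q^(N+1) ≠ 0 := pow_ne_zero _ h.hq
  have h1 := h.h1
  have h4 := h.h4
  have h2 := h.h2
  have hq := h.hq
  have f1 : 1-c1*c3*q*(q^(b+1)*q^(b+1)) = -(c1*c3*q*(q^(b+1)*q^(b+1))-1) := by ring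
  have f2 : 1-c2*c4*q*(q^(x+1)*q^(x+1)) = -(c2*c4*q*(q^(x+1)*q^(x+1))-1) := by ring
  have f4 : c3*q^(b+1)-1 = -(1-c3*q^(b+1)) := by ring
  rw [f1, f2, f4, pow_succ _ N, show c2*c3*q^(N+1+1) = c2*c3*q*q^(N+1) by ring]
  generalize c1*c3*q*(q^(b+1)*q^(b+1))-1 = D3 at *
  generalize c2*c4*q*(q^(x+1)*q^(x+1))-1 = D4 at *
  generalize 1-c3*q^(b+1) = D8 at *
  generalize 1-q*c1 = D1 at *
  generalize 1-q*c2 = D2 at *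
  generalize fx q _ (q*c2) (q*c1) N a = Fa at *
  generalize fx q _ (q*c2) c4 N x = Fx at *
  generalize fb q _ (q*c1) c3 N b = Fb at *
  generalize hAA : c1*c4*q^(N+1+1) = A at *
  generalize A^N = AN at *
  rw [show c1*c4*q^(N+1+1) = c1*c4*q*q^(N+1) by ring] at hAA
  generalize q^(N+1) = n at *
  generalize q^(b+1) = B at *
  generalize q^(x+1) = X at *
  clear f1 f2 f4 h hxb
  subst hAA
  simp only [div_div, mul_div_assoc', div_mul_eq_mul_div, ← neg_div]
  rw [div_eq_div_iff (by simp [*]) (by simp [*])]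
  ring
end
end qR
namespace qR
def uu (q d c4 : ℂ) (m y : ℕ) : ℂ :=
  sg q d y*(1-d*q^(2*y+1))/poch q q y*JJ q (q*c4) m y*poch q (d*c4*q^(m+2)) y/poch q (d*q^(y+1)) (m+1)
def PL (q c0 c1 c2 c3 c4 : ℂ) (N j a x b : ℕ) : ℂ :=
  ∑ y ∈ Finset.range (N+1), uu q (c0*c3) c4 (N-a) y*rr q c3 c0 c4 (N-a) j y*Psi q c0 c1 c2 c3 c4 N a x b y
def kj (q c0 c4 : ℂ) (j : ℕ) : ℂ := poch q (q*c4) j/(poch q (q*c0) j*kk q c4 j)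
lemma uu_zero {q d c4 : ℂ} {m y : ℕ} (h : m < y) : uu q d c4 m y = 0 := by
  rw [uu, JJ_zero h]; ring
section
variable {q c0 c1 c2 c3 c4 : ℂ} {N : ℕ}
lemma PL_expand (h : Hyp q (N+1) c0 c1 c2 c3 c4) (j a x b : ℕ) (ha : a ≤ N) (hx : x ≤ N+1) (hb : b ≤ N+1) :
    PL q c0 c1 c2 c3 c4 (N+1) j (a+1) x b
     = ee1 q c1 c2 c3 c4 (q^(N+1)) (q^x) (q^b)*PL q c0 (q*c1) (q*c2) c3 c4 N j a x b
     + ee2 q c1 c2 c3 c4 (q^(N+1)) (q^x) (q^b)*PL q c0 (q*c1) (q*c2) c3 c4 N j a x (b-1)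
     + ee3 q c0 c1 c2 c3 c4 (q^(N+1)) (q^x) (q^b)*PL q c0 (q*c1) (q*c2) c3 c4 N j a (x-1) b
     + ee4 q c0 c1 c2 c3 c4 (q^(N+1)) (q^x) (q^b)*PL q c0 (q*c1) (q*c2) c3 c4 N j a (x-1) (b-1) := by
  rw [PL, Finset.sum_range_succ, Nat.add_sub_add_right, uu_zero (show N-a < N+1 by omega)]
  simp only [PL, Finset.mul_sum]
  rw [zero_mul, zero_mul, add_zero, ← Finset.sum_add_distrib, ← Finset.sum_add_distrib, ← Finset.sum_add_distrib]
  apply Finset.sum_congr rfl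
  intro y hy
  rcases Nat.lt_or_ge N (a+y) with hay | hay
  · rw [uu_zero (show N-a < y by have := Finset.mem_range.1 hy; omega)]; ring
  · rw [Psi_expand h a x b y hay hx hb]; ring
lemma stepA (h : Hyp q (N+1) c0 c1 c2 c3 c4) (j a x b : ℕ) (hja : j+a ≤ N) (hxb : x+b ≤ N+1)
    (IH : ∀ x b, x+b ≤ N → PL q c0 (q*c1) (q*c2) c3 c4 N j a x b
      = kj q c0 c4 j*hf q (q*c1) (q*c2) c3 c4 N a x b*Psi q c0 (q*c2) (q*c1) c4 c3 N a b x j) :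
    PL q c0 c1 c2 c3 c4 (N+1) j (a+1) x b
      = kj q c0 c4 j*hf q c1 c2 c3 c4 (N+1) (a+1) x b*Psi q c0 c2 c1 c4 c3 (N+1) (a+1) b x j := by
  rw [PL_expand h j a x b (by omega) (by omega) (by omega), Psi_expand h.swap a b x j (by omega) (by omega) (by omega)]
  have T1 : ee1 q c1 c2 c3 c4 (q^(N+1)) (q^x) (q^b)*PL q c0 (q*c1) (q*c2) c3 c4 N j a x b
     = kj q c0 c4 j*hf q c1 c2 c3 c4 (N+1) (a+1) x b*(ee1 q c2 c1 c4 c3 (q^(N+1)) (q^b) (q^x)*Psi q c0 (q*c2) (q*c1) c4 c3 N a b x j) := by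
    rcases Nat.lt_or_ge N (x+b) with h' | h'
    · have e : q^x*q^b-q^(N+1) = 0 := by rw [← pow_add, show x+b = N+1 by omega, sub_self]
      have e' : q^b*q^x-q^(N+1) = 0 := by rw [mul_comm, e]
      rw [ee1, ee1, e, e']; ring
    · rw [IH x b h']
      linear_combination -(kj q c0 c4 j*Psi q c0 (q*c2) (q*c1) c4 c3 N a b x j)*hf1 h a x b h'
  have T2 : ee2 q c1 c2 c3 c4 (q^(N+1)) (q^x) (q^b)*PL q c0 (q*c1) (q*c2) c3 c4 N j a x (b-1)
     = kj q c0 c4 j*hf q c1 c2 c3 c4 (N+1) (a+1) x b*(ee3 q c0 c2 c1 c4 c3 (q^(N+1)) (q^b) (q^x)*Psi q c0 (q*c2) (q*c1) c4 c3 N a (b-1) x j) := by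
    rcases b with _ | b
    · rw [ee2, ee3, eg2, pow_zero, sub_self]; ring
    · rw [Nat.add_sub_cancel, IH x b (by omega)]
      linear_combination -(kj q c0 c4 j*Psi q c0 (q*c2) (q*c1) c4 c3 N a b x j)*hf3 h a x b (by omega)
  have T3 : ee3 q c0 c1 c2 c3 c4 (q^(N+1)) (q^x) (q^b)*PL q c0 (q*c1) (q*c2) c3 c4 N j a (x-1) b
     = kj q c0 c4 j*hf q c1 c2 c3 c4 (N+1) (a+1) x b*(ee2 q c2 c1 c4 c3 (q^(N+1)) (q^b) (q^x)*Psi q c0 (q*c2) (q*c1) c4 c3 N a b (x-1) j) := by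
    rcases x with _ | x
    · rw [ee2, ee3, eg2, pow_zero, sub_self]; ring
    · rw [Nat.add_sub_cancel, IH x b (by omega)]
      linear_combination -(kj q c0 c4 j*Psi q c0 (q*c2) (q*c1) c4 c3 N a b x j)*hf2 h a x b (by omega)
  have T4 : ee4 q c0 c1 c2 c3 c4 (q^(N+1)) (q^x) (q^b)*PL q c0 (q*c1) (q*c2) c3 c4 N j a (x-1) (b-1)
     = kj q c0 c4 j*hf q c1 c2 c3 c4 (N+1) (a+1) x b*(ee4 q c0 c2 c1 c4 c3 (q^(N+1)) (q^b) (q^x)*Psi q c0 (q*c2) (q*c1) c4 c3 N a (b-1) (x-1) j) := by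
    rcases b with _ | b
    · rw [ee4, ee4, eg2, eg2, pow_zero, sub_self]; ring
    rcases x with _ | x
    · rw [ee4, ee4, eg2, eg2, pow_zero, sub_self]; ring
    · rw [Nat.add_sub_cancel, Nat.add_sub_cancel, IH x b (by omega)]
      linear_combination -(kj q c0 c4 j*Psi q c0 (q*c2) (q*c1) c4 c3 N a b x j)*hf4 h a x b (by omega)
  rw [T1, T2, T3, T4]; ring
end
end qR
namespace qR
lemma kk_mul (q c z : ℂ) (n : ℕ) : kk q (c*z) n = z^n*kk q c n := by
  induction n with
  | zero => simp [kk_zero]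
  | succ n ih => rw [kk_succ, kk_succ, ih]; ring
lemma poch_rev {q : ℂ} (hq : q ≠ 0) (c : ℂ) (j : ℕ) : ∀ v, c*v*q^j = 1 → poch q (c*q) j = poch q v j*kk q c j := by
  induction j with
  | zero => intro v _; simp [poch_zero, kk_zero]
  | succ j ih =>
    intro v hv
    have := ih (v*q) (by rw [← hv]; ring)
    rw [poch_succ, poch_succ', kk_succ, this]
    linear_combination -(poch q (v*q) j*kk q c j)*hv
section
variable {q c0 c1 c2 c3 c4 : ℂ} {N : ℕ}
lemma uv_symm (h : Hyp q N c0 c1 c2 c3 c4) (a x y : ℕ) (ha : a ≤ N) (hx : x ≤ N) (hy : y ≤ N) :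
    uu q (c0*c3) c4 (N-a) y*vv q (c0*c3) c1 N (N-x) y = uu q (c3*c0) c1 (N-x) y*vv q (c3*c0) c4 N (N-a) y := by
  rw [mul_comm c3 c0, uu, uu, vv, vv]
  generalize hd : c0*c3 = d
  have nn : ∀ k, 1 ≤ k → k ≤ 2*N+5 → d*q^k ≠ 1 := hd ▸ h.n03
  have key : ∀ z, z ≤ N → poch q (d*q^(y+(N-z)+2)) (N-(N-z))*poch q (d*q^(y+1)) (N-z+1) = poch q (d*q^(y+1)) (N+1) := by
    intro z hz
    have := poch_add q (d*q^(y+1)) (N-z+1) z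
    rw [show N-(N-z) = z by omega]
    rw [show N-z+1+z = N+1 by omega, show d*q^(y+1)*q^(N-z+1) = d*q^(y+(N-z)+2) by ring] at this
    rw [this]; ring
  have k1 := key a ha
  have k2 := key x hx
  have p1 : poch q (d*q^(y+1)) (N-a+1) ≠ 0 := poch_pow_ne nn (by omega) (by omega)
  have p2 : poch q (d*q^(y+1)) (N-x+1) ≠ 0 := poch_pow_ne nn (by omega) (by omega)
  have p3 : poch q q y ≠ 0 := poch_q_ne h.q1 hy
  rw [← k2] at k1
  clear key k2 h nn
  generalize poch q (d*q^(y+(N-a)+2)) (N-(N-a)) = A1 at *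
  generalize poch q (d*q^(y+(N-x)+2)) (N-(N-x)) = A2 at *
  generalize poch q (d*q^(y+1)) (N-a+1) = B1 at *
  generalize poch q (d*q^(y+1)) (N-x+1) = B2 at *
  generalize poch q q y = B3 at *
  generalize poch q (d*c1*q^(N-x+2)) y = C1
  generalize poch q (d*c4*q^(N-a+2)) y = C2
  generalize sg q d y*(1-d*q^(2*y+1)) = C3
  generalize JJ q (q*c1) (N-x) y = C4
  generalize JJ q (q*c4) (N-a) y = C5
  generalize poch q q (N-y) = C6
  rw [div_mul_eq_mul_div, div_mul_eq_mul_div, div_mul_eq_mul_div, div_mul_eq_mul_div, div_mul_eq_mul_div, div_mul_eq_mul_div,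
   div_mul_eq_mul_div, div_mul_eq_mul_div, div_div, div_div, div_eq_div_iff (mul_ne_zero p3 p1) (mul_ne_zero p3 p2)]
  linear_combination -(C3*C4*C5*C6*C1*C2*B3)*k1
lemma PL_refl (h : Hyp q N c0 c1 c2 c3 c4) (j a x b : ℕ) (ha : a ≤ N) (hx : x ≤ N) :
    PL q c0 c1 c2 c3 c4 N j a x b = PL q c3 c4 c2 c0 c1 N b x a j := by
  apply Finset.sum_congr rfl
  intro y hy
  rw [Psi, Psi, rr_dual h.hq c3 c0 c4 (N-a) j y, rr_dual h.hq c4 c2 c1, rr_dual h.hq c1 c3 c0]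
  linear_combination (rr q c4 c0 c3 (N-a) y j*rr q c1 c2 c4 (N-y) x a*rr q c0 c3 c1 (N-x) b y)*uv_symm h a x y ha hx (by have := Finset.mem_range.1 hy; omega)
lemma H_refl (h : Hyp q N c0 c1 c2 c3 c4) (j a x b : ℕ) (hj : j ≤ N) (hb : b ≤ N) :
    kj q c0 c4 j*hf q c1 c2 c3 c4 N a x b*Psi q c0 c2 c1 c4 c3 N a b x j
    = kj q c3 c1 b*hf q c4 c2 c0 c1 N x a j*Psi q c3 c2 c4 c1 c0 N x j a b := by
  rw [Psi, Psi, rr_dual h.hq c2 c4 c0, rr_dual h.hq c3 c1 c2]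
  have key : kj q c0 c4 j*hf q c1 c2 c3 c4 N a x b*vv q (c0*c4) c2 N (N-b) j
     = kj q c3 c1 b*hf q c4 c2 c0 c1 N x a j*vv q (c3*c1) c2 N (N-j) b := by
    rcases Nat.lt_or_ge N (j+b) with hjb | hjb
    · rw [vv_zero (show N-b < j by omega), vv_zero (show N-j < b by omega)]; ring
    rw [vv, vv, kj, kj, hf, hf, fb, fb, mul_comm c4 c1, JJ, JJ, if_pos (by omega), if_pos (by omega)]
    have r1 := poch_rev h.hq (c4*(c0*c2*q^(N-b+1))) j (c3*c1*q^(b+(N-j)+2)) (by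
      obtain ⟨z, rfl⟩ := Nat.exists_eq_add_of_le hjb
      rw [← h.con, show j+b+z-b = j+z by omega, show j+b+z-j = b+z by omega]; ring)
    have r2 := poch_rev h.hq (c1*(c2*c3*q^(N-j+1))) b (c0*c4*q^(j+(N-b)+2)) (by
      obtain ⟨z, rfl⟩ := Nat.exists_eq_add_of_le hjb
      rw [← h.con, show j+b+z-b = j+z by omega, show j+b+z-j = b+z by omega]; ring)
    rw [kk_mul] at r1 r2
    have e1 : c2*c3*q^(N+1) = c2*c3*q^(N-j+1)*q^j := by rw [mul_assoc, mul_assoc, mul_assoc, ← pow_add]; congr 3; omega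
    have e2 : c2*c0*q^(N+1) = c0*c2*q^(N-b+1)*q^b := by rw [mul_comm c2, mul_assoc, mul_assoc, mul_assoc, ← pow_add]; congr 3; omega
    rw [show N-(N-b) = b by omega, show N-(N-j) = j by omega, e1, e2, mul_pow _ (q^j), mul_pow _ (q^b),
     show c0*c4*c2*q^(N-b+2) = c4*(c0*c2*q^(N-b+1))*q by ring, show c3*c1*c2*q^(N-j+2) = c1*(c2*c3*q^(N-j+1))*q by ring, r1, r2,
     show N-b-j = N-j-b by omega, ← pow_mul, ← pow_mul, mul_comm b j]
    have k1 := kk_ne h.hq h.h4 j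
    have k2 := kk_ne h.hq h.h1 b
    have p0 : poch q (q*c0) j ≠ 0 := poch_one_ne h.n0 (by omega)
    have p3 : poch q (q*c3) b ≠ 0 := poch_one_ne h.n3 (by omega)
    generalize kk q c4 j = K1 at *
    generalize kk q c1 b = K2 at *
    generalize poch q (q*c0) j = P0 at *
    generalize poch q (q*c3) b = P3 at *
    generalize fx q _ c2 c1 N a = F1
    generalize fx q _ c2 c4 N x = F2
    generalize (c1*c4*q^(N+1))^N = F3
    generalize (c2*c3*q^(N-j+1))^b = F4
    generalize (c0*c2*q^(N-b+1))^j = F5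
    generalize poch q (q*c2) (N-j-b)/poch q q (N-j-b) = F6
    generalize poch q (c0*c4*q^(j+(N-b)+2)) b = F7
    generalize poch q (c3*c1*q^(b+(N-j)+2)) j = F8
    generalize poch q (q*c4) j = F9
    generalize poch q (q*c1) b = F10
    generalize poch q q (N-j) = F11
    generalize poch q q (N-b) = F12
    generalize q^(j*b) = F13
    clear r1 r2 h e1 e2
    simp only [div_eq_mul_inv, mul_inv]
    linear_combination (F9*P0⁻¹*F3*F1*F2*F4*F13*F10*F12*P3⁻¹*F11*F7*F6*F8*F5)*(inv_mul_cancel₀ k1-inv_mul_cancel₀ k2)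
  linear_combination (rr q c0 c4 c2 (N-b) x j*rr q c2 c1 c3 (N-j) b a)*key
end
end qR
namespace qR
def ff (q c0 c1 c3 : ℂ) (N y : ℕ) : ℂ :=
  sg q (c0*c3) y*(q*c0)^y*poch q (q*c3) y/poch q (q*c0) y*poch q (q*c1) (N-y)*poch q (c0*c3*c1*q^(N+2)) y/poch q q N
lemma TIIc (q A B C D E F G : ℂ) (hq : q ≠ 0) (hb : A*B*C*D*q^2 = E*F*G) (K : ℕ)
    (hE : poch q E (K+1) ≠ 0) (hF : poch q F (K+1) ≠ 0) (hG : poch q G (K+1) ≠ 0)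
    (hQ : poch q q (K+1) ≠ 0) (hA : B*q^(K+1) = 1) :
    q^2*(F-A)*(F-D)*B*C*(C-B)*S4 q A D (B*q) (C*q) E (F*q) G (K+1)
    = F*(1-F)* (C*(B*q-E)*(B*q-G)*S4 q A D B (C*q) E F G (K+2)
       - B*(C*q-E)*(C*q-G)*S4 q A D (B*q) C E F G (K+1)) := by
  rw [TII_partial q A B C D E F G hq hb K (poch_ne_of_le hE (by omega)) hF (poch_ne_of_le hG (by omega)) (poch_ne_of_le hQ (by omega))]
  have e1 : S4 q A D B (C*q) E F G (K+2) = S4 q A D B (C*q) E F G (K+1)+tm q A D B (C*q) E F G (K+1) := by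
    rw [S4, Finset.sum_range_succ, ← S4]
  have hK : q^K = (B*q)⁻¹ := by
    apply eq_inv_of_mul_eq_one_left; rw [← hA]; ring
  have hB0 : B ≠ 0 := left_ne_zero_of_mul (by rw [hA]; exact one_ne_zero)
  have hBq := mul_ne_zero hB0 hq
  rw [poch_succ] at hE hG hQ
  rw [poch_succ'] at hF
  have t : (1-F)*((B*q-E)*(B*q-G))*tm q A D B (C*q) E F G (K+1)
      = q^2*B*(C-B)*tm q A D (B*q) (C*q) E (F*q) G K *(1-A*q^K)*(1-D*q^K)*(q^K)⁻¹ := by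
    rw [tm, tm, poch_succ q A, poch_succ q D, poch_succ' q B, poch_succ q (C*q), poch_succ q E, poch_succ' q F, poch_succ q G, poch_succ q q, pow_succ]
    have hE1 := left_ne_zero_of_mul hE
    have hF1 := left_ne_zero_of_mul hF
    have hG1 := left_ne_zero_of_mul hG
    have hQ1 := left_ne_zero_of_mul hQ
    have hE2 := right_ne_zero_of_mul hE
    have hF2 := right_ne_zero_of_mul hF
    have hG2 := right_ne_zero_of_mul hG
    have hQ2 := right_ne_zero_of_mul hQ
    rw [hK] at hE2 hG2 hQ2 ⊢
    generalize poch q E K = PE at *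
    generalize poch q (F*q) K = PF at *
    generalize poch q G K = PG at *
    generalize poch q q K = PQ at *
    generalize poch q A K = PA at *
    generalize poch q D K = PD at *
    generalize poch q (B*q) K = PB at *
    generalize poch q (C*q) K = PC at *
    have a1 : B*q-E = B*q*(1-E*(B*q)⁻¹) := by field_simp
    have a2 : B*q-G = B*q*(1-G*(B*q)⁻¹) := by field_simp
    have a3 : 1-B = -B*(1-q*(B*q)⁻¹) := by field_simp; ring
    have a4 : C-B = -B*(1-C*q*(B*q)⁻¹) := by field_simp; ring
    rw [a1, a2, a3, a4, inv_inv]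
    generalize 1-E*(B*q)⁻¹ = X1 at *
    generalize 1-G*(B*q)⁻¹ = X2 at *
    generalize 1-q*(B*q)⁻¹ = X3 at *
    generalize 1-C*q*(B*q)⁻¹ = X4 at *
    generalize 1-A*(B*q)⁻¹ = X5 at *
    generalize 1-D*(B*q)⁻¹ = X6 at *
    generalize 1-F = X7 at *
    field_simp
  rw [e1]
  linear_combination -F*C*t
section
variable {q c0 c1 c2 c3 c4 : ℂ} {N : ℕ}
lemma uv_Wt (h : Hyp q N c0 c1 c2 c3 c4) (y : ℕ) (hy : y ≤ N) :
    uu q (c0*c3) c4 N y*vv q (c0*c3) c1 N N y = Wt q c3 c0 c4 N y*ff q c0 c1 c3 N y := by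
  rw [uu, vv, Wt, ff, JJ, JJ, if_pos hy, if_pos hy, mul_comm c3 c0, Nat.sub_self, poch_zero]
  have p0 : poch q (q*c0) y ≠ 0 := poch_one_ne h.n0 (by omega)
  have p3 : poch q (q*c3) y ≠ 0 := poch_one_ne h.n3 (by omega)
  have p1 : poch q q N ≠ 0 := poch_q_ne h.q1 (by omega)
  have p2 : poch q q (N-y) ≠ 0 := poch_q_ne h.q1 (by omega)
  have p4 : (q*c0)^y ≠ 0 := pow_ne_zero _ (mul_ne_zero h.hq h.h0)
  generalize poch q (q*c0) y = P0 at *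
  generalize poch q (q*c3) y = P3 at *
  generalize poch q q N = P1 at *
  generalize poch q q (N-y) = P2 at *
  generalize (q*c0)^y = P4 at *
  simp only [div_eq_mul_inv, mul_inv]
  generalize (poch q (c0*c3*q^(y+1)) (N+1))⁻¹ = F1
  generalize (poch q q y)⁻¹ = F2
  generalize poch q (c0*c3*c4*q^(N+2)) y = F3
  generalize poch q (c0*c3*c1*q^(N+2)) y = F4
  generalize poch q (q*c4) (N-y) = F5
  generalize poch q (q*c1) (N-y) = F6
  generalize sg q (c0*c3) y = F7
  generalize 1-c0*c3*q^(2*y+1) = F8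
  clear h
  field_simp
lemma rr_step (h : Hyp q (N+1) c0 c1 c2 c3 c4) (b y : ℕ) (hy : y ≤ N) :
    (1-q^(N+1))*q^b*((1-c0*q^(y+1))*(1-c1*q^(N+1-y))*(c0*c3)*q^(y+2)*rr q c1 c3 c0 (N+1) y b
       + q*c0*(1-c3*q^(y+1))*(1-c0*c3*c1*q^(N+3+y))*rr q c1 c3 c0 (N+1) (y+1) b)
     = q*c0*(q^b-q^(N+1))*(1-c1*c3*q*q^b*q^(N+1))*(1-c0*c3*q^(2*y+2))*rr q c1 c3 (q*c0) N y b := by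
  have hq := h.hq
  have pb := pow_ne_zero b hq
  have py := pow_ne_zero y hq
  have pn := pow_ne_zero (N+1) hq
  have t := TIIc q (q^b)⁻¹ (q^(y+1))⁻¹ (c0*c3*q^(y+1)) (c1*c3*q^(b+1)) (q*c3) (q^(N+1))⁻¹ (c0*c1*c3*q^(N+3)) hq
    (by have := pow_ne_zero (y+1) hq
        rw [show q^(N+3) = q^(N+1)*q^2 by ring, pow_succ q b]; field_simp) y
    (poch_one_ne h.n3 (by omega)) (poch_G_ne hq h.q1 (by omega) (by omega))
    (poch_pow_ne h.n013 (by omega) (by omega)) (poch_q_ne h.q1 (by omega)) (inv_mul_cancel₀ (pow_ne_zero _ hq))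
  have e1 : S4 q (q^b)⁻¹ (c1*c3*q^(b+1)) ((q^(y+1))⁻¹*q) (c0*c3*q^(y+1)*q) (q*c3) ((q^(N+1))⁻¹*q) (c0*c1*c3*q^(N+3)) (y+1)
    = rr q c1 c3 (q*c0) N y b := by
    rw [rr, S4_swap, S4_swapFG, i1 hq, i1 hq]; congr 1 <;> ring
  have e2 : S4 q (q^b)⁻¹ (c1*c3*q^(b+1)) (q^(y+1))⁻¹ (c0*c3*q^(y+1)*q) (q*c3) (q^(N+1))⁻¹ (c0*c1*c3*q^(N+3)) (y+2)
    = rr q c1 c3 c0 (N+1) (y+1) b := by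
    rw [rr, S4_swap, S4_swapFG]; congr 1 <;> ring
  have e3 : S4 q (q^b)⁻¹ (c1*c3*q^(b+1)) ((q^(y+1))⁻¹*q) (c0*c3*q^(y+1)) (q*c3) (q^(N+1))⁻¹ (c0*c1*c3*q^(N+3)) (y+1)
    = rr q c1 c3 c0 (N+1) y b := by
    rw [rr, S4_swap, S4_swapFG, i1 hq]; congr 1 <;> ring
  rw [e1, e2, e3, i1 hq] at t
  have e4 : q^(N+1-y) = q^(N+1)*(q^y)⁻¹ := by
    rw [eq_mul_inv_iff_mul_eq₀ py, ← pow_add]; congr 1; omega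
  rw [e4]
  rw [show q^(N+3) = q^(N+1)*q^2 by ring, pow_succ q b, pow_succ q y] at t
  rw [show q^(N+3+y) = q^(N+1)*q^2*q^y by ring, pow_succ q y, show q^(y+2) = q^y*q^2 by ring, show q^(2*y+2) = (q^y)^2*q^2 by ring]
  generalize rr q c1 c3 (q*c0) N y b = R1 at *
  generalize rr q c1 c3 c0 (N+1) (y+1) b = R2 at *
  generalize rr q c1 c3 c0 (N+1) y b = R3 at *
  generalize q^b = Bb at *
  generalize q^y = Y at *
  generalize q^(N+1) = n at *
  have h3 := h.h3
  clear e1 e2 e3 e4 h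
  have : q*c0*(Bb-n)*(1-c1*c3*q*Bb*n)*(1-c0*c3*(Y^2*q^2))*R1 = -(n^2*Bb*Y*c3⁻¹)*(q^2*(n⁻¹-Bb⁻¹)*(n⁻¹-c1*c3*(Bb*q))*(Y*q)⁻¹*(c0*c3*(Y*q))*(c0*c3*(Y*q)-(Y*q)⁻¹)*R1) := by
    field_simp; ring
  rw [this, t]
  field_simp; ring
end
end qR
namespace qR
section
variable {q c0 c1 c2 c3 c4 : ℂ} {N : ℕ}
lemma ff_succ (h : Hyp q (N+1) c0 c1 c2 c3 c4) (y : ℕ) (hy : y ≤ N) :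
    ff q c0 c1 c3 (N+1) (y+1)*((c0*c3)*q^(y+2)*(1-c0*q^(y+1))*(1-c1*q^(N+1-y)))
     = -(ff q c0 c1 c3 (N+1) y*(q*c0*(1-c3*q^(y+1))*(1-c0*c3*c1*q^(N+3+y)))) := by
  have d0 := one_sub_ne h.n0 (k := y+1) (by omega) (by omega)
  have dd : (c0*c3)*q^(y+2) ≠ 0 := mul_ne_zero (mul_ne_zero h.h0 h.h3) (pow_ne_zero _ h.hq)
  have e : poch q (q*c1) (N+1-y) = poch q (q*c1) (N-y)*(1-c1*q^(N+1-y)) := by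
    rw [show N+1-y = N-y+1 by omega, poch_succ]; ring
  rw [ff, ff, Nat.add_sub_add_right, e, sg_succ, poch_succ q (q*c3), poch_succ q (q*c0), poch_succ q (c0*c3*c1*q^(N+1+2)),
    show c0*c3*c1*q^(N+1+2)*q^y = c0*c3*c1*q^(N+3+y) by ring, show q*c0*q^y = c0*q^(y+1) by ring, show q*c3*q^y = c3*q^(y+1) by ring, pow_succ (q*c0),
    show -(c0*c3)*q^(y+2) = -((c0*c3)*q^(y+2)) by ring, inv_neg]
  generalize (c0*c3)*q^(y+2) = D at *
  simp only [div_eq_mul_inv, mul_inv]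
  have i0 := inv_mul_cancel₀ d0
  have i1 := inv_mul_cancel₀ dd
  generalize D⁻¹ = I1 at *
  generalize (1-c0*q^(y+1))⁻¹ = I0 at *
  generalize 1-c0*q^(y+1) = D0 at *
  generalize (poch q (q*c0) y)⁻¹ = F1
  generalize (poch q q (N+1))⁻¹ = F2
  generalize (q*c0)^y = F3
  generalize poch q (c0*c3*c1*q^(N+1+2)) y = F4
  generalize 1-c1*q^(N+1-y) = F5
  generalize 1-c3*q^(y+1) = F6
  generalize 1-c0*c3*c1*q^(N+3+y) = F7
  generalize sg q (c0*c3) y = F8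
  generalize poch q (q*c3) y = F9
  generalize poch q (q*c1) (N-y) = F10
  clear h e
  linear_combination -(F1*F2*F3*F4*F5*F6*F7*F8*F9*F10*q*c0)*(I0*D0*i1+i0)
lemma sg_q (q d : ℂ) (hq : q ≠ 0) (y : ℕ) : sg q (q*d) y*q^y = sg q d y := by
  induction y with
  | zero => simp [sg_zero]
  | succ y ih =>
    rw [sg_succ, sg_succ, ← ih, show -(q*d)*q^(y+2) = q*(-d*q^(y+2)) by ring, mul_inv, pow_succ]
    linear_combination (sg q (q*d) y*q^y*(-d*q^(y+2))⁻¹)*(mul_inv_cancel₀ hq)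
lemma ff_low (h : Hyp q (N+1) c0 c1 c2 c3 c4) (y : ℕ) (hy : y ≤ N) :
    ff q (q*c0) c1 c3 N y*((1-c0*q^(y+1))*(1-c1*q^(N+1-y)))
     = ff q c0 c1 c3 (N+1) y*((1-q*c0)*(1-q^(N+1))) := by
  have e : poch q (q*c1) (N+1-y) = poch q (q*c1) (N-y)*(1-c1*q^(N+1-y)) := by
    rw [show N+1-y = N-y+1 by omega, poch_succ]; ring
  have s := poch_shift q (q*c0) y
  have p0 : poch q (q*c0) y ≠ 0 := poch_one_ne h.n0 (by omega)
  have p1 : poch q (q*c0) (y+1) ≠ 0 := poch_one_ne h.n0 (by omega)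
  rw [poch_succ'] at p1
  have p2 := right_ne_zero_of_mul p1
  have d := one_sub_q_ne h.q1 (k := N+1) (by omega) (by omega)
  have p3 : poch q q N ≠ 0 := poch_q_ne h.q1 (by omega)
  rw [ff, ff, e, mul_assoc q c0 c3, ← sg_q q (c0*c3) h.hq, show q*(q*c0) = q*c0*q by ring, mul_pow (q*c0) q, poch_succ q q, ← pow_succ',
    show q*(c0*c3)*c1*q^(N+2) = c0*c3*c1*q^(N+1+2) by ring]
  rw [show q*c0*q^y = c0*q^(y+1) by ring] at s
  generalize poch q (q*c0) y = P0 at *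
  generalize poch q (q*c0*q) y = P1 at *
  generalize poch q q N = P2 at *
  generalize poch q (q*c3) y = F1
  generalize poch q (q*c1) (N-y) = F2
  generalize poch q (c0*c3*c1*q^(N+1+2)) y = F3
  generalize 1-c1*q^(N+1-y) = F4
  generalize sg q (q*(c0*c3)) y = F5
  generalize (q*c0)^y = F6
  generalize q^y = F7
  generalize 1-c0*q^(y+1) = F8 at *
  generalize 1-q^(N+1) = F9 at *
  clear h e
  simp only [div_eq_mul_inv, mul_inv]
  have i0 := inv_mul_cancel₀ p0
  have i1 := inv_mul_cancel₀ p2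
  have i2 := inv_mul_cancel₀ d
  generalize P0⁻¹ = I0 at *
  generalize P1⁻¹ = I1 at *
  generalize F9⁻¹ = I9 at *
  have key : I1*F8 = I0*(1-q*c0) := by
    linear_combination (-I0*I1)*s+I0*(1-q*c0)*i1-I1*F8*i0
  linear_combination (F5*F6*F7*F1*F2*F3*P2⁻¹*F4)*(key-I0*(1-q*c0)*i2)
lemma term_step (h : Hyp q (N+1) c0 c1 c2 c3 c4) (b y : ℕ) (hy : y ≤ N) :
    (1-q^(N+1))^2*(1-q*c0)*q^b*(c3*q)*(bt q c3 c0 c4 N y*(ff q c0 c1 c3 (N+1) y*rr q c1 c3 c0 (N+1) y b-ff q c0 c1 c3 (N+1) (y+1)*rr q c1 c3 c0 (N+1) (y+1) b))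
     = (q^b-q^(N+1))*(1-c1*c3*q*q^b*q^(N+1))*(uu q (q*c0*c3) (q*c4) N y*vv q (q*c0*c3) c1 N N y*rr q c1 c3 (q*c0) N y b) := by
  rw [uv_Wt h.low04 y hy]
  have w := Wt_bt h.hq c3 c0 c4 N y
  have r := rr_step h b y hy
  have f1 := ff_succ h y hy
  have f2 := ff_low h y hy
  have d0 := one_sub_ne h.n0 (k := y+1) (by omega) (by omega)
  have d1 := one_sub_ne h.n1 (k := N+1-y) (by omega) (by omega)
  have py := pow_ne_zero y h.hq
  apply mul_left_cancel₀ (mul_ne_zero (mul_ne_zero (mul_ne_zero h.h0 h.hq) py) (mul_ne_zero d0 d1))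
  rw [mul_comm c3 c0] at w
  rw [show q^(y+2) = q*q*q^y by ring] at r f1
  generalize Wt q c3 (q*c0) (q*c4) N y = W at *
  generalize bt q c3 c0 c4 N y = T at *
  generalize ff q c0 c1 c3 (N+1) y = F1 at *
  generalize ff q c0 c1 c3 (N+1) (y+1) = F2 at *
  generalize ff q (q*c0) c1 c3 N y = F3 at *
  generalize rr q c1 c3 c0 (N+1) y b = R1 at *
  generalize rr q c1 c3 c0 (N+1) (y+1) b = R2 at *
  generalize rr q c1 c3 (q*c0) N y b = R3 at *
  generalize 1-c0*q^(y+1) = D0 at *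
  generalize 1-c1*q^(N+1-y) = D1 at *
  generalize 1-c1*c3*q*q^b*q^(N+1) = D2 at *
  generalize 1-c0*c3*q^(2*y+2) = D3 at *
  generalize 1-c3*q^(y+1) = D4 at *
  generalize 1-c0*c3*c1*q^(N+3+y) = D5 at *
  generalize 1-q*c0 = D6 at *
  generalize hn : 1-q^(N+1) = n at *
  generalize q^b-q^(N+1) = m at *
  clear h hn
  linear_combination n*D6*T*F1*r-(n^2*D6*q^b*T*R2)*f1-T*q*c0*m*D2*D3*R3*f2-q*c0*m*D2*R3*F3*D0*D1*w
end
end qR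
namespace qR
section
variable {q c0 c1 c2 c3 c4 : ℂ} {N : ℕ}
lemma PL_00 (h : Hyp q (N+1) c0 c1 c2 c3 c4) (j b : ℕ) (hj : j ≤ N) :
    (1-q^(N+1))^2*(1-q*c0)*q^b*(c3*q)*PL q c0 c1 c2 c3 c4 (N+1) (j+1) 0 0 b
     = (1-q*c4)*((q^b-q^(N+1))*(1-c1*c3*q*q^b*q^(N+1)))*PL q (q*c0) c1 c2 c3 (q*c4) N j 0 0 b := by
  have o := O_full (c1 := c3) (c2 := c0) (c3 := c4) h.hq h.h3 h.h0 N j hj h.q1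
    (fun k i1 i2 => ⟨h.n3 k i1 (by omega), h.n0 k i1 (by omega), h.n4 k i1 (by omega),
      by rw [mul_comm c3]; exact h.n03 k i1 (by omega),
      by simpa using h.u 1 0 0 0 1 k (by omega) i1 (by omega),
      by simpa using h.u 0 0 0 1 1 k (by omega) i1 (by omega),
      by rw [mul_comm c3]; simpa using h.u 1 0 0 1 1 k (by omega) i1 (by omega)⟩)
    (fun y => ff q c0 c1 c3 (N+1) y*rr q c1 c3 c0 (N+1) y b)
  have e1 : PL q c0 c1 c2 c3 c4 (N+1) (j+1) 0 0 b = ∑ x ∈ Finset.range (N+2), Wt q c3 c0 c4 (N+1) x*rr q c3 c0 c4 (N+1) (j+1) x*(ff q c0 c1 c3 (N+1) x*rr q c1 c3 c0 (N+1) x b) := by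
    apply Finset.sum_congr rfl
    intro y hy
    have := uv_Wt h y (by have := Finset.mem_range.1 hy; omega)
    rw [Psi, rr_zero_left, Nat.sub_zero]
    linear_combination (rr q c3 c0 c4 (N+1) (j+1) y*rr q c1 c3 c0 (N+1) y b)*this
  rw [e1, o, PL]
  simp only [Finset.mul_sum]
  apply Finset.sum_congr rfl
  intro y hy
  have := term_step h b y (by have := Finset.mem_range.1 hy; omega)
  rw [Psi, rr_zero_left, Nat.sub_zero]
  linear_combination ((1-q*c4)*rr q c3 (q*c0) (q*c4) N j y)*this
lemma step00 (h : Hyp q (N+1) c0 c1 c2 c3 c4) (j b : ℕ) (hj : j ≤ N) (hb : b ≤ N+1)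
    (IH : b ≤ N → PL q (q*c0) c1 c2 c3 (q*c4) N j 0 0 b
      = kj q (q*c0) (q*c4) j*hf q c1 c2 c3 (q*c4) N 0 0 b*Psi q (q*c0) c2 c1 (q*c4) c3 N 0 b 0 j) :
    PL q c0 c1 c2 c3 c4 (N+1) (j+1) 0 0 b
      = kj q c0 c4 (j+1)*hf q c1 c2 c3 c4 (N+1) 0 0 b*Psi q c0 c2 c1 c4 c3 (N+1) 0 b 0 (j+1) := by
  have m := PL_00 h j b hj
  have dn := one_sub_q_ne h.q1 (k := N+1) (by omega) (by omega)
  have d0 : 1-q*c0 ≠ 0 := by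
    have := one_sub_ne h.n0 (k := 1) (by omega) (by omega)
    rwa [pow_one, mul_comm] at this
  have pb := pow_ne_zero b h.hq
  have nz : (1-q^(N+1))^2*(1-q*c0)*q^b*(c3*q) ≠ 0 :=
    mul_ne_zero (mul_ne_zero (mul_ne_zero (pow_ne_zero _ dn) d0) pb) (mul_ne_zero h.h3 h.hq)
  apply mul_left_cancel₀ nz
  rw [m]
  rcases Nat.lt_or_ge N b with hb' | hb'
  · obtain rfl : b = N+1 := by omega
    rw [Psi, vv_zero (by omega), sub_self]; ring
  rw [IH hb', Psi, Psi, rr_zero_left, rr_zero_left, rr_zero_right h.hq, rr_zero_right h.hq]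
  have r1 : kj q c0 c4 (j+1)*((1-q*c0)*(c4*q)) = -((1-q*c4)*kj q (q*c0) (q*c4) j) := by
    rw [kj, kj, poch_succ', poch_succ' q (q*c0), kk_succ', show q*(q*c4) = q*c4*q by ring, show q*(q*c0) = q*c0*q by ring]
    have h4 := h.h4
    have hq := h.hq
    rw [show -c4*q = -(c4*q) by ring]
    have i2 := inv_mul_cancel₀ (mul_ne_zero h4 hq)
    generalize c4*q = w at *
    simp only [div_eq_mul_inv, mul_inv, inv_neg]
    have i1 := inv_mul_cancel₀ d0
    generalize (1-q*c0)⁻¹ = I1 at *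
    generalize w⁻¹ = I2 at *
    generalize (kk q _ j)⁻¹ = F1
    generalize (poch q _ j)⁻¹ = F2
    generalize poch q _ j = F3
    linear_combination -((1-q*c4)*F3*F2*F1)*(i1*(I2*w)+i2)
  have r2 : hf q c1 c2 c3 c4 (N+1) 0 0 b*(1-q^(N+1))^2 = (c1*c4*q^(N+1+1))*((q^b-q^(N+1))*hf q c1 c2 c3 (q*c4) N 0 0 b) := by
    have e : poch q q (N+1-b) = poch q q (N-b)*(1-q*q^(N-b)) := by
      rw [show N+1-b = N-b+1 by omega, poch_succ]
    have e2 : q^(N+1) = q^b*(q*q^(N-b)) := by rw [← pow_succ', ← pow_add]; congr 1; omega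
    have p3 : poch q q N ≠ 0 := poch_q_ne h.q1 (by omega)
    rw [hf, hf, fx, fx, fx, fx, fb, fb, show c1*(q*c4)*q^(N+1) = c1*c4*q^(N+1+1) by ring, Nat.sub_zero, Nat.sub_zero, e,
      show c2*c3*q^(N+1+1) = c2*c3*q^(N+1)*q by ring, mul_pow (c2*c3*q^(N+1)) q b, poch_succ q q, ← pow_succ', pow_succ _ N]
    simp only [poch_zero, pow_zero, one_mul]
    have e3 : q^b*(1-q*q^(N-b)) = q^b-q^(N+1) := by rw [e2]; ring
    rw [← e3]
    generalize c1*c4*q^(N+1+1) = A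
    generalize 1-q^(N+1) = n at *
    generalize poch q q N = P at *
    generalize poch q q (N-b) = F1 at *
    generalize poch q (q*c1) b = F2 at *
    generalize 1-q*q^(N-b) = F3 at *
    generalize q^b = F4 at *
    generalize (c2*c3*q^(N+1))^b = F5 at *
    simp only [div_eq_mul_inv, mul_inv]
    generalize (poch q (q*c3) b)⁻¹ = F6 at *
    have i := inv_mul_cancel₀ dn
    generalize n⁻¹ = I at *
    linear_combination (A^N*A*P⁻¹^2*F5*F4*F2*F1*F3*F6)*(I*n+1)*i
  have r3 : vv q (c0*c4) c2 (N+1) (N+1-b) (j+1)*(c1*c3*q*q^b*q^(N+1)) = -(1-c1*c3*q*q^b*q^(N+1))*vv q (q*c0*(q*c4)) c2 N (N-b) j := by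
    rw [vv, vv, Nat.add_sub_add_right, JJ, JJ, show N+1-(N+1-b) = b by omega, show N-(N-b) = b by omega, poch_succ' q (c0*c4*c2*q^(N+1-b+2)),
      show N+1-b = N-b+1 by omega, Nat.add_sub_add_right, show c0*c4*q^(j+1+(N-b+1)+2) = q*c0*(q*c4)*q^(j+(N-b)+2) by ring,
      show c0*c4*c2*q^(N-b+1+2)*q = q*c0*(q*c4)*c2*q^(N-b+2) by ring]
    simp only [Nat.add_le_add_iff_right]
    have e : c0*c4*c2*q^(N-b+1+2)*(c1*c3*q*q^b*q^(N+1)) = 1 := by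
      obtain ⟨z, rfl⟩ := Nat.exists_eq_add_of_le hb'
      rw [← h.con, show b+z-b = z by omega]; ring
    generalize (if j ≤ N-b then poch q (q*c2) (N-b-j)/poch q q (N-b-j) else 0) = J
    linear_combination -(poch q q (N-j)*poch q (q*c0*(q*c4)*q^(j+(N-b)+2)) b*J*poch q (q*c0*(q*c4)*c2*q^(N-b+2)) j)*e
  have nz2 : c1*c3*q*q^b*q^(N+1)*(c4*q) ≠ 0 := by
    have := h.h1; have := h.h3; have := h.h4; have := h.hq
    simp [*]
  apply mul_left_cancel₀ nz2
  rw [pow_succ q (N+1)] at r2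
  generalize vv q (c0*c4) c2 (N+1) (N+1-b) (j+1) = V1 at *
  generalize vv q (q*c0*(q*c4)) c2 N (N-b) j = V2 at *
  generalize hf q c1 c2 c3 c4 (N+1) 0 0 b = H1 at *
  generalize hf q c1 c2 c3 (q*c4) N 0 0 b = H2 at *
  generalize kj q c0 c4 (j+1) = K1 at *
  generalize kj q (q*c0) (q*c4) j = K2 at *
  generalize q^b-q^(N+1) = m at *
  generalize q^(N+1) = n at *
  generalize q^b = B at *
  generalize hD : 1-c1*c3*q*B*n = D at *
  clear hD m IH
  linear_combination -(B*c3*q*H1*V1*(1-n)^2*(c1*c3*q*B*n))*r1+(B*c3*q*(1-q*c4)*K2*V1*(c1*c3*q*B*n))*r2+((1-q*c4)*K2*(c1*c4*(n*q))*m*H2*B*c3*q)*r3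
end
end qR
namespace qR
lemma hh_one (q v : ℂ) (k : ℕ) : hh q 1 v k = poch q v k := rfl
lemma sg_kk {q d : ℂ} (hq : q ≠ 0) (hd : d ≠ 0) (n : ℕ) : sg q d n*kk q d n*q^n = 1 := by
  induction n with
  | zero => simp [sg_zero, kk_zero]
  | succ n ih =>
    have h0 : -d*q^(n+2) ≠ 0 := mul_ne_zero (neg_ne_zero.2 hd) (pow_ne_zero _ hq)
    have h1 := inv_mul_cancel₀ h0
    rw [sg_succ, kk_succ]
    generalize (-d*q^(n+2))⁻¹ = I at *
    linear_combination (sg q d n*kk q d n*q^n)*h1+ih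
section
variable {q c0 c1 c2 c3 c4 : ℂ} {N : ℕ}
lemma PL_base (h : Hyp q N c0 c1 c2 c3 c4) :
    PL q c0 c1 c2 c3 c4 N 0 0 0 0
      = kj q c0 c4 0*hf q c1 c2 c3 c4 N 0 0 0*Psi q c0 c2 c1 c4 c3 N 0 0 0 0 := by
  have s := sum65 q (c0*c3) 1 h.hq (mul_ne_zero h.h0 h.h3) N (q*c4) (q*c1) h.q1 (fun k a b => h.n03 k a (by omega))
  have p3 : poch q q N ≠ 0 := poch_q_ne h.q1 le_rfl
  have e : PL q c0 c1 c2 c3 c4 N 0 0 0 0 = ∑ y ∈ Finset.range (N+1), (1-c0*c3*q^(2*y+1))*e65 q (c0*c3) 1 (q*c4) (q*c1) N y := by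
    apply Finset.sum_congr rfl
    intro y hy
    have hy : y ≤ N := by have := Finset.mem_range.1 hy; omega
    have p2 : poch q q (N-y) ≠ 0 := poch_q_ne h.q1 (by omega)
    rw [Psi, rr_zero_left, rr_zero_left, rr_zero_right h.hq, Nat.sub_zero, uu, vv, JJ, JJ, if_pos hy, if_pos hy, Nat.sub_self, poch_zero, e65, hh_one, hh_one,
      show c0*c3*q^(N+1)*(q*c4) = c0*c3*c4*q^(N+2) by ring, show c0*c3*q^(N+1)*(q*c1) = c0*c3*c1*q^(N+2) by ring]
    generalize poch q q (N-y) = P at *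
    simp only [div_eq_mul_inv, mul_inv]
    have i := inv_mul_cancel₀ p2
    generalize P⁻¹ = I at *
    generalize poch q (c0*c3*c4*q^(N+2)) y = F1
    generalize poch q (c0*c3*c1*q^(N+2)) y = F2
    generalize poch q (q*c4) (N-y) = F3
    generalize poch q (q*c1) (N-y) = F4
    generalize (poch q q y)⁻¹ = F5
    generalize (poch q (c0*c3*q^(y+1)) (N+1))⁻¹ = F6
    linear_combination (sg q (c0*c3) y*(1-c0*c3*q^(2*y+1))*F1*F2*F3*F4*F5*F6*I)*i
  rw [e, s, hh_one]
  have r := poch_rev h.hq (c0*c3*(c1*c4*q^(N+2))) N (q*c2) (by rw [← h.con]; ring)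
  rw [kk_mul] at r
  rw [show c0*c3*(q*c4)*(q*c1)*q^(N+1) = c0*c3*(c1*c4*q^(N+2))*q by ring, r, Psi, rr_zero_left, rr_zero_left, vv, kj, hf, fx, fx, fb, JJ, if_pos (by omega)]
  simp only [Nat.sub_zero, poch_zero, pow_zero, kk_zero, Nat.sub_self]
  have k := sg_kk h.hq (mul_ne_zero h.h0 h.h3) N
  rw [show c1*c4*q^(N+2) = c1*c4*q^(N+1)*q by ring, mul_pow _ q N]
  generalize (c1*c4*q^(N+1))^N = A at *
  generalize poch q q N = P at *
  field_simp
  linear_combination (A*poch q (q*c2) N)*k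
end
theorem Pmain (q : ℂ) (N : ℕ) : ∀ (c0 c1 c2 c3 c4 : ℂ), Hyp q N c0 c1 c2 c3 c4 → ∀ j a x b, j+a ≤ N → x+b ≤ N →
    PL q c0 c1 c2 c3 c4 N j a x b = kj q c0 c4 j*hf q c1 c2 c3 c4 N a x b*Psi q c0 c2 c1 c4 c3 N a b x j := by
  induction N with
  | zero =>
    intro c0 c1 c2 c3 c4 h j a x b h1 h2
    obtain rfl : j = 0 := by omega
    obtain rfl : a = 0 := by omega
    obtain rfl : x = 0 := by omega
    obtain rfl : b = 0 := by omega
    exact PL_base h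
  | succ N ih =>
    have sA : ∀ (c0 c1 c2 c3 c4 : ℂ), Hyp q (N+1) c0 c1 c2 c3 c4 → ∀ j a x b, j+(a+1) ≤ N+1 → x+b ≤ N+1 →
       PL q c0 c1 c2 c3 c4 (N+1) j (a+1) x b = kj q c0 c4 j*hf q c1 c2 c3 c4 (N+1) (a+1) x b*Psi q c0 c2 c1 c4 c3 (N+1) (a+1) b x j :=
      fun c0 c1 c2 c3 c4 h j a x b h1 h2 => stepA h j a x b (by omega) h2
        (fun x b hxb => ih _ _ _ _ _ h.low12 j a x b (by omega) hxb)
    have s0 : ∀ (c0 c1 c2 c3 c4 : ℂ), Hyp q (N+1) c0 c1 c2 c3 c4 → ∀ j b, j+1 ≤ N+1 → b ≤ N+1 →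
       PL q c0 c1 c2 c3 c4 (N+1) (j+1) 0 0 b = kj q c0 c4 (j+1)*hf q c1 c2 c3 c4 (N+1) 0 0 b*Psi q c0 c2 c1 c4 c3 (N+1) 0 b 0 (j+1) :=
      fun c0 c1 c2 c3 c4 h j b h1 h2 => step00 h j b (by omega) h2
        (fun hb => ih _ _ _ _ _ h.low04 j 0 0 b (by omega) (by omega))
    intro c0 c1 c2 c3 c4 h j a x b h1 h2
    rcases a with _ | a
    · rcases x with _ | x
      · rcases j with _ | j
        · rcases b with _ | b
          · exact PL_base h
          · rw [PL_refl h _ _ _ _ (by omega) (by omega), H_refl h _ _ _ _ (by omega) (by omega)]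
            exact s0 _ _ _ _ _ h.refl b 0 (by omega) (by omega)
        · exact s0 _ _ _ _ _ h j b (by omega) (by omega)
      · rw [PL_refl h _ _ _ _ (by omega) (by omega), H_refl h _ _ _ _ (by omega) (by omega)]
        exact sA _ _ _ _ _ h.refl b x 0 j (by omega) (by omega)
    · exact sA _ _ _ _ _ h j a x b h1 h2
end qR
namespace qR
def pp (q σ c1 c2 c3 : ℂ) (N n x : ℕ) : ℂ :=
  if n ≤ N ∧ x ≤ N then Wt q c3 c2 c1 N n*σ^N*rr q c1 c2 c3 N n x else 0
lemma pp_pos {q σ c1 c2 c3 : ℂ} {N n x : ℕ} (h1 : n ≤ N) (h2 : x ≤ N) :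
    pp q σ c1 c2 c3 N n x = Wt q c3 c2 c1 N n*σ^N*rr q c1 c2 c3 N n x := if_pos ⟨h1, h2⟩
lemma pp_neg {q σ c1 c2 c3 : ℂ} {N n x : ℕ} (h : N < n ∨ N < x) :
    pp q σ c1 c2 c3 N n x = 0 := if_neg (by omega)
lemma p_pp {q s c1 c2 c3 t2 : ℂ} (hq : q ≠ 0) (hc : c2 ≠ 0) (hs : s^2 = q) (ht : t2^2 = c2) (N n x : ℕ) :
    p q s c1 c2 c3 t2 (N:ℤ) (n:ℤ) (x:ℤ) = pp q (s*t2) c1 c2 c3 N n x := by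
  have s0 : s*t2 ≠ 0 := by
    intro h; apply mul_ne_zero hq hc; rw [← hs, ← ht, ← mul_pow, h]; simp
  by_cases h : n ≤ N ∧ x ≤ N
  · rw [pp_pos h.1 h.2, p, if_pos (by omega), Om, binom, if_pos (by omega)]
    have e1 : ((N:ℤ)-n).toNat = N-n := by omega
    have e2 : ((N:ℤ)+1).toNat = N+1 := by omega
    have e3 : (s*t2)^(2*(n:ℤ)-N) = (q*c2)^n/(s*t2)^N := by
      rw [zpow_sub₀ s0, ← hs, ← ht, ← mul_pow, ← pow_mul]
      norm_cast
    have z1 : q^(2*(n:ℤ)+1) = q^(2*n+1) := by norm_cast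
    have z2 : q^((N:ℤ)+2) = q^(N+2) := by norm_cast
    have z3 : q^((n:ℤ)+1) = q^(n+1) := by norm_cast
    have z4 : q^((x:ℤ)+1) = q^(x+1) := by norm_cast
    simp only [e1, e2, e3, z1, z2, z3, z4, Int.toNat_natCast, zpow_neg, zpow_natCast]
    congr 1
    · rw [Wt, show c3*c2 = c2*c3 by ring, show c2*c3*c1 = c1*c2*c3 by ring]
      simp only [div_eq_mul_inv, mul_inv, inv_inv]
      ring
  · rw [pp_neg (by omega), p, if_neg (by omega)]
lemma om_kk (q r : ℂ) (hq : q ≠ 0) (n : ℕ) : om q r (n:ℤ) = kk q r n := by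
  have : ((n:ℤ)*((n:ℤ)+1)/2) = ((n*(n+1)/2 : ℕ) : ℤ) := by norm_cast
  rw [om, this]
  simp only [zpow_natCast]
  clear this
  induction n with
  | zero => simp [kk_zero]
  | succ n ih =>
    rw [kk_succ, ← ih, show (n+1)*(n+1+1)/2 = n*(n+1)/2+(n+1) by
      rw [show (n+1)*(n+1+1) = n*(n+1)+(n+1)*2 by ring, Nat.add_mul_div_right _ _ (by norm_num)]]
    ring
lemma Wt_symm {q c1 c2 c3 : ℂ} {N a : ℕ} (hq : q ≠ 0) (h1 : c1 ≠ 0) (h2 : c2 ≠ 0)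
    (p1 : poch q (q*c1) a ≠ 0) (p2 : poch q (q*c2) a ≠ 0) :
    ww q c1 c2 a*Wt q c2 c1 c3 N a = ww q c2 c1 a*Wt q c1 c2 c3 N a := by
  have k1 := kk_mul q 1 c1 a
  have k2 := kk_mul q 1 c2 a
  rw [one_mul] at k1 k2
  rw [ww, ww, Wt, Wt, k1, k2, mul_comm c2 c1, mul_pow, mul_pow]
  have r1 : c1^a ≠ 0 := pow_ne_zero _ h1
  have r2 : c2^a ≠ 0 := pow_ne_zero _ h2
  simp only [div_eq_mul_inv, mul_inv]
  have i1 := inv_mul_cancel₀ r1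
  have i2 := inv_mul_cancel₀ r2
  have i3 := inv_mul_cancel₀ p1
  have i4 := inv_mul_cancel₀ p2
  generalize c1^a = C1 at *
  generalize c2^a = C2 at *
  generalize poch q (q*c1) a = P1 at *
  generalize poch q (q*c2) a = P2 at *
  generalize C1⁻¹ = I1 at *
  generalize C2⁻¹ = I2 at *
  generalize P1⁻¹ = I3 at *
  generalize P2⁻¹ = I4 at *
  have : C1*P2*I3*P1*I1*I4 = C2*P1*I4*P2*I2*I3 := by
    linear_combination (P2*I3*P1*I4)*(i1-i2)
  linear_combination (kk q 1 a*poch q q N*poch q (q*c3) (N-a)*(1-c1*c2*q^(2*a+1))*poch q (c1*c2*c3*q^(N+2)) a*(poch q q a)⁻¹*(poch q q (N-a))⁻¹*(q^a)⁻¹*(poch q (c1*c2*q^(a+1)) (N+1))⁻¹)*this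
lemma O_pp {q σ c1 c2 c3 : ℂ} {M N : ℕ} (hq : q ≠ 0) (hM : M ≤ N) (h1 : c1 ≠ 0) (h2 : c2 ≠ 0)
    (hσ : σ^2 = q*c2) (q1 : ∀ k, 1 ≤ k → k ≤ N → q^k ≠ 1) (g : Gen3 q (2*N+2) c1 c2 c3) (n m : ℕ) :
    ∑ x ∈ Finset.range (N+1), pp q σ c1 c2 c3 M n x*pp q σ c3 c2 c1 M x m
      = if n = m ∧ n ≤ M then 1 else 0 := by
  by_cases hn : n ≤ M ∧ m ≤ M
  swap
  · rw [if_neg (by omega)]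
    apply Finset.sum_eq_zero
    intro x _
    rcases (by omega : M < n ∨ M < m) with h | h
    · rw [pp_neg (Or.inl h), zero_mul]
    · rw [pp_neg (n := x) (Or.inr h), mul_zero]
  have e := O_rr hq M c1 c2 c3 h1 h2 (fun k a b => q1 k a (by omega)) (Gen3_mono g (by omega)) n m hn.1 hn.2
  have : (if n = m ∧ n ≤ M then (1:ℂ) else 0) = if n = m then 1 else 0 := by
    simp [hn.1]
  rw [this, ← e]
  symm
  rw [Finset.mul_sum]
  rw [← Finset.sum_subset (Finset.range_subset_range.2 (by omega : M+1 ≤ N+1))]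
  · apply Finset.sum_congr rfl
    intro x hx
    have hx : x ≤ M := by have := Finset.mem_range.1 hx; omega
    rw [pp_pos hn.1 hx, pp_pos hx hn.2, ← hσ, rr_dual hq c3 c2 c1 M x m, ← pow_mul, mul_comm 2 M, pow_mul]
    ring
  · intro x _ hx
    rw [pp_neg (x := x), zero_mul]
    simp at hx; omega
lemma R_pp {q s t1 t2 t3 c1 c2 c3 : ℂ} {M N : ℕ} (hq : q ≠ 0) (hM : M ≤ N) (h1 : c1 ≠ 0) (h2 : c2 ≠ 0) (h3 : c3 ≠ 0)
    (e3 : t3^2 = c3) (q1 : ∀ k, 1 ≤ k → k ≤ N → q^k ≠ 1) (g : Gen3 q (2*N+2) c1 c2 c3) (i b : ℕ) :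
    ww q c2 c3 i*ww q c3 c1 b*∑ a ∈ Finset.range (N+1), ww q c1 c2 a*(pp q (s*t2) c1 c2 c3 M i a*pp q (s*t1) c3 c1 c2 M a b)
      = kk q (s*t1*t2*t3) M*pp q (s*t3) c1 c3 c2 M i b := by
  by_cases hn : i ≤ M ∧ b ≤ M
  swap
  · rw [pp_neg (N := M) (n := i) (x := b) (by omega), mul_zero]
    apply mul_eq_zero_of_right
    apply Finset.sum_eq_zero
    intro x _
    rcases (by omega : M < i ∨ M < b) with h | h
    · rw [pp_neg (Or.inl h), zero_mul, mul_zero]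
    · rw [pp_neg (n := x) (Or.inr h), mul_zero, mul_zero]
  have e := R_rr hq M c1 c2 c3 h1 h2 h3 (fun k a b => q1 k a (by omega)) (Gen3_mono g (by omega)) i b hn.1 hn.2
  have n1 : ∀ a, a ≤ M → poch q (q*c1) a ≠ 0 := fun a ha => poch_one_ne (M := M) (fun k k1 k2 => (g k k1 (by omega)).1) ha
  have n2 : ∀ a, a ≤ M → poch q (q*c2) a ≠ 0 := fun a ha => poch_one_ne (M := M) (fun k k1 k2 => (g k k1 (by omega)).2.1) ha
  have n3 : ∀ a, a ≤ M → poch q (q*c3) a ≠ 0 := fun a ha => poch_one_ne (M := M) (fun k k1 k2 => (g k k1 (by omega)).2.2.1) ha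
  have eS : ∑ a ∈ Finset.range (N+1), ww q c1 c2 a*(pp q (s*t2) c1 c2 c3 M i a*pp q (s*t1) c3 c1 c2 M a b)
     = Wt q c3 c2 c1 M i*(s*t2)^M*(s*t1)^M*RS q c1 c2 c3 M i b := by
    rw [RS, Finset.mul_sum]
    rw [← Finset.sum_subset (Finset.range_subset_range.2 (by omega : M+1 ≤ N+1))]
    · apply Finset.sum_congr rfl
      intro a ha
      have ha : a ≤ M := by have := Finset.mem_range.1 ha; omega
      rw [pp_pos hn.1 ha, pp_pos ha hn.2, rr_dual hq c3 c1 c2 M a b]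
      linear_combination (Wt q c3 c2 c1 M i*(s*t2)^M*(s*t1)^M*(rr q c1 c2 c3 M i a*rr q c2 c1 c3 M b a))*Wt_symm (c3 := c3) (N := M) hq h1 h2 (n1 a ha) (n2 a ha)
    · intro x _ hx
      rw [pp_neg (x := x), zero_mul, mul_zero]
      simp at hx; omega
  have hk : (s*t2)^M*(s*t1)^M*kk q c3 M = kk q (s*t1*t2*t3) M*(s*t3)^M := by
    have k1 := kk_mul q 1 c3 M
    have k2 := kk_mul q 1 (s*t1*t2*t3) M
    rw [one_mul] at k1 k2
    rw [k1, k2, ← e3]; ring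
  have hw := Wt_symm (c3 := c1) (N := M) hq h2 h3 (n2 i hn.1) (n3 i hn.1)
  rw [eS, pp_pos hn.1 hn.2]
  linear_combination (ww q c3 c1 b*(s*t2)^M*(s*t1)^M*RS q c1 c2 c3 M i b)*hw+(Wt q c2 c3 c1 M i*(s*t2)^M*(s*t1)^M)*e+(Wt q c2 c3 c1 M i*rr q c1 c3 c2 M i b)*hk
end qR
namespace qR
lemma sg_aux {q d e c4 : ℂ} {N : ℕ} (hq : q ≠ 0) (hd : d ≠ 0) (hc : d*e*c4*q^(2*N+3) = 1) (a y : ℕ) (hy : y ≤ N+1) :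
    (c4*q^N)^y*kk q (e*q^a) (N+1) = q^(y*a)*kk q (e*q^a) (N+1-y)*sg q d y := by
  induction y with
  | zero => simp [sg_zero]
  | succ y ih =>
    have h0 : -d*q^(y+2) ≠ 0 := mul_ne_zero (neg_ne_zero.2 hd) (pow_ne_zero _ hq)
    have h1 := inv_mul_cancel₀ h0
    have ih := ih (by omega)
    obtain ⟨z, rfl⟩ := Nat.exists_eq_add_of_le (by omega : y ≤ N)
    rw [show y+z+1-y = z+1 by omega, kk_succ q _ z] at ih
    rw [show y+z+1-(y+1) = z by omega, sg_succ, pow_succ]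
    generalize (-d*q^(y+2))⁻¹ = I at *
    have k : c4*q^(y+z)*(-(e*q^a)*q^(z+1)) = q^a*I := by
      linear_combination (q^a*I)*hc+(e*q^a*c4*q^(2*z+y+1))*h1
    linear_combination (c4*q^(y+z))*ih+(q^(y*a)*kk q (e*q^a) z*sg q d y)*k
lemma core {q d e c4 : ℂ} {N : ℕ} (hq : q ≠ 0) (hd : d ≠ 0) (hc : d*e*c4*q^(2*N+3) = 1) (a y : ℕ) (ha : a+y ≤ N) :
    (c4*q^N)^y*poch q (e*c4*q^(N-y+2)) a*poch q (e*q^(a+1)) (N+1)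
      = c4^a*kk q (e*q^(N+1)) a*poch q (e*q^(a+1)) (N-y+1)*poch q (d*q^(N-a+2+y)) a*sg q d y*poch q (d*c4*q^(N-a+2)) y := by
  have hs := sg_aux hq hd hc a y (by omega)
  obtain ⟨z, rfl⟩ := Nat.exists_eq_add_of_le ha
  have e1 : a+y+z-y = a+z := by omega
  have e2 : a+y+z-a = y+z := by omega
  rw [show a+y+z+1-y = a+z+1 by omega] at hs
  rw [e1, e2]
  have r1 := poch_rev hq (e*c4*q^(a+z+1)) a (d*q^(y+z+2+y)) (by rw [← hc]; ring)
  have r2 := poch_rev hq (e*q^a) (a+y+z+1) (d*c4*q^(y+z+2)) (by rw [← hc]; ring)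
  have r3 := poch_rev hq (e*q^a) (a+z+1) (d*c4*q^(y+z+2)*q^y) (by rw [← hc]; ring)
  have r4 := poch_add q (d*c4*q^(y+z+2)) y (a+z+1)
  rw [show y+(a+z+1) = a+y+z+1 by omega] at r4
  rw [show e*c4*q^(a+z+1)*q = e*c4*q^(a+z+2) by ring] at r1
  rw [show e*q^a*q = e*q^(a+1) by ring] at r2 r3
  rw [r1, r2, r3, r4]
  have k1 := kk_mul q (e*q^(a+z+1)) c4 a
  have k2 := kk_mul q (e*q^(a+z+1)) (q^y) a
  rw [show e*q^(a+z+1)*c4 = e*c4*q^(a+z+1) by ring] at k1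
  rw [show e*q^(a+z+1)*q^y = e*q^(a+y+z+1) by ring, ← pow_mul] at k2
  rw [k1, k2]
  linear_combination (poch q (d*q^(y+z+2+y)) a*(c4^a*kk q (e*q^(a+z+1)) a)*(poch q (d*c4*q^(y+z+2)) y*poch q (d*c4*q^(y+z+2)*q^y) (a+z+1)))*hs
def ZZ (q e : ℂ) (N a : ℕ) : ℂ :=
  (1-e*q^(2*a+1))*kk q (e*q^(N+1)) a/(poch q q a*q^a*poch q (e*q^(a+1)) (N+1))
def C1 (q c1 c2 c4 : ℂ) (N a x : ℕ) : ℂ :=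
  poch q q (N-x)*poch q (q*c2) a/poch q (q*c1) a*(c4/c2)^a*ZZ q (c1*c2) N a
lemma Hyp.n12 {q : ℂ} {N : ℕ} {c0 c1 c2 c3 c4 : ℂ} (h : Hyp q N c0 c1 c2 c3 c4) : ∀ k, 1 ≤ k → k ≤ 2*N+5 → c1*c2*q^k ≠ 1 := fun k a b => by simpa using h.u 0 1 1 0 0 k (by omega) a b
lemma E1 {q c0 c1 c2 c3 c4 : ℂ} {N : ℕ} (h : Hyp q N c0 c1 c2 c3 c4) (a x y : ℕ) (ha : a+y ≤ N) (hx : x+y ≤ N) :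
    (c3*c4*q^(N+1))^y*(poch q (q*c0) y/poch q (q*c3) y)*Wt q c1 c2 c4 (N-y) a*Wt q c0 c3 c1 (N-x) y
      = C1 q c1 c2 c4 N a x*(uu q (c0*c3) c4 (N-a) y*vv q (c0*c3) c1 N (N-x) y) := by
  have hd : c0*c3 ≠ 0 := mul_ne_zero h.h0 h.h3
  have cr := core (e := c1*c2) (d := c0*c3) (c4 := c4) (N := N) h.hq hd (by rw [← h.con]; ring) a y ha
  have p0 : poch q (q*c0) y ≠ 0 := poch_one_ne h.n0 (by omega)
  have p3 : poch q (q*c3) y ≠ 0 := poch_one_ne h.n3 (by omega)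
  have pa : poch q (c1*c2*q^(a+1)) (N+1) ≠ 0 := poch_pow_ne h.n12 (by omega) (by omega)
  have pb : poch q (c1*c2*q^(a+1)) (N-y+1) ≠ 0 := poch_pow_ne h.n12 (by omega) (by omega)
  have d1 : poch q (c0*c3*q^(y+1)) (N-x+1) ≠ 0 := poch_pow_ne h.n03 (by omega) (by omega)
  have d2 : poch q (c0*c3*q^(y+1)) (N-a+1) ≠ 0 := poch_pow_ne h.n03 (by omega) (by omega)
  have a1 := poch_add q (c0*c3*q^(y+1)) (N-x+1) x
  have a2 := poch_add q (c0*c3*q^(y+1)) (N-a+1) a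
  rw [show N-x+1+x = N+1 by omega, show c0*c3*q^(y+1)*q^(N-x+1) = c0*c3*q^(y+(N-x)+2) by ring] at a1
  rw [show N-a+1+a = N+1 by omega, show c0*c3*q^(y+1)*q^(N-a+1) = c0*c3*q^(N-a+2+y) by ring, a1] at a2
  rw [C1, ZZ, uu, vv, JJ, JJ, if_pos (by omega), if_pos (by omega), Wt, Wt,
    show N-(N-x) = x by omega, show N-y-a = N-a-y by omega, show c0*c3*c1*q^(N-x+2) = c0*c3*c1*q^(N-x+2) from rfl,
    show (q*c3)^y = q^y*c3^y from mul_pow _ _ _, show (q*c2)^a = q^a*c2^a from mul_pow _ _ _, div_pow,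
    show (c3*c4*q^(N+1))^y = (c4*q^N)^y*(q^y*c3^y) by rw [← mul_pow, ← mul_pow]; congr 1; ring]
  have i1 := inv_mul_cancel₀ p0
  have i2 := inv_mul_cancel₀ p3
  have i3 := inv_mul_cancel₀ pa
  have i4 := inv_mul_cancel₀ pb
  have i5 := inv_mul_cancel₀ d1
  have i6 := inv_mul_cancel₀ d2
  have i7 := inv_mul_cancel₀ (pow_ne_zero y h.hq)
  have i8 := inv_mul_cancel₀ (pow_ne_zero y h.h3)
  simp only [div_eq_mul_inv, mul_inv]
  generalize poch q (c0*c3*q^(y+(N-x)+2)) x = D3 at *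
  generalize poch q (c0*c3*q^(N-a+2+y)) a = D4 at *
  generalize poch q (c0*c3*q^(y+1)) (N-x+1) = D1 at *
  generalize poch q (c0*c3*q^(y+1)) (N-a+1) = D2 at *
  generalize poch q (c1*c2*q^(a+1)) (N+1) = A1 at *
  generalize poch q (c1*c2*q^(a+1)) (N-y+1) = A2 at *
  generalize poch q (c1*c2*c4*q^(N-y+2)) a = A3 at *
  generalize poch q (c0*c3*c4*q^(N-a+2)) y = A4 at *
  generalize poch q (c0*c3*c1*q^(N-x+2)) y = A5 at *
  generalize poch q (q*c0) y = B0 at *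
  generalize poch q (q*c3) y = B3 at *
  generalize q^y = qy at *
  generalize c3^y = cy at *
  generalize D1⁻¹ = I1 at *
  generalize D2⁻¹ = I2 at *
  generalize A1⁻¹ = I3 at *
  generalize A2⁻¹ = I4 at *
  generalize B0⁻¹ = I5 at *
  generalize B3⁻¹ = I6 at *
  generalize qy⁻¹ = I7 at *
  generalize cy⁻¹ = I8 at *
  generalize (c4*q^N)^y = X at *
  generalize kk q (c1*c2*q^(N+1)) a = K at *
  generalize sg q (c0*c3) y = S at *
  have m1 : D4*I1 = D3*I2 := by
    linear_combination (-I1*I2)*a2-(D4*I1)*i6+(D3*I2)*i5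
  have m2 : X*A3*I4 = c4^a*K*D4*S*A4*I3 := by
    linear_combination (I3*I4)*cr-(X*A3*I4)*i3+(c4^a*K*D4*S*A4*I3)*i4
  have m3 : B0*I6*B3*I5*qy*cy*I7*I8 = 1 := by
    linear_combination (I6*B3*qy*cy*I7*I8)*i1+(qy*cy*I7*I8)*i2+(cy*I8)*i7+i8
  have m4 : X*A3*I4*I1 = c4^a*K*S*A4*I3*(D3*I2) := by
    linear_combination I1*m2+(c4^a*K*S*A4*I3)*m1
  generalize poch q q (N-y) = F1
  generalize poch q q (N-x) = F2
  generalize poch q (q*c4) (N-a-y) = F3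
  generalize poch q (q*c1) (N-x-y) = F4
  generalize (poch q q (N-a-y))⁻¹ = F5
  generalize (poch q q (N-x-y))⁻¹ = F6
  generalize 1-c1*c2*q^(2*a+1) = F7
  generalize 1-c0*c3*q^(2*y+1) = F8
  generalize (poch q q a)⁻¹ = F9
  generalize (poch q q y)⁻¹ = F10
  generalize (q^a)⁻¹ = F11
  generalize (c2^a)⁻¹ = F12
  generalize poch q (q*c2) a = F13
  generalize (poch q (q*c1) a)⁻¹ = F14
  linear_combination (X*A3*I4*I1*F1*F2*F3*F4*F5*F6*F7*F8*F9*F10*F11*F12*F13*F14*A5)*m3+(F1*F2*F3*F4*F5*F6*F7*F8*F9*F10*F11*F12*F13*F14*A5)*m4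
lemma Wt_kj {q c0 c3 c4 : ℂ} {M j : ℕ} (hq : q ≠ 0) (h0 : c0 ≠ 0) (h4 : c4 ≠ 0)
    (p0 : poch q (q*c0) j ≠ 0) (p4 : poch q (q*c4) j ≠ 0) (hj : j ≤ M) :
    Wt q c4 c0 c3 M j*kj q c0 c4 j = poch q q M*uu q (c0*c4) c3 M j := by
  have hs := sg_kk hq (mul_ne_zero h0 h4) j
  have k1 := kk_mul q c4 c0 j
  rw [mul_comm c4 c0] at k1
  rw [k1] at hs
  have i1 := inv_mul_cancel₀ p0
  have i2 := inv_mul_cancel₀ p4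
  have i3 := inv_mul_cancel₀ (kk_ne hq h4 j)
  have i4 := inv_mul_cancel₀ (pow_ne_zero j hq)
  have i5 := inv_mul_cancel₀ (pow_ne_zero j h0)
  rw [Wt, kj, uu, JJ, if_pos hj, mul_comm c4 c0, mul_pow, show c0*c4*c3*q^(M+2) = c0*c4*c3*q^(M+2) from rfl]
  simp only [div_eq_mul_inv, mul_inv]
  generalize poch q (q*c0) j = B0 at *
  generalize poch q (q*c4) j = B4 at *
  generalize kk q c4 j = K at *
  generalize q^j = Q at *
  generalize c0^j = C at *
  generalize sg q (c0*c4) j = S at *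
  generalize B0⁻¹ = I1 at *
  generalize B4⁻¹ = I2 at *
  generalize K⁻¹ = I3 at *
  generalize Q⁻¹ = I4 at *
  generalize C⁻¹ = I5 at *
  have m : B0*I1*B4*I2*I3*I4*I5 = S := by
    linear_combination (B4*I2*I3*I4*I5)*i1+(I3*I4*I5)*i2-(I3*I4*I5)*hs+(S*C*Q*I4*I5)*i3+(S*C*I5)*i4+S*i5
  linear_combination (poch q q M*poch q (q*c3) (M-j)*(1-c0*c4*q^(2*j+1))*poch q (c0*c4*c3*q^(M+2)) j*(poch q q j)⁻¹*(poch q q (M-j))⁻¹*(poch q (c0*c4*q^(j+1)) (M+1))⁻¹)*m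
end qR
namespace qR
structure Sq (q s c0 c1 c2 c3 c4 t0 t1 t2 t3 t4 : ℂ) (N : ℕ) : Prop where
  hs : s^2 = q
  e0 : t0^2 = c0
  e1 : t1^2 = c1
  e2 : t2^2 = c2
  e3 : t3^2 = c3
  e4 : t4^2 = c4
  con : s^(2*N+3)*(t0*t1*t2*t3*t4) = 1
section
variable {q s c0 c1 c2 c3 c4 t0 t1 t2 t3 t4 : ℂ} {N : ℕ}
lemma Sq.ne (h : Sq q s c0 c1 c2 c3 c4 t0 t1 t2 t3 t4 N) : s ≠ 0 ∧ t0 ≠ 0 ∧ t1 ≠ 0 ∧ t2 ≠ 0 ∧ t3 ≠ 0 ∧ t4 ≠ 0 := by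
  have := h.con
  refine ⟨?_, ?_, ?_, ?_, ?_, ?_⟩ <;> rintro rfl <;> simp at this
lemma Sq.A (h : Sq q s c0 c1 c2 c3 c4 t0 t1 t2 t3 t4 N) : c1*c4*q^(N+1) = t1*t4/(s*t0*t2*t3) := by
  obtain ⟨n, n0, n1, n2, n3, n4⟩ := h.ne
  rw [eq_div_iff (by simp [*]), ← h.e1, ← h.e4, ← h.hs, ← pow_mul]
  linear_combination (t1*t4)*h.con
lemma Sq.B (h : Sq q s c0 c1 c2 c3 c4 t0 t1 t2 t3 t4 N) : c2*c3*q^(N+1) = t2*t3/(s*t0*t1*t4) := by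
  obtain ⟨n, n0, n1, n2, n3, n4⟩ := h.ne
  rw [eq_div_iff (by simp [*]), ← h.e2, ← h.e3, ← h.hs, ← pow_mul]
  linear_combination (t2*t3)*h.con
lemma Sq.C (h : Sq q s c0 c1 c2 c3 c4 t0 t1 t2 t3 t4 N) : c3*c4*q^(N+1) = t3*t4/(s*t0*t1*t2) := by
  obtain ⟨n, n0, n1, n2, n3, n4⟩ := h.ne
  rw [eq_div_iff (by simp [*]), ← h.e4, ← h.e3, ← h.hs, ← pow_mul]
  linear_combination (t3*t4)*h.con
lemma pow_id (h : Sq q s c0 c1 c2 c3 c4 t0 t1 t2 t3 t4 N) (j a x b : ℕ) (hj : j ≤ N) (ha : a ≤ N) (hx : x ≤ N) (hb : b ≤ N) :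
    (s*t0)^(N-a)*(s*t2)^N*(s*t3)^(N-x)*((c1*c4/(c2*c3))^a*(c1*c4*q^(N+1))^N/((c1*c4*q^(N+1))^a*(c1*c4*q^(N+1))^x)*(c2*c3*q^(N+1))^b)*(c4*c3*q^(N+1))^j
      = (s*t4)^(N-b)*(s*t1)^(N-j)*((t3*t4/(t0*t2))^j*(t1*t4/(t2*t3))^a*(t0*t2/(t1*t4))^x*(t2*t3/(t0*t1))^b) := by
  obtain ⟨n, n0, n1, n2, n3, n4⟩ := h.ne
  rw [mul_comm c4 c3, h.A, h.B, h.C, ← h.e1, ← h.e2, ← h.e3, ← h.e4,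
    pow_sub₀ _ (mul_ne_zero n n0) ha, pow_sub₀ _ (mul_ne_zero n n3) hx, pow_sub₀ _ (mul_ne_zero n n4) hb, pow_sub₀ _ (mul_ne_zero n n1) hj]
  have f0 : (s*t0*(s*t2)*(s*t3)*(t1*t4/(s*t0*t2*t3)))^N = (s*t4*(s*t1))^N := by congr 1; field_simp
  have fa : ((s*t0)⁻¹*(t1^2*t4^2/(t2^2*t3^2))*(t1*t4/(s*t0*t2*t3))⁻¹)^a = (t1*t4/(t2*t3))^a := by congr 1; field_simp
  have fx : ((s*t3)⁻¹*(t1*t4/(s*t0*t2*t3))⁻¹)^x = (t0*t2/(t1*t4))^x := by congr 1; field_simp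
  have fb : (t2*t3/(s*t0*t1*t4))^b = ((s*t4)⁻¹*(t2*t3/(t0*t1)))^b := by congr 1; field_simp
  have fj : (t3*t4/(s*t0*t1*t2))^j = ((s*t1)⁻¹*(t3*t4/(t0*t2)))^j := by congr 1; field_simp
  rw [fb, fj, ← fa, ← fx]
  rw [mul_pow _ (s*t1) N, mul_pow _ (t1*t4/(s*t0*t2*t3)) N, mul_pow _ (s*t3) N, mul_pow _ (s*t2) N] at f0
  rw [mul_pow (s*t1)⁻¹, mul_pow (s*t4)⁻¹, mul_pow _ (t1*t4/(s*t0*t2*t3))⁻¹ a, mul_pow _ (t1*t4/(s*t0*t2*t3))⁻¹ x, mul_pow (s*t0)⁻¹]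
  simp only [inv_pow, div_eq_mul_inv (_*_ : ℂ) ((t1*t4/(s*t0*t2*t3))^a*_), mul_inv ((t1*t4/(s*t0*t2*t3))^a)]
  linear_combination (((s*t0)^a)⁻¹*((s*t3)^x)⁻¹*((s*t1)^j)⁻¹*((s*t4)^b)⁻¹*(t1^2*t4^2/(t2^2*t3^2))^a*((t1*t4/(s*t0*t2*t3))^a)⁻¹*((t1*t4/(s*t0*t2*t3))^x)⁻¹*(t2*t3/(t0*t1))^b*(t3*t4/(t0*t2))^j)*f0
lemma C1_rel (h : Hyp q N c0 c1 c2 c3 c4) (a x b : ℕ) (ha : a ≤ N) (hx : x ≤ N) (hb : b ≤ N) :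
    poch q q (N-a)*C1 q c1 c2 c4 N a x*hf q c1 c2 c3 c4 N a x b
      = ((c1*c4/(c2*c3))^a*(c1*c4*q^(N+1))^N/((c1*c4*q^(N+1))^a*(c1*c4*q^(N+1))^x)*(c2*c3*q^(N+1))^b)
        *(poch q (q*c2) a/poch q (q*c1) a*(poch q (q*c4) x/poch q (q*c2) x)*(poch q (q*c1) b/poch q (q*c3) b))
        *C1 q c2 c1 c3 N a b := by
  have p1 : poch q (q*c1) a ≠ 0 := poch_one_ne h.n1 (by omega)
  have p2 : poch q (q*c2) a ≠ 0 := poch_one_ne h.n2 (by omega)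
  have q1 : poch q q (N-a) ≠ 0 := poch_q_ne h.q1 (by omega)
  have q2 : poch q q (N-x) ≠ 0 := poch_q_ne h.q1 (by omega)
  rw [C1, C1, hf, fx, fx, fb, mul_comm c2 c1]
  simp only [div_eq_mul_inv, mul_inv, mul_pow _ _ a, inv_pow]
  generalize poch q (q*c1) a = P1 at *
  generalize poch q (q*c2) a = P2 at *
  generalize poch q q (N-a) = F1 at *
  generalize poch q q (N-x) = F2 at *
  have i1 := inv_mul_cancel₀ p1
  have i2 := inv_mul_cancel₀ p2
  have i3 := inv_mul_cancel₀ q1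
  have i4 := inv_mul_cancel₀ q2
  have i5 := inv_mul_cancel₀ (pow_ne_zero a h.h1)
  have i6 := inv_mul_cancel₀ (pow_ne_zero a h.h3)
  generalize P1⁻¹ = I1 at *
  generalize P2⁻¹ = I2 at *
  generalize F1⁻¹ = I3 at *
  generalize F2⁻¹ = I4 at *
  generalize c1^a = X1 at *
  generalize c3^a = X3 at *
  generalize c4^a = X4 at *
  generalize X1⁻¹ = I5 at *
  generalize X3⁻¹ = I6 at *
  generalize (X4⁻¹) = I7 at *
  generalize ((q^(N+1))^a)⁻¹ = I8 at *
  generalize (c1*c4*q^(N+1))^N = E1 at *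
  generalize ((c1*c4*q^(N+1))^x)⁻¹ = E2 at *
  generalize (c2*c3*q^(N+1))^b = E3 at *
  generalize (c2^a)⁻¹ = E4 at *
  generalize poch q (q*c4) x = E5 at *
  generalize (poch q (q*c2) x)⁻¹ = E6 at *
  generalize poch q (q*c1) b = E7 at *
  generalize (poch q (q*c3) b)⁻¹ = E8 at *
  generalize poch q q (N-b) = E9 at *
  generalize ZZ q (c1*c2) N a = E10 at *
  have m : F1*I3*F2*I4*P2*I2*P1*I1 = X1*I5*X3*I6*(P2*I2*P1*I1) := by
    linear_combination (P2*I2*P1*I1)*((F2*I4)*i3+i4-(X3*I6)*i5-i6)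
  linear_combination (E1*E2*E3*E4*E5*E6*E7*E8*E9*E10*X4*I5*I7*I8)*m
theorem P_pp (h : Hyp q N c0 c1 c2 c3 c4) (k : Sq q s c0 c1 c2 c3 c4 t0 t1 t2 t3 t4 N) (j a x b : ℕ)
    (hj : j ≤ N) (ha : a ≤ N) (hx : x ≤ N) (hb : b ≤ N) :
    ∑ y ∈ Finset.range (N+1), (t3*t4/(t1*t0))^y*(poch q (q*c0) y/poch q (q*c3) y)*
        (pp q (s*t0) c3 c0 c4 (N-a) j y*pp q (s*t2) c4 c2 c1 (N-y) a x*pp q (s*t3) c1 c3 c0 (N-x) y b)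
      = (poch q (q*c0) j/poch q (q*c4) j*(t3*t4/(t0*t2))^j)*(poch q (q*c2) a/poch q (q*c1) a*(t1*t4/(t2*t3))^a)
        *(poch q (q*c4) x/poch q (q*c2) x*(t0*t2/(t1*t4))^x)*(poch q (q*c1) b/poch q (q*c3) b*(t2*t3/(t0*t1))^b)
        *(pp q (s*t4) c2 c4 c0 (N-b) j x*pp q (s*t1) c3 c1 c2 (N-j) a b) := by
  by_cases hc : j+a ≤ N ∧ x+b ≤ N
  swap
  · rcases (by omega : N < j+a ∨ N < x+b) with hc | hc
    · rw [pp_neg (n := a) (x := b) (by omega), mul_zero, mul_zero]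
      apply Finset.sum_eq_zero; intro y _
      rw [pp_neg (n := j) (x := y) (by omega)]; ring
    · rw [pp_neg (n := j) (x := x) (by omega), zero_mul, mul_zero]
      apply Finset.sum_eq_zero; intro y _
      rw [pp_neg (n := y) (x := b) (by omega)]; ring
  obtain ⟨h1, h2⟩ := hc
  obtain ⟨n, n0, n1, n2, n3, n4⟩ := k.ne
  have L : ∑ y ∈ Finset.range (N+1), (t3*t4/(t1*t0))^y*(poch q (q*c0) y/poch q (q*c3) y)*
        (pp q (s*t0) c3 c0 c4 (N-a) j y*pp q (s*t2) c4 c2 c1 (N-y) a x*pp q (s*t3) c1 c3 c0 (N-x) y b)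
      = Wt q c4 c0 c3 (N-a) j*(s*t0)^(N-a)*(s*t2)^N*(s*t3)^(N-x)*C1 q c1 c2 c4 N a x*PL q c0 c1 c2 c3 c4 N j a x b := by
    rw [PL, Finset.mul_sum]
    apply Finset.sum_congr rfl
    intro y hy
    have hy : y ≤ N := by have := Finset.mem_range.1 hy; omega
    by_cases ya : N-a < y
    · rw [uu_zero ya, pp_neg (n := j) (x := y) (by omega)]; ring
    by_cases yx : N-x < y
    · rw [Psi, vv_zero yx, pp_neg (n := y) (x := b) (by omega)]; ring
    rw [pp_pos (by omega) (by omega), pp_pos (by omega) (by omega), pp_pos (by omega) (by omega), Psi]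
    have e := E1 h a x y (by omega) (by omega)
    have ep : (t3*t4/(t1*t0))^y*(s*t2)^(N-y) = (c3*c4*q^(N+1))^y*(s*t2)^N := by
      rw [k.C, pow_sub₀ _ (mul_ne_zero n n2) hy]
      have : (t3*t4/(s*t0*t1*t2))^y = ((t3*t4/(t1*t0))*(s*t2)⁻¹)^y := by congr 1; field_simp
      rw [this, mul_pow (t3*t4/(t1*t0)), inv_pow]; ring
    linear_combination (poch q (q*c0) y/poch q (q*c3) y*Wt q c4 c0 c3 (N-a) j*(s*t0)^(N-a)*(s*t3)^(N-x)*Wt q c1 c2 c4 (N-y) a*Wt q c0 c3 c1 (N-x) y*rr q c3 c0 c4 (N-a) j y*rr q c4 c2 c1 (N-y) a x*rr q c1 c3 c0 (N-x) y b)*ep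
      + (Wt q c4 c0 c3 (N-a) j*(s*t0)^(N-a)*(s*t2)^N*(s*t3)^(N-x)*rr q c3 c0 c4 (N-a) j y*rr q c4 c2 c1 (N-y) a x*rr q c1 c3 c0 (N-x) y b)*e
  rw [L, Pmain q N c0 c1 c2 c3 c4 h j a x b h1 h2, Psi]
  by_cases jb : N-b < j
  · rw [vv_zero jb, pp_neg (n := j) (x := x) (by omega)]; ring
  rw [pp_pos (by omega) (by omega), pp_pos (by omega) (by omega)]
  have e := E1 h.swap a b j (by omega) (by omega)
  have w := Wt_kj (c3 := c3) (M := N-a) (j := j) h.hq h.h0 h.h4 (poch_one_ne h.n0 (by omega)) (poch_one_ne h.n4 (by omega)) (by omega)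
  have r := C1_rel h a x b ha hx hb
  have po := pow_id k j a x b hj ha hx hb
  have s1 : Wt q c4 c0 c3 (N-a) j*kj q c0 c4 j*C1 q c1 c2 c4 N a x*hf q c1 c2 c3 c4 N a x b*vv q (c0*c4) c2 N (N-b) j
     = ((c1*c4/(c2*c3))^a*(c1*c4*q^(N+1))^N/((c1*c4*q^(N+1))^a*(c1*c4*q^(N+1))^x)*(c2*c3*q^(N+1))^b)
        *(poch q (q*c2) a/poch q (q*c1) a*(poch q (q*c4) x/poch q (q*c2) x)*(poch q (q*c1) b/poch q (q*c3) b))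
        *((c4*c3*q^(N+1))^j*(poch q (q*c0) j/poch q (q*c4) j)*Wt q c2 c1 c3 (N-j) a*Wt q c0 c4 c2 (N-b) j) := by
    rw [e, w]
    linear_combination (uu q (c0*c4) c3 (N-a) j*vv q (c0*c4) c2 N (N-b) j)*r
  generalize ((c1*c4/(c2*c3))^a*(c1*c4*q^(N+1))^N/((c1*c4*q^(N+1))^a*(c1*c4*q^(N+1))^x)*(c2*c3*q^(N+1))^b) = U at *
  generalize poch q (q*c2) a/poch q (q*c1) a = V1 at *
  generalize poch q (q*c4) x/poch q (q*c2) x = V2 at *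
  generalize poch q (q*c1) b/poch q (q*c3) b = V3 at *
  generalize poch q (q*c0) j/poch q (q*c4) j = V4 at *
  generalize rr q c3 c1 c2 (N-j) a b = R1
  generalize rr q c2 c4 c0 (N-b) j x = R2
  linear_combination ((s*t0)^(N-a)*(s*t2)^N*(s*t3)^(N-x)*R1*R2)*s1+(V1*V2*V3*V4*R1*R2*Wt q c2 c1 c3 (N-j) a*Wt q c0 c4 c2 (N-b) j)*po
end
end qR
namespace qR
lemma sum_re (n : ℕ) (Ex Fy al be A H : ℕ → ℂ) (B E : ℕ → ℕ → ℂ) (C D : ℕ → ℕ → ℕ → ℂ) :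
    ∑ x ∈ Finset.range n, ∑ y ∈ Finset.range n, Ex x*Fy y*(∑ a ∈ Finset.range n, al a*(A a*B a y*C a x y))
        *(∑ b ∈ Finset.range n, be b*(D x y b*E x b*H b))
      = ∑ b ∈ Finset.range n, ∑ a ∈ Finset.range n, al a*be b*A a*H b*∑ x ∈ Finset.range n, Ex x*E x b*
          ∑ y ∈ Finset.range n, Fy y*(B a y*C a x y*D x y b) := by
  symm
  simp only [Finset.mul_sum, Finset.sum_mul]
  calc _ = ∑ b ∈ Finset.range n, ∑ x ∈ Finset.range n, ∑ a ∈ Finset.range n, ∑ y ∈ Finset.range n,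
        al a*be b*A a*H b*(Ex x*E x b*(Fy y*(B a y*C a x y*D x y b))) :=
        Finset.sum_congr rfl fun b _ => Finset.sum_comm
    _ = ∑ x ∈ Finset.range n, ∑ b ∈ Finset.range n, ∑ a ∈ Finset.range n, ∑ y ∈ Finset.range n,
        al a*be b*A a*H b*(Ex x*E x b*(Fy y*(B a y*C a x y*D x y b))) := Finset.sum_comm
    _ = ∑ x ∈ Finset.range n, ∑ b ∈ Finset.range n, ∑ y ∈ Finset.range n, ∑ a ∈ Finset.range n,
        al a*be b*A a*H b*(Ex x*E x b*(Fy y*(B a y*C a x y*D x y b))) :=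
        Finset.sum_congr rfl fun x _ => Finset.sum_congr rfl fun b _ => Finset.sum_comm
    _ = ∑ x ∈ Finset.range n, ∑ y ∈ Finset.range n, ∑ b ∈ Finset.range n, ∑ a ∈ Finset.range n,
        al a*be b*A a*H b*(Ex x*E x b*(Fy y*(B a y*C a x y*D x y b))) :=
        Finset.sum_congr rfl fun x _ => Finset.sum_comm
    _ = _ := by
        apply Finset.sum_congr rfl; intro x _; apply Finset.sum_congr rfl; intro y _
        apply Finset.sum_congr rfl; intro b _; apply Finset.sum_congr rfl; intro a _
        ring
lemma Hyp.gA {q : ℂ} {N : ℕ} {c0 c1 c2 c3 c4 : ℂ} (h : Hyp q N c0 c1 c2 c3 c4) : Gen3 q (2*N+2) c1 c2 c3 := by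
  intro k a b
  have b' : k ≤ 2*N+5 := by omega
  exact ⟨by simpa [a, b'] using h.g 0 1 0 0 0 k,
    by simpa [a, b'] using h.g 0 0 1 0 0 k,
    by simpa [a, b'] using h.g 0 0 0 1 0 k,
    by simpa [a, b'] using h.g 0 1 1 0 0 k,
    by simpa [a, b'] using h.g 0 0 1 1 0 k,
    by simpa [a, b'] using h.g 0 1 0 1 0 k,
    by simpa [a, b'] using h.g 0 1 1 1 0 k⟩
lemma Hyp.gB {q : ℂ} {N : ℕ} {c0 c1 c2 c3 c4 : ℂ} (h : Hyp q N c0 c1 c2 c3 c4) : Gen3 q (2*N+2) c0 c2 c4 := by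
  intro k a b
  have b' : k ≤ 2*N+5 := by omega
  exact ⟨by simpa [a, b'] using h.g 1 0 0 0 0 k,
    by simpa [a, b'] using h.g 0 0 1 0 0 k,
    by simpa [a, b'] using h.g 0 0 0 0 1 k,
    by simpa [a, b'] using h.g 1 0 1 0 0 k,
    by simpa [a, b'] using h.g 0 0 1 0 1 k,
    by simpa [a, b'] using h.g 1 0 0 0 1 k,
    by simpa [a, b'] using h.g 1 0 1 0 1 k⟩
lemma G_pp {q s c0 c1 c2 c3 c4 t0 t1 t2 t3 t4 : ℂ} {N : ℕ} (hq : q ≠ 0) (h0 : c0 ≠ 0) (h2 : c2 ≠ 0)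
    (hs : s^2 = q) (e0 : t0^2 = c0) (e2 : t2^2 = c2)
    (hc0 : c0 = (q^(2*(N : ℤ)+3)*c1*c2*c3*c4)⁻¹)
    (ht0 : t0 = (s^(2*(N : ℤ)+3)*t1*t2*t3*t4)⁻¹)
    (i j x y : ℕ) (hij : i+j ≤ N) (hy : y ≤ N) :
    G q s c1 c2 c3 c4 t1 t2 t3 t4 (N:ℤ) (i:ℤ) (j:ℤ) (x:ℤ) (y:ℤ)
      = ∑ a ∈ Finset.range (N+1), kk q (t1*t2*t3/t4) a*(pp q (s*t2) c1 c2 c3 (N-j) i a*pp q (s*t0) c3 c0 c4 (N-a) j y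
          *pp q (s*t2) c4 c2 c1 (N-y) a x) := by
  rw [G, if_pos (by omega), ← hc0, ← ht0]
  have em : (min ((N:ℤ)-j) (N-y)).toNat+1 ≤ N+1 := by omega
  rw [← Finset.sum_subset (Finset.range_subset_range.2 em)]
  · apply Finset.sum_congr rfl
    intro a ha
    have ha : a ≤ N-j ∧ a ≤ N-y := by have := Finset.mem_range.1 ha; omega
    rw [show (N:ℤ)-j = ((N-j : ℕ):ℤ) by omega, show (N:ℤ)-a = ((N-a : ℕ):ℤ) by omega, show (N:ℤ)-y = ((N-y : ℕ):ℤ) by omega,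
      p_pp hq h2 hs e2, p_pp hq h0 hs e0, p_pp hq h2 hs e2, om_kk q _ hq]
    ring
  · intro a _ ha
    have ha : N-j < a ∨ N-y < a := by
      by_contra hh
      apply ha; rw [Finset.mem_range]; omega
    rcases ha with ha | ha
    · rw [pp_neg (N := N-j) (Or.inr ha)]; ring
    · rw [pp_neg (N := N-y) (Or.inl ha)]; ring
section
variable {q s c0 c1 c2 c3 c4 t0 t1 t2 t3 t4 : ℂ} {N : ℕ}
lemma ww_coef {r z c c' : ℂ} (hr : r*z = c) (n : ℕ) :
    kk q r n*(poch q (q*c') n/poch q (q*c) n*z^n) = ww q c c' n := by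
  rw [ww, ← hr, kk_mul]; ring
theorem main_pp (h : Hyp q N c0 c1 c2 c3 c4) (k : Sq q s c0 c1 c2 c3 c4 t0 t1 t2 t3 t4 N) (i j m l : ℕ)
    (hij : i+j ≤ N) (hml : m+l ≤ N) :
    ww q c2 c3 i*∑ x ∈ Finset.range (N+1), ∑ y ∈ Finset.range (N+1),
      (poch q (q*c2) x/poch q (q*c4) x*(t1*t4/(t0*t2))^x)*((t3*t4/(t1*t0))^y*(poch q (q*c0) y/poch q (q*c3) y))
      *(∑ a ∈ Finset.range (N+1), kk q (t1*t2*t3/t4) a*(pp q (s*t2) c1 c2 c3 (N-j) i a*pp q (s*t0) c3 c0 c4 (N-a) j y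
          *pp q (s*t2) c4 c2 c1 (N-y) a x))
      *(∑ b ∈ Finset.range (N+1), kk q (t1*t3*t0/t2) b*(pp q (s*t3) c1 c3 c0 (N-x) y b*pp q (s*t4) c0 c4 c2 (N-b) x l
          *pp q (s*t3) c2 c3 c1 (N-l) b m))
     = if i = m ∧ j = l then (poch q (q*c0) j/poch q (q*c4) j*(t3*t4/(t0*t2))^j)*kk q (s*t1*t2*t3) (N-j) else 0 := by
  obtain ⟨n, n0, n1, n2, n3, n4⟩ := k.ne
  rw [sum_re (N+1) (fun x => poch q (q*c2) x/poch q (q*c4) x*(t1*t4/(t0*t2))^x)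
    (fun y => (t3*t4/(t1*t0))^y*(poch q (q*c0) y/poch q (q*c3) y)) (fun a => kk q (t1*t2*t3/t4) a)
    (fun b => kk q (t1*t3*t0/t2) b) (fun a => pp q (s*t2) c1 c2 c3 (N-j) i a) (fun b => pp q (s*t3) c2 c3 c1 (N-l) b m)
    (fun a y => pp q (s*t0) c3 c0 c4 (N-a) j y) (fun x b => pp q (s*t4) c0 c4 c2 (N-b) x l)
    (fun a x y => pp q (s*t2) c4 c2 c1 (N-y) a x) (fun x y b => pp q (s*t3) c1 c3 c0 (N-x) y b)]
  set Wj := poch q (q*c0) j/poch q (q*c4) j*(t3*t4/(t0*t2))^j with hWj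
  have step : ∀ b ∈ Finset.range (N+1),
      ww q c2 c3 i*∑ a ∈ Finset.range (N+1), kk q (t1*t2*t3/t4) a*kk q (t1*t3*t0/t2) b*pp q (s*t2) c1 c2 c3 (N-j) i a*pp q (s*t3) c2 c3 c1 (N-l) b m
        *∑ x ∈ Finset.range (N+1), (poch q (q*c2) x/poch q (q*c4) x*(t1*t4/(t0*t2))^x)*pp q (s*t4) c0 c4 c2 (N-b) x l
          *∑ y ∈ Finset.range (N+1), (t3*t4/(t1*t0))^y*(poch q (q*c0) y/poch q (q*c3) y)*
            (pp q (s*t0) c3 c0 c4 (N-a) j y*pp q (s*t2) c4 c2 c1 (N-y) a x*pp q (s*t3) c1 c3 c0 (N-x) y b)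
      = Wj*kk q (s*t1*t2*t3) (N-j)*((if j = l then 1 else 0)*(pp q (s*t3) c1 c3 c2 (N-j) i b*pp q (s*t3) c2 c3 c1 (N-j) b m)) := by
    intro b hb
    have hb : b ≤ N := by have := Finset.mem_range.1 hb; omega
    have x1 : ∀ a ∈ Finset.range (N+1), kk q (t1*t2*t3/t4) a*kk q (t1*t3*t0/t2) b*pp q (s*t2) c1 c2 c3 (N-j) i a*pp q (s*t3) c2 c3 c1 (N-l) b m
        *∑ x ∈ Finset.range (N+1), (poch q (q*c2) x/poch q (q*c4) x*(t1*t4/(t0*t2))^x)*pp q (s*t4) c0 c4 c2 (N-b) x l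
          *∑ y ∈ Finset.range (N+1), (t3*t4/(t1*t0))^y*(poch q (q*c0) y/poch q (q*c3) y)*
            (pp q (s*t0) c3 c0 c4 (N-a) j y*pp q (s*t2) c4 c2 c1 (N-y) a x*pp q (s*t3) c1 c3 c0 (N-x) y b)
       = (Wj*ww q c3 c1 b*pp q (s*t3) c2 c3 c1 (N-l) b m*(if j = l ∧ j ≤ N-b then 1 else 0))
          *(ww q c1 c2 a*(pp q (s*t2) c1 c2 c3 (N-j) i a*pp q (s*t1) c3 c1 c2 (N-j) a b)) := by
      intro a ha
      have ha : a ≤ N := by have := Finset.mem_range.1 ha; omega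
      rw [← O_pp (σ := s*t4) (c1 := c2) (c2 := c4) (c3 := c0) h.hq (Nat.sub_le N b) h.h2 h.h4 (by rw [mul_pow, k.hs, k.e4]) h.q1
        (Gen3_swap23 (Gen3_swap12 h.gB)) j l,
        ← ww_coef (r := t1*t2*t3/t4) (z := t1*t4/(t2*t3)) (c := c1) (by rw [← k.e1]; field_simp),
        ← ww_coef (r := t1*t3*t0/t2) (z := t2*t3/(t0*t1)) (c := c3) (by rw [← k.e3]; field_simp),
        Finset.mul_sum, Finset.mul_sum, Finset.sum_mul]
      apply Finset.sum_congr rfl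
      intro x hx
      have hx : x ≤ N := by have := Finset.mem_range.1 hx; omega
      rw [P_pp h k j a x b (by omega) ha hx hb, ← hWj]
      have p2 : poch q (q*c2) x ≠ 0 := poch_one_ne h.n2 (by omega)
      have p4 : poch q (q*c4) x ≠ 0 := poch_one_ne h.n4 (by omega)
      have c : poch q (q*c2) x/poch q (q*c4) x*(t1*t4/(t0*t2))^x*(poch q (q*c4) x/poch q (q*c2) x*(t0*t2/(t1*t4))^x) = 1 := by
        have : (t1*t4/(t0*t2))^x*(t0*t2/(t1*t4))^x = 1 := by
          rw [← mul_pow, show t1*t4/(t0*t2)*(t0*t2/(t1*t4)) = 1 by field_simp, one_pow]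
        have c' : poch q (q*c2) x/poch q (q*c4) x*(poch q (q*c4) x/poch q (q*c2) x) = 1 := by field_simp
        linear_combination (poch q (q*c2) x/poch q (q*c4) x*(poch q (q*c4) x/poch q (q*c2) x))*this+c'
      generalize poch q (q*c2) x/poch q (q*c4) x*(t1*t4/(t0*t2))^x = E1 at *
      generalize poch q (q*c4) x/poch q (q*c2) x*(t0*t2/(t1*t4))^x = E2 at *
      generalize poch q (q*c2) a/poch q (q*c1) a*(t1*t4/(t2*t3))^a = E3 at *
      generalize poch q (q*c1) b/poch q (q*c3) b*(t2*t3/(t0*t1))^b = E4 at *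
      linear_combination (kk q (t1*t2*t3/t4) a*kk q (t1*t3*t0/t2) b*pp q (s*t2) c1 c2 c3 (N-j) i a*pp q (s*t3) c2 c3 c1 (N-l) b m*pp q (s*t4) c0 c4 c2 (N-b) x l*Wj*E3*E4*pp q (s*t4) c2 c4 c0 (N-b) j x*pp q (s*t1) c3 c1 c2 (N-j) a b)*c
    rw [Finset.sum_congr rfl x1, ← Finset.mul_sum]
    have R := R_pp (s := s) (t1 := t1) (t2 := t2) (M := N-j) h.hq (Nat.sub_le N j) h.h1 h.h2 h.h3 k.e3 h.q1 h.gA i b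
    by_cases hjl : j = l
    · subst hjl
      by_cases hbj : j ≤ N-b
      · rw [if_pos ⟨rfl, hbj⟩, if_pos rfl]
        linear_combination (Wj*pp q (s*t3) c2 c3 c1 (N-j) b m)*R
      · rw [pp_neg (N := N-j) (n := b) (x := m) (by omega)]; ring
    · rw [if_neg (by tauto), if_neg hjl]; ring
  rw [Finset.mul_sum, Finset.sum_congr rfl step, ← Finset.mul_sum, ← Finset.mul_sum,
    O_pp h.hq (Nat.sub_le N j) h.h1 h.h3 (by rw [mul_pow, k.hs, k.e3]) h.q1 (Gen3_swap23 h.gA)]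
  by_cases h1 : j = l <;> by_cases h2 : i = m <;> simp [h1, h2] <;> omega
end
end qR
namespace qR
lemma kk_split {q r u z : ℂ} {N : ℕ} (h : r*u*q^(N+1) = z) (j : ℕ) (hj : j ≤ N) :
    kk q r N*kk q u j = kk q r (N-j)*z^j := by
  induction j with
  | zero => simp [kk]
  | succ j ih =>
    have ih := ih (by omega)
    obtain ⟨M, rfl⟩ : ∃ M, N = M+j+1 := ⟨N-j-1, by omega⟩
    rw [show M+j+1-j = M+1 by omega, kk_succ q r M] at ih
    rw [show M+j+1-(j+1) = M by omega, kk_succ q u, ← mul_assoc, ih, pow_succ z, ← h]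
    ring
lemma fin_aux {q s c0 c1 c2 c3 c4 t0 t1 t2 t3 t4 : ℂ} {N : ℕ} (h : Hyp q N c0 c1 c2 c3 c4)
    (k : Sq q s c0 c1 c2 c3 c4 t0 t1 t2 t3 t4 N) (i j : ℕ) (hij : i+j ≤ N) :
    (poch q (q*c0) j/poch q (q*c4) j*(t3*t4/(t0*t2))^j)*kk q (s*t1*t2*t3) (N-j)
      = ww q c2 c3 i*(om q (s*t1*t2*t3) (N : ℤ)
          * (om q (t3*t0*t4 / t2) (j : ℤ) / om q (t2*t3) (i : ℤ))
          * xi q c2 c3 t2 t3 (i : ℤ)*xi q c0 c4 t0 t4 (j : ℤ)) := by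
  obtain ⟨n, n0, n1, n2, n3, n4⟩ := k.ne
  rw [om_kk _ _ h.hq, om_kk _ _ h.hq, om_kk _ _ h.hq, xi, xi, Int.toNat_natCast, Int.toNat_natCast, zpow_natCast, zpow_natCast]
  have e : s*t1*t2*t3*(t3*t0*t4/t2)*q^(N+1) = t3/t2 := by
    have := k.con
    have hs := k.hs
    rw [← hs]
    field_simp
    linear_combination this
  have e1 := kk_split e j (by omega)
  have p0 : poch q (q*c2) i ≠ 0 := poch_one_ne h.n2 (by omega)
  have p3 : poch q (q*c3) i ≠ 0 := poch_one_ne h.n3 (by omega)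
  have e2 : kk q c2 i = (t2/t3)^i*kk q (t2*t3) i := by
    rw [← kk_mul, ← k.e2]; congr 1; field_simp
  have p4 : kk q (t2*t3) i ≠ 0 := kk_ne h.hq (mul_ne_zero n2 n3) i
  have e3 : ww q c2 c3 i*(poch q (q*c2) i/poch q (q*c3) i*(t3/t2)^i) = kk q (t2*t3) i := by
    rw [ww, e2, div_pow, div_pow]; field_simp
  have e4 : (t3*t4/(t0*t2))^j = (t3/t2)^j*(t4/t0)^j := by rw [← mul_pow]; congr 1; field_simp
  rw [e4]
  calc _ = (poch q (q*c0) j/poch q (q*c4) j*(t4/t0)^j)*(kk q (s*t1*t2*t3) (N-j)*(t3/t2)^j) := by ring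
    _ = (poch q (q*c0) j/poch q (q*c4) j*(t4/t0)^j)*(kk q (s*t1*t2*t3) N*kk q (t3*t0*t4/t2) j)*(kk q (t2*t3) i/kk q (t2*t3) i) := by
        rw [e1, div_self p4, mul_one]
    _ = _ := by rw [← e3]; ring
lemma mkHyp {N : ℕ} {q c0 c1 c2 c3 c4 : ℂ}
    (hq : q ≠ 0) (hc1 : c1 ≠ 0) (hc2 : c2 ≠ 0) (hc3 : c3 ≠ 0) (hc4 : c4 ≠ 0)
    (hc0 : c0 = (q^(2*(N : ℤ)+3)*c1*c2*c3*c4)⁻¹)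
    (hgen : ∀ e0 e1 e2 e3 e4 : ℕ, e0 ≤ 1 → e1 ≤ 1 → e2 ≤ 1 → e3 ≤ 1 → e4 ≤ 1 →
      1 ≤ e0+e1+e2+e3+e4 → e0+e1+e2+e3+e4 ≤ 4 →
      ∀ k : ℤ, 1 ≤ k → k ≤ 2*(N : ℤ)+5 →
        c0^e0*c1^e1*c2^e2*c3^e3*c4^e4 ≠ q^(-k))
    (hq1 : ∀ k : ℕ, 1 ≤ k → k ≤ N → q^k ≠ 1) : Hyp q N c0 c1 c2 c3 c4 := by
  have e : q^(2*(N : ℤ)+3) = q^(2*N+3) := by norm_cast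
  rw [e] at hc0
  have qn : q^(2*N+3) ≠ 0 := pow_ne_zero _ hq
  refine ⟨hq, ?_, hc1, hc2, hc3, hc4, ?_, hq1, ?_⟩
  · rw [hc0]; apply inv_ne_zero; simp only [ne_eq, mul_eq_zero, not_or]; exact ⟨⟨⟨⟨qn, hc1⟩, hc2⟩, hc3⟩, hc4⟩
  · rw [hc0]; field_simp
  · intro e0 e1 e2 e3 e4 k a0 a1 a2 a3 a4 b1 b2 k1 k2 hh
    apply hgen e0 e1 e2 e3 e4 a0 a1 a2 a3 a4 b1 b2 (k:ℤ) (by omega) (by omega)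
    rw [zpow_neg, zpow_natCast]
    exact eq_inv_of_mul_eq_one_left hh
lemma mkSq {N : ℕ} {q s c0 c1 c2 c3 c4 t0 t1 t2 t3 t4 : ℂ}
    (hq : q ≠ 0) (hc1 : c1 ≠ 0) (hc2 : c2 ≠ 0) (hc3 : c3 ≠ 0) (hc4 : c4 ≠ 0)
    (hs : s^2 = q) (ht1 : t1^2 = c1) (ht2 : t2^2 = c2) (ht3 : t3^2 = c3)
    (ht4 : t4^2 = c4)
    (hc0 : c0 = (q^(2*(N : ℤ)+3)*c1*c2*c3*c4)⁻¹)
    (ht0 : t0 = (s^(2*(N : ℤ)+3)*t1*t2*t3*t4)⁻¹) : Sq q s c0 c1 c2 c3 c4 t0 t1 t2 t3 t4 N := by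
  have e : q^(2*(N : ℤ)+3) = q^(2*N+3) := by norm_cast
  have e' : s^(2*(N : ℤ)+3) = s^(2*N+3) := by norm_cast
  rw [e] at hc0
  rw [e'] at ht0
  have n : ∀ {a b : ℂ}, a^2 = b → b ≠ 0 → a ≠ 0 := by rintro a b h1 h2 rfl; apply h2; rw [← h1]; simp
  have n0 := n hs hq
  have n1 := n ht1 hc1
  have n2 := n ht2 hc2
  have n3 := n ht3 hc3
  have n4 := n ht4 hc4
  refine ⟨hs, ?_, ht1, ht2, ht3, ht4, ?_⟩
  · rw [ht0, hc0, ← hs, ← ht1, ← ht2, ← ht3, ← ht4, inv_pow]; congr 1; ring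
  · have := pow_ne_zero (2*N+3) n0
    rw [ht0]; field_simp
lemma mkInv {q z a b c d e : ℂ} {M : ℤ} (hz : z = q^M) (h : z*(a*b*c*d*e) = 1) : e = (q^M*b*d*a*c)⁻¹ := by
  rw [← hz]; apply eq_inv_of_mul_eq_one_left; linear_combination h
end qR
/-- Involution relation for the Griffiths polynomials of q-Racah type. -/
theorem griffiths_involution
    (N : ℕ) (q s c1 c2 c3 c4 c0 t1 t2 t3 t4 t0 : ℂ)
    (hq : q ≠ 0) (hc1 : c1 ≠ 0) (hc2 : c2 ≠ 0) (hc3 : c3 ≠ 0) (hc4 : c4 ≠ 0)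
    (hs : s ^ 2 = q) (ht1 : t1 ^ 2 = c1) (ht2 : t2 ^ 2 = c2) (ht3 : t3 ^ 2 = c3)
    (ht4 : t4 ^ 2 = c4)
    (hc0 : c0 = (q ^ (2 * (N : ℤ) + 3) * c1 * c2 * c3 * c4)⁻¹)
    (ht0 : t0 = (s ^ (2 * (N : ℤ) + 3) * t1 * t2 * t3 * t4)⁻¹)
    (hgen : ∀ e0 e1 e2 e3 e4 : ℕ, e0 ≤ 1 → e1 ≤ 1 → e2 ≤ 1 → e3 ≤ 1 → e4 ≤ 1 →
      1 ≤ e0 + e1 + e2 + e3 + e4 → e0 + e1 + e2 + e3 + e4 ≤ 4 →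
      ∀ k : ℤ, 1 ≤ k → k ≤ 2 * (N : ℤ) + 5 →
        c0 ^ e0 * c1 ^ e1 * c2 ^ e2 * c3 ^ e3 * c4 ^ e4 ≠ q ^ (-k))
    (hq1 : ∀ k : ℕ, 1 ≤ k → k ≤ N → q ^ k ≠ 1)
    (i j k l : ℕ) (hij : i + j ≤ N) (hkl : k + l ≤ N) :
    ∑ x ∈ Finset.range (N + 1), ∑ y ∈ Finset.range (N + 1 - x),
        (t1 / t0) ^ x * (t4 / t1) ^ y
          * qR.xi q c2 c4 t2 t4 (x : ℤ) * qR.xi q c0 c3 t0 t3 (y : ℤ)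
          * qR.G q s c1 c2 c3 c4 t1 t2 t3 t4 (N : ℤ) (i : ℤ) (j : ℤ) (x : ℤ) (y : ℤ)
          * qR.G q s c1 c3 c0 c2 t1 t3 t0 t2 (N : ℤ) (y : ℤ) (x : ℤ) (k : ℤ) (l : ℤ)
      = (if i = k ∧ j = l then 1 else 0)
          * qR.om q (s * t1 * t2 * t3) (N : ℤ)
          * (qR.om q (t3 * t0 * t4 / t2) (j : ℤ) / qR.om q (t2 * t3) (i : ℤ))
          * qR.xi q c2 c3 t2 t3 (i : ℤ) * qR.xi q c0 c4 t0 t4 (j : ℤ) := by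
  have H := qR.mkHyp hq hc1 hc2 hc3 hc4 hc0 hgen hq1
  have K := qR.mkSq hq hc1 hc2 hc3 hc4 hs ht1 ht2 ht3 ht4 hc0 ht0
  have M := qR.main_pp H K i j k l hij hkl
  obtain ⟨n, n0, n1, n2, n3, n4⟩ := K.ne
  have hc4' : c4 = (q^(2*(N : ℤ)+3)*c1*c3*c0*c2)⁻¹ :=
    qR.mkInv (z := q^(2*N+3)) (by norm_cast) (by linear_combination H.con)
  have ht4' : t4 = (s^(2*(N : ℤ)+3)*t1*t3*t0*t2)⁻¹ :=
    qR.mkInv (z := s^(2*N+3)) (by norm_cast) (by linear_combination K.con)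
  have wn : qR.ww q c2 c3 i ≠ 0 := by
    rw [qR.ww]
    exact div_ne_zero (mul_ne_zero (qR.kk_ne hq hc2 i) (qR.poch_one_ne H.n3 (by omega))) (qR.poch_one_ne H.n2 (by omega))
  apply mul_left_cancel₀ wn
  trans (if i = k ∧ j = l then (qR.poch q (q*c0) j/qR.poch q (q*c4) j*(t3*t4/(t0*t2))^j)*qR.kk q (s*t1*t2*t3) (N-j) else 0)
  · rw [← M]
    congr 1
    apply Finset.sum_congr rfl
    intro x hx
    have hx := Finset.mem_range.1 hx
    rw [← Finset.sum_subset (Finset.range_subset_range.2 (show N+1-x ≤ N+1 by omega))]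
    · apply Finset.sum_congr rfl
      intro y hy
      have hy := Finset.mem_range.1 hy
      rw [qR.G_pp hq H.h0 hc2 hs K.e0 ht2 hc0 ht0 i j x y hij (by omega),
        qR.G_pp hq hc4 hc3 hs ht4 ht3 hc4' ht4' y x k l (by omega) (by omega), qR.xi, qR.xi,
        Int.toNat_natCast, Int.toNat_natCast, zpow_natCast, zpow_natCast]
      have f1 : (t1*t4/(t0*t2))^x = (t1/t0)^x*(t4/t2)^x := by rw [← mul_pow]; congr 1; field_simp
      have f2 : (t3*t4/(t1*t0))^y = (t4/t1)^y*(t3/t0)^y := by rw [← mul_pow]; congr 1; field_simp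
      rw [f1, f2]
      ring
    · intro y hy hy'
      have hy' : ¬ y < N+1-x := fun h => hy' (Finset.mem_range.2 h)
      have hy := Finset.mem_range.1 hy
      have : ∑ a ∈ Finset.range (N+1), qR.kk q (t1*t2*t3/t4) a*(qR.pp q (s*t2) c1 c2 c3 (N-j) i a*qR.pp q (s*t0) c3 c0 c4 (N-a) j y
          *qR.pp q (s*t2) c4 c2 c1 (N-y) a x) = 0 := by
        apply Finset.sum_eq_zero
        intro a _
        rw [qR.pp_neg (N := N-y) (x := x) (by omega)]
        ring
      rw [this]
      ring
  · rw [qR.fin_aux H K i j hij]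
    split_ifs <;> ring
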